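/- Fix a positive integer k and an integer λ > 1, and set d = k^2 + 2 and D = λd. There exists Q such that for every prime power q ≥ Q the following holds, with n = q^k. Choose w_1, …, w_k independently and uniformly at random from F_q[X_1,…,X_k]_{≤D}, and independently choose p_{i,j} uniformly at random from F_q[X_1,…,X_k]_{≤d} for each i ∈ {1,…,k} and j ∈ {1,…,n}; set f_{i,j} = w_i + p_{i,j}. Then with probability at least 1/(4·(D^k)!), all three of the following hold simultaneously: (i) for every (j_1, …, j_k) ∈ {1,…,n}^k, the number of points x ∈ F_q^k with f_{1,j_1}(x) = ⋯ = f_{k,j_k}(x) = 0 is at most D^k; (ii) for at least n^k/(4·(D^k)!) of the tuples (j_1, …, j_k) ∈ {1,…,n}^k, the number of such common zeros is exactly D^k; and (iii) for every k pairwise distinct pairs (i_1, j_1), …, (i_k, j_k) ∈ {1,…,k} × {1,…,n} with {i_1, …, i_k} ≠ {1,…,k}, the number of points x ∈ F_q^k with f_{i_1,j_1}(x) = ⋯ = f_{i_k,j_k}(x) = 0 is at most D^k/λ. -/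

import Mathlib

section
namespace S17
open MvPolynomial

theorem prime_indep (F : Type) [Field F] (n : ℕ) : ∀ (P : Ideal (MvPolynomial (Fin n) F)) [P.IsPrime],
    ∃ (τ : ℕ) (e : Fin τ → Fin n), Function.Injective e ∧
      (∀ h : MvPolynomial (Fin τ) F, rename e h ∈ P → h = 0) ∧
      (n : ℕ∞) ≤ τ + P.height := by
  induction n with
  | zero =>
    intro P _
    refine ⟨0, id, Function.injective_id, ?_, by simp⟩
    intro h hh
    have h1 : h ∈ P := by simpa using hh
    by_contra hne
    apply (inferInstance : P.IsPrime).ne_top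
    rw [Ideal.eq_top_iff_one]
    have : h = C (coeff 0 h) := eq_C_of_isEmpty h
    have hc : coeff 0 h ≠ 0 := by
      intro h0; rw [h0] at this; simp at this; exact hne this
    have : C (coeff 0 h)⁻¹ * h ∈ P := P.mul_mem_left _ h1
    rw [eq_C_of_isEmpty h, ← C_mul] at this
    simpa [hc] using this
  | succ n ih =>
    intro P hP
    let E := MvPolynomial.finSuccEquiv F n
    let P' : Ideal (Polynomial (MvPolynomial (Fin n) F)) := P.comap (E.symm : _ →+* _)
    have hmem : ∀ x, x ∈ P ↔ E x ∈ P' := by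
      intro x; simp [P', Ideal.mem_comap]
    have hht : P'.height = P.height := RingEquiv.height_comap E.symm.toRingEquiv P
    let p : Ideal (MvPolynomial (Fin n) F) := P'.comap Polynomial.C
    have hP' : P'.IsPrime := Ideal.comap_isPrime _ _
    have hp : p.IsPrime := Ideal.comap_isPrime _ _
    obtain ⟨τ, e, he, hind, hdim⟩ := ih p
    have hle : p.map Polynomial.C ≤ P' := Ideal.map_comap_le
    have hq : (p.map Polynomial.C).IsPrime := Ideal.isPrime_map_C_of_isPrime
    have hh1 : p.height ≤ (p.map Polynomial.C).height := by
      have : (p.map (Polynomial.C : _ →+* Polynomial (MvPolynomial (Fin n) F))).LiesOver p := by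
        constructor
        ext x
        simp only [Ideal.under, Ideal.mem_comap, Polynomial.algebraMap_eq]
        constructor
        · exact fun h => Ideal.mem_map_of_mem _ h
        · intro h
          have := Ideal.mem_map_C_iff.1 h 0
          simpa using this
      rw [Ideal.height_eq_height_add_of_liesOver_of_hasGoingDown p (p.map Polynomial.C)]
      exact le_self_add
    by_cases heq : p.map Polynomial.C = P'
    · refine ⟨τ + 1, Fin.cons 0 (fun i => (e i).succ), ?_, ?_, ?_⟩
      · rw [Fin.cons_injective_iff]
        refine ⟨?_, fun a b h => he (Fin.succ_injective _ h)⟩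
        rintro ⟨x, hx⟩; exact Fin.succ_ne_zero _ hx
      · intro h hh
        rw [hmem] at hh
        have key : E (rename (Fin.cons 0 (fun i => (e i).succ)) h)
            = Polynomial.map (rename e : _ →ₐ[F] _).toRingHom (MvPolynomial.finSuccEquiv F τ h) := by
          have : (E.toAlgHom.comp (rename (Fin.cons 0 (fun i => (e i).succ)) : MvPolynomial (Fin (τ+1)) F →ₐ[F] _))
             = (Polynomial.mapAlgHom (rename e : MvPolynomial (Fin τ) F →ₐ[F] _)).comp (MvPolynomial.finSuccEquiv F τ).toAlgHom := by
            apply MvPolynomial.algHom_ext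
            intro i
            refine Fin.cases ?_ (fun i => ?_) i
            · simp [E, finSuccEquiv_X_zero]
            · simp [E, finSuccEquiv_X_succ]
          exact DFunLike.congr_fun this h
        rw [key, ← heq, Ideal.mem_map_C_iff] at hh
        have : MvPolynomial.finSuccEquiv F τ h = 0 := by
          ext1 i
          rw [Polynomial.coeff_zero]
          apply hind
          have := hh i
          rw [Polynomial.coeff_map] at this
          exact this
        exact (map_eq_zero_iff _ (MvPolynomial.finSuccEquiv F τ).injective).1 this
      · rw [← hht, ← heq]
        push_cast
        calc (n : ℕ∞) + 1 ≤ τ + p.height + 1 := by gcongr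
          _ ≤ τ + (p.map Polynomial.C).height + 1 := by gcongr
          _ = _ := by ring
    · refine ⟨τ, fun i => (e i).succ, fun a b h => he (Fin.succ_injective _ h), ?_, ?_⟩
      · intro h hh
        rw [hmem] at hh
        have key : E (rename (fun i => (e i).succ) h) = Polynomial.C (rename e h) := by
          have : (E.toAlgHom.comp (rename (fun i => (e i).succ) : MvPolynomial (Fin τ) F →ₐ[F] _))
             = (Polynomial.CAlgHom).comp (rename e : MvPolynomial (Fin τ) F →ₐ[F] _) := by
            apply MvPolynomial.algHom_ext
            intro i
            simp [E, finSuccEquiv_X_succ]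
          exact DFunLike.congr_fun this h
        rw [key] at hh
        exact hind h hh
      · have := Ideal.height_add_one_le_of_lt_of_isPrime (lt_of_le_of_ne hle heq)
        rw [← hht]
        push_cast
        calc (n : ℕ∞) + 1 ≤ τ + p.height + 1 := by gcongr
          _ ≤ τ + (p.map Polynomial.C).height + 1 := by gcongr
          _ = τ + ((p.map Polynomial.C).height + 1) := by ring
          _ ≤ _ := by gcongr
end S17
end

section
namespace S17
open MvPolynomial

instance finS (k : ℕ) (F : Type) [Field F] (N : ℕ) : Module.Finite F (restrictTotalDegree (Fin k) F N) := by
  have hf : {s : Fin k →₀ ℕ | s.degree ≤ N}.Finite := Finsupp.finite_of_degree_le N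
  have : Finite {s : Fin k →₀ ℕ | (s.sum fun _ e => e) ≤ N} := hf.to_subtype
  exact Module.Finite.of_basis (basisRestrictSupport F {s : Fin k →₀ ℕ | (s.sum fun _ e => e) ≤ N})

theorem finrank_S (k : ℕ) (F : Type) [Field F] (N : ℕ) :
    Module.finrank F (restrictTotalDegree (Fin k) F N) = (N + k).choose k := by
  have h1' : Module.finrank F (restrictTotalDegree (Fin k) F N) = Nat.card {s : Fin k →₀ ℕ | (s.sum fun _ e => e) ≤ N} :=
    Module.finrank_eq_nat_card_basis (basisRestrictSupport F {s : Fin k →₀ ℕ | (s.sum fun _ e => e) ≤ N})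
  rw [h1']
  let φ : {s : Fin k →₀ ℕ | (s.sum fun _ e => e) ≤ N} → {P : Fin (k+1) → ℕ // ∑ i, P i = N} :=
    fun s => ⟨Fin.cons (N - ∑ i, s.1 i) s.1, by
      have := s.2
      simp only [Set.mem_ofPred_eq] at this
      rw [Finsupp.sum_fintype _ _ (by simp)] at this
      rw [Fin.sum_univ_succ]; simp; omega⟩
  have hφ : Function.Bijective φ := by
    constructor
    · intro a b hab
      have h := congrArg Subtype.val hab
      simp only [φ] at h
      apply Subtype.ext
      apply DFunLike.coe_injective
      have := congrArg Fin.tail h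
      simpa [Fin.tail_cons] using this
    · rintro ⟨P, hP⟩
      rw [Fin.sum_univ_succ] at hP
      refine ⟨⟨Finsupp.equivFunOnFinite.symm (Fin.tail P), ?_⟩, ?_⟩
      · simp only [Set.mem_ofPred_eq]
        rw [Finsupp.sum_fintype _ _ (by simp)]
        simp [Fin.tail]; omega
      · apply Subtype.ext
        simp only [φ]
        funext i
        refine Fin.cases ?_ (fun i => ?_) i
        · simp [Fin.tail]; omega
        · simp [Fin.tail]
  have e : Sym (Fin (k+1)) N ≃ {P : Fin (k+1) → ℕ // ∑ i, P i = N} := Sym.equivNatSumOfFintype (Fin (k+1)) N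
  rw [Nat.card_eq_of_bijective φ hφ, ← Nat.card_congr e, Nat.card_eq_fintype_card (α := Sym (Fin (k+1)) N), Sym.card_sym_eq_choose, Fintype.card_fin]
  have h3 : k + 1 + N - 1 = N + k := by omega
  rw [h3, Nat.choose_symm_add]

theorem finrank_S_le (k : ℕ) (F : Type) [Field F] (N : ℕ) :
    k.factorial * Module.finrank F (restrictTotalDegree (Fin k) F N) ≤ (N + k) ^ k := by
  rw [finrank_S, ← Nat.descFactorial_eq_factorial_mul_choose]
  exact Nat.descFactorial_le_pow _ _

theorem le_finrank_S (k : ℕ) (F : Type) [Field F] (N : ℕ) :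
    N ^ k ≤ k.factorial * Module.finrank F (restrictTotalDegree (Fin k) F N) := by
  rw [finrank_S, ← Nat.descFactorial_eq_factorial_mul_choose]
  refine le_trans ?_ (Nat.pow_sub_le_descFactorial _ _)
  exact Nat.pow_le_pow_left (by omega) _

variable {k : ℕ} {F : Type} [Field F]

noncomputable def hil (J : Ideal (MvPolynomial (Fin k) F)) (N : ℕ) : Submodule F (MvPolynomial (Fin k) F ⧸ J) :=
  (restrictTotalDegree (Fin k) F N).map (Ideal.Quotient.mkₐ F J).toLinearMap

noncomputable def H (J : Ideal (MvPolynomial (Fin k) F)) (N : ℕ) : ℕ := Module.finrank F (hil J N)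

instance (J : Ideal (MvPolynomial (Fin k) F)) (N : ℕ) : Module.Finite F (hil J N) := by
  unfold hil; infer_instance

theorem H_step (J J' : Ideal (MvPolynomial (Fin k) F)) (f : MvPolynomial (Fin k) F) (e N : ℕ)
    (hf : f.totalDegree ≤ e) (hnz : ∀ h, f * h ∈ J → h ∈ J) (hJ : J ≤ J') (hfJ : f ∈ J') (heN : e ≤ N) :
    H J' N + H J (N - e) ≤ H J N := by
  let π : (MvPolynomial (Fin k) F ⧸ J) →ₗ[F] (MvPolynomial (Fin k) F ⧸ J') :=
    (Ideal.Quotient.factorₐ F hJ).toLinearMap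
  let g := π.domRestrict (hil J N)
  have h1 := LinearMap.finrank_range_add_finrank_ker g
  have h2 : LinearMap.range g = hil J' N := by
    rw [LinearMap.range_domRestrict, hil, hil, ← Submodule.map_comp]
    congr 1
  have h3 : H J (N - e) ≤ Module.finrank F (LinearMap.ker g) := by
    let μ : (MvPolynomial (Fin k) F ⧸ J) →ₗ[F] (MvPolynomial (Fin k) F ⧸ J) :=
      LinearMap.mulLeft F (Ideal.Quotient.mk J f)
    have hμ : Function.Injective μ := by
      rw [← LinearMap.ker_eq_bot, LinearMap.ker_eq_bot']
      intro x hx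
      obtain ⟨x, rfl⟩ := Ideal.Quotient.mk_surjective x
      simp only [μ, LinearMap.mulLeft_apply, ← map_mul, Ideal.Quotient.eq_zero_iff_mem] at hx ⊢
      exact hnz _ hx
    have hmap : ∀ x ∈ hil J (N - e), μ x ∈ hil J N := by
      rintro _ ⟨x, hx, rfl⟩
      refine ⟨f * x, ?_, ?_⟩
      · have hx' : x.totalDegree ≤ N - e := by
          simpa [mem_restrictTotalDegree] using hx
        show f * x ∈ restrictTotalDegree (Fin k) F N
        rw [mem_restrictTotalDegree]
        refine (totalDegree_mul _ _).trans (by omega)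
      · simp [μ]
    let ν : hil J (N - e) →ₗ[F] LinearMap.ker g :=
      LinearMap.codRestrict _ (LinearMap.restrict μ hmap) (by
        rintro ⟨_, x, hx, rfl⟩
        simp only [LinearMap.mem_ker]
        change π (μ (Ideal.Quotient.mkₐ F J x)) = 0
        have : (Ideal.Quotient.factorₐ F hJ) ((Ideal.Quotient.mk J f) * (Ideal.Quotient.mk J x)) = 0 := by
          rw [map_mul]
          have : (Ideal.Quotient.factorₐ F hJ) ((Ideal.Quotient.mk J f)) = 0 := by
            show Ideal.Quotient.mk J' f = 0
            exact Ideal.Quotient.eq_zero_iff_mem.2 hfJ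
          rw [this, zero_mul]
        exact this)
    refine LinearMap.finrank_le_finrank_of_injective (f := ν) ?_
    intro a b hab
    apply Subtype.ext
    apply hμ
    exact congrArg (fun z => ((z : LinearMap.ker g) : hil J N).1) hab
  have h4 : Module.finrank F (LinearMap.range g) = H J' N := by rw [h2]; rfl
  unfold H at *
  omega

/-- growth of Hilbert function -/
def Growth (J : Ideal (MvPolynomial (Fin k) F)) (τ α β : ℕ) : Prop :=
  ∃ N0, ∀ N ≥ N0, α * (N - N0) ^ τ ≤ β * (τ.factorial * H J N)

theorem pow_succ_sub_le (τ e x : ℕ) : (x + e) ^ (τ + 1) ≤ x ^ (τ + 1) + (τ + 1) * e * (x + e) ^ τ := by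
  induction τ with
  | zero => simp
  | succ τ ih =>
    have h1 : x ^ (τ+1) ≤ (x+e)^(τ+1) := Nat.pow_le_pow_left (by omega) _
    calc (x+e)^(τ+1+1) = (x+e)^(τ+1) * (x + e) := by ring
      _ = (x+e)^(τ+1) * x + (x+e)^(τ+1)*e := by ring
      _ ≤ (x ^ (τ + 1) + (τ + 1) * e * (x + e) ^ τ) * x + (x+e)^(τ+1)*e := by gcongr
      _ = x^(τ+1+1) + (τ+1)*e*((x+e)^τ * x) + (x+e)^(τ+1)*e := by ring
      _ ≤ x^(τ+1+1) + (τ+1)*e*((x+e)^τ * (x+e)) + (x+e)^(τ+1)*e := by gcongr; omega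
      _ = _ := by ring

theorem Growth_step (J J' : Ideal (MvPolynomial (Fin k) F)) (f : MvPolynomial (Fin k) F) (e : ℕ)
    (he : 0 < e)
    (hf : f.totalDegree ≤ e) (hnz : ∀ h, f * h ∈ J → h ∈ J) (hJ : J ≤ J') (hfJ : f ∈ J')
    (τ α β : ℕ) (hg : Growth J' τ α β) : Growth J (τ + 1) α (β * e) := by
  obtain ⟨N0, hN0⟩ := hg
  refine ⟨N0 + e, ?_⟩
  have key : ∀ x, α * x ^ (τ + 1) ≤ (β * e) * ((τ + 1).factorial * H J (N0 + e + x)) := by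
    intro x
    induction x using Nat.strong_induction_on with
    | _ x ih =>
      have hs := H_step J J' f e (N0 + e + x) hf hnz hJ hfJ (by omega)
      have hg := hN0 (N0 + e + x) (by omega)
      have hx : N0 + e + x - N0 = x + e := by omega
      rw [hx] at hg
      by_cases hxe : e ≤ x
      · have ih' := ih (x - e) (by omega)
        have e1 : N0 + e + (x - e) = N0 + e + x - e := by omega
        rw [e1] at ih'
        have hp := pow_succ_sub_le τ e (x - e)
        have e2 : x - e + e = x := by omega
        rw [e2] at hp
        have hx2 : x ^ τ ≤ (x + e) ^ τ := Nat.pow_le_pow_left (by omega) _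
        calc α * x ^ (τ+1) ≤ α * ((x-e)^(τ+1) + (τ+1)*e*x^τ) := by gcongr
          _ = α * (x-e)^(τ+1) + (τ+1)*e*(α * x^τ) := by ring
          _ ≤ β * e * ((τ + 1).factorial * H J (N0 + e + x - e)) + (τ+1)*e*(α * (x+e)^τ) := by gcongr
          _ ≤ β * e * ((τ + 1).factorial * H J (N0 + e + x - e)) + (τ+1)*e*(β * (τ.factorial * H J' (N0 + e + x))) := by gcongr
          _ = β * e * ((τ + 1).factorial * (H J' (N0 + e + x) + H J (N0 + e + x - e))) := by
            rw [Nat.factorial_succ]; ring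
          _ ≤ _ := by gcongr
      · have : x ^ (τ+1) ≤ (τ+1) * e * (x+e)^τ := by
          calc x ^ (τ+1) = x * x^τ := by ring
            _ ≤ ((τ+1) * e) * (x+e)^τ := by
              gcongr
              · nlinarith
              · omega
        calc α * x ^ (τ+1) ≤ α * ((τ+1) * e * (x+e)^τ) := by gcongr
          _ = (τ+1)*e*(α * (x+e)^τ) := by ring
          _ ≤ (τ+1)*e*(β * (τ.factorial * H J' (N0 + e + x))) := by gcongr
          _ = β * e * ((τ + 1).factorial * (H J' (N0 + e + x))) := by
            rw [Nat.factorial_succ]; ring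
          _ ≤ _ := by gcongr; omega
  intro N hN
  have := key (N - (N0 + e))
  rwa [show N0 + e + (N - (N0 + e)) = N by omega] at this

theorem H_bot_le (N : ℕ) : k.factorial * H (⊥ : Ideal (MvPolynomial (Fin k) F)) N ≤ (N + k) ^ k := by
  refine le_trans ?_ (finrank_S_le k F N)
  gcongr
  exact Submodule.finrank_map_le _ _

theorem Growth_bot (α β : ℕ) (h : Growth (⊥ : Ideal (MvPolynomial (Fin k) F)) k α β) : α ≤ β := by
  obtain ⟨N0, h⟩ := h
  by_contra hlt
  push Not at hlt
  have h1 : ∀ x : ℕ, α * x ^ k ≤ β * (x + (N0 + k)) ^ k := by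
    intro x
    have := h (N0 + x) (by omega)
    rw [show N0 + x - N0 = x by omega] at this
    refine this.trans ?_
    have h2 := H_bot_le (k := k) (F := F) (N0 + x)
    calc _ ≤ β * (N0 + x + k)^k := by gcongr
      _ = _ := by ring
  -- (x + c)^k ≤ (1+c/x)^k x^k
  have h3 : Filter.Tendsto (fun x : ℕ => (β:ℝ) * (1 + ((N0 + k : ℕ):ℝ) / x) ^ k) Filter.atTop (nhds (β * (1 + 0)^k)) := by
    refine Filter.Tendsto.const_mul _ (Filter.Tendsto.pow ?_ _)
    refine Filter.Tendsto.const_add _ ?_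
    exact tendsto_const_div_atTop_nhds_zero_nat _
  have h4 : (α : ℝ) ≤ β * (1+0)^k := by
    refine ge_of_tendsto h3 ?_
    filter_upwards [Filter.eventually_gt_atTop 0] with x hx
    have hx' : (0:ℝ) < x := by exact_mod_cast hx
    have h5 : (α:ℝ) * x^k ≤ β * (x + ((N0 + k : ℕ):ℝ))^k := by exact_mod_cast h1 x
    have h6 : (x + ((N0 + k : ℕ):ℝ)) = (1 + ((N0 + k : ℕ):ℝ)/x) * x := by field_simp
    rw [h6, mul_pow, ← mul_assoc] at h5
    exact le_of_mul_le_mul_right h5 (by positivity)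
  simp at h4
  omega
end S17
end

section
namespace S17
open MvPolynomial
variable {k : ℕ} {F : Type} [Field F]

theorem Growth_primes (J : Ideal (MvPolynomial (Fin k) F)) {ι : Type} [Fintype ι] [DecidableEq ι]
    (P : ι → Ideal (MvPolynomial (Fin k) F)) (hP : ∀ i, (P i).IsPrime)
    (hJ : ∀ i, J ≤ P i) (hinc : ∀ i j, P i ≤ P j → i = j) (τ : ℕ)
    (e : ι → Fin τ → Fin k) (he : ∀ i h, rename (e i) h ∈ P i → h = (0 : MvPolynomial (Fin τ) F)) :
    Growth J τ (Fintype.card ι) 1 := by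
  have hg : ∀ i, ∃ g, g ∉ P i ∧ ∀ j, j ≠ i → g ∈ P j := by
    intro i
    have h1 : ∀ j, ∃ a, j ≠ i → a ∈ P j ∧ a ∉ P i := by
      intro j
      by_cases hij : j = i
      · exact ⟨0, fun h => absurd hij h⟩
      · have : ¬ P j ≤ P i := fun h => hij (hinc _ _ h)
        obtain ⟨a, ha, hb⟩ := SetLike.not_le_iff_exists.1 this
        exact ⟨a, fun _ => ⟨ha, hb⟩⟩
    choose a ha using h1
    refine ⟨∏ j ∈ Finset.univ.erase i, a j, ?_, ?_⟩
    · intro hmem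
      have := hP i
      obtain ⟨j, hj, hj'⟩ := (Ideal.IsPrime.prod_mem_iff).1 hmem
      exact (ha j (Finset.ne_of_mem_erase hj)).2 hj'
    · intro j hj
      exact Ideal.mem_of_dvd _ (Finset.dvd_prod_of_mem _ (Finset.mem_erase.2 ⟨hj, Finset.mem_univ _⟩)) (ha j hj).1
  choose g hg1 hg2 using hg
  refine ⟨Finset.univ.sup (fun i => (g i).totalDegree), fun N hN => ?_⟩
  set N0 := Finset.univ.sup (fun i => (g i).totalDegree) with hN0
  let Φ : (ι → restrictTotalDegree (Fin τ) F (N - N0)) →ₗ[F] MvPolynomial (Fin k) F ⧸ J :=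
    (Ideal.Quotient.mkₐ F J).toLinearMap ∘ₗ
      ∑ i, (LinearMap.mulLeft F (g i)) ∘ₗ (rename (e i)).toLinearMap ∘ₗ (Submodule.subtype _) ∘ₗ LinearMap.proj i
  have hΦ : ∀ h, Φ h = Ideal.Quotient.mk J (∑ i, g i * rename (e i) (h i).1) := by
    intro h
    simp [Φ]
  have hmem : ∀ h, Φ h ∈ hil J N := by
    intro h
    rw [hΦ]
    refine ⟨∑ i, g i * rename (e i) (h i).1, ?_, rfl⟩
    refine Submodule.sum_mem _ fun i _ => ?_
    rw [mem_restrictTotalDegree]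
    refine (totalDegree_mul _ _).trans ?_
    have h1 : (g i).totalDegree ≤ N0 := Finset.le_sup (f := fun i => (g i).totalDegree) (Finset.mem_univ i)
    have h2 := (h i).2
    rw [mem_restrictTotalDegree] at h2
    have h3 := totalDegree_rename_le (e i) (h i).1
    omega
  have hinj : Function.Injective Φ := by
    rw [← LinearMap.ker_eq_bot, LinearMap.ker_eq_bot']
    intro h hh
    rw [hΦ, Ideal.Quotient.eq_zero_iff_mem] at hh
    funext i
    have h1 := hJ i hh
    rw [← Finset.add_sum_erase _ _ (Finset.mem_univ i)] at h1
    have h2 : ∑ j ∈ Finset.univ.erase i, g j * rename (e j) (h j).1 ∈ P i := by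
      refine Ideal.sum_mem _ fun j hj => ?_
      exact Ideal.mul_mem_right _ _ (hg2 j i (Finset.ne_of_mem_erase hj).symm)
    have h3 := (Ideal.add_mem_iff_left _ h2).1 h1
    have h4 := ((hP i).mem_or_mem h3).resolve_left (hg1 i)
    apply Subtype.ext
    exact he i _ h4
  have hfin := LinearMap.finrank_le_finrank_of_injective (f := Φ.codRestrict (hil J N) hmem)
    (fun a b hab => hinj (congrArg Subtype.val hab))
  rw [Module.finrank_pi_fintype] at hfin
  simp only [Finset.sum_const, Finset.card_univ, smul_eq_mul] at hfin
  calc Fintype.card ι * (N - N0) ^ τ ≤ Fintype.card ι * (τ.factorial * Module.finrank F (restrictTotalDegree (Fin τ) F (N - N0))) := by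
        gcongr; exact le_finrank_S _ _ _
    _ = τ.factorial * (Fintype.card ι * Module.finrank F (restrictTotalDegree (Fin τ) F (N - N0))) := by ring
    _ ≤ τ.factorial * H J N := by gcongr; exact hfin
    _ = _ := by ring

/-- initial ideals -/
noncomputable def II (f : Fin k → MvPolynomial (Fin k) F) (s : ℕ) : Ideal (MvPolynomial (Fin k) F) :=
  Ideal.span (f '' {i | i.val < s})

def Bad (f : Fin k → MvPolynomial (Fin k) F) (s : Fin k) : Prop :=
  ∃ P ∈ (II f s.val).minimalPrimes, f s ∈ P

theorem Growth_chain (f : Fin k → MvPolynomial (Fin k) F) (e : Fin k → ℕ) (he : ∀ i, 0 < e i)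
    (hfe : ∀ i, (f i).totalDegree ≤ e i) (s : ℕ) (hs : s ≤ k) (hbad : ∀ i : Fin k, i.val < s → ¬ Bad f i)
    (α : ℕ) (hG : Growth (II f s).radical (k - s) α 1) : α ≤ ∏ i, e i := by
  have key : ∀ r, r ≤ s → Growth (II f (s - r)).radical (k - (s - r)) α
      (∏ i ∈ Finset.univ.filter (fun i : Fin k => s - r ≤ i.val ∧ i.val < s), e i) := by
    intro r
    induction r with
    | zero =>
      intro _
      have : (Finset.univ.filter (fun i : Fin k => s - 0 ≤ i.val ∧ i.val < s)) = ∅ := by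
        ext i; simp
      rw [this]; simpa using hG
    | succ r ih =>
      intro hr
      have ih := ih (by omega)
      have hlt : s - (r + 1) < k := by omega
      set j : Fin k := ⟨s - (r+1), hlt⟩ with hj
      have hsr : s - r = (s - (r+1)) + 1 := by omega
      have := Growth_step (II f (s - (r+1))).radical (II f (s - r)).radical (f j) (e j) (he j) (hfe j)
        (by
          intro h hh
          rw [← Ideal.sInf_minimalPrimes, Submodule.mem_sInf] at hh ⊢
          intro P hP
          have hPp : Ideal.IsPrime P := hP.1.1
          refine (hPp.mem_or_mem (hh P hP)).resolve_left fun hc => ?_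
          exact hbad j (by simp [hj]; omega) ⟨P, hP, hc⟩)
        (by
          apply Ideal.radical_mono
          apply Ideal.span_mono
          apply Set.image_mono
          intro i hi
          simp only [Set.mem_ofPred_eq] at hi ⊢
          omega)
        (by
          apply Ideal.le_radical
          apply Ideal.subset_span
          refine ⟨j, ?_, rfl⟩
          simp [hj]; omega) _ _ _ ih
      have e1 : k - (s - r) + 1 = k - (s - (r + 1)) := by omega
      rw [e1] at this
      convert this using 1
      have : (Finset.univ.filter (fun i : Fin k => s - (r+1) ≤ i.val ∧ i.val < s)) =
        insert j (Finset.univ.filter (fun i : Fin k => s - r ≤ i.val ∧ i.val < s)) := by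
        ext i
        simp only [Finset.mem_filter, Finset.mem_univ, true_and, Finset.mem_insert, hj, Fin.ext_iff]
        omega
      rw [this, Finset.prod_insert, mul_comm]
      simp [hj]; omega
  have h0 := key s le_rfl
  have e2 : (II f (s - s)).radical = ⊥ := by
    rw [II]
    have : (f '' {i : Fin k | i.val < s - s}) = ∅ := by simp
    rw [this, Ideal.span_empty]
    exact (Ideal.isPrime_bot).isRadical.radical
  rw [e2] at h0
  rw [show k - (s - s) = k by omega] at h0
  refine (Growth_bot _ _ h0).trans ?_
  refine Finset.prod_le_prod_of_subset_of_one_le' (Finset.filter_subset _ _) fun i _ _ => he i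

theorem II_height (f : Fin k → MvPolynomial (Fin k) F) (s : ℕ) (hs : s ≤ k)
    (P : Ideal (MvPolynomial (Fin k) F)) (hP : P ∈ (II f s).minimalPrimes) :
    ∃ e : Fin (k - s) → Fin k, Function.Injective e ∧ ∀ h : MvPolynomial (Fin (k-s)) F, rename e h ∈ P → h = 0 := by
  have hPp : Ideal.IsPrime P := hP.1.1
  obtain ⟨τ, e, hei, he, hτ⟩ := prime_indep F _ P
  have hfin : (f '' {i | i.val < s}).Finite := Set.toFinite _
  have h1 : P.height ≤ ((f '' {i : Fin k | i.val < s}).ncard : ℕ∞) :=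
    Ideal.height_le_card_of_mem_minimalPrimes_span hfin hP
  have h2 : (f '' {i : Fin k | i.val < s}).ncard ≤ s := by
    refine (Set.ncard_image_le (Set.toFinite _)).trans ?_
    have : Set.InjOn (fun i : Fin k => i.val) {i : Fin k | i.val < s} := fun a _ b _ h => Fin.ext h
    rw [← this.ncard_image]
    have h3 : ((fun i : Fin k => i.val) '' {i | i.val < s}) ⊆ (Finset.range s : Set ℕ) := by
      rintro _ ⟨i, hi, rfl⟩; simpa using hi
    refine (Set.ncard_le_ncard h3).trans ?_
    simp
  have h3 : (k : ℕ∞) ≤ τ + s := hτ.trans (by gcongr; exact h1.trans (by exact_mod_cast h2))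
  have h4 : k ≤ τ + s := by exact_mod_cast h3
  refine ⟨e ∘ Fin.castLE (by omega), hei.comp (Fin.castLE_injective _), fun h hh => ?_⟩
  rw [← rename_rename] at hh
  have := he _ hh
  exact rename_injective _ (Fin.castLE_injective _) (by simpa using this)

theorem minimalPrimes_card (f : Fin k → MvPolynomial (Fin k) F) (e : Fin k → ℕ) (he : ∀ i, 0 < e i)
    (hfe : ∀ i, (f i).totalDegree ≤ e i) (s : ℕ) (hs : s ≤ k) (hbad : ∀ i : Fin k, i.val < s → ¬ Bad f i) :
    (II f s).minimalPrimes.ncard ≤ ∏ i, e i := by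
  classical
  have hfin : (II f s).minimalPrimes.Finite := Ideal.finite_minimalPrimes_of_isNoetherianRing _ _
  have := hfin.fintype
  apply Growth_chain f e he hfe s hs hbad
  have h1 := fun P : (II f s).minimalPrimes => II_height f s hs P.1 P.2
  choose ee he1 he2 using h1
  have := Growth_primes (II f s).radical (fun P : (II f s).minimalPrimes => P.1) (fun P => P.2.1.1)
    (fun P => by
      have hp : P.1.IsPrime := P.2.1.1
      rw [hp.radical_le_iff]; exact P.2.1.2)
    (fun P P' h => Subtype.ext (le_antisymm h (P'.2.2 P.2.1 h))) (k - s) ee he2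
  rwa [← Nat.card_eq_fintype_card] at this

theorem points_card [Finite F] (f : Fin k → MvPolynomial (Fin k) F) (e : Fin k → ℕ) (he : ∀ i, 0 < e i)
    (hfe : ∀ i, (f i).totalDegree ≤ e i) (hbad : ∀ i : Fin k, ¬ Bad f i) :
    Nat.card {x : Fin k → F // ∀ i, eval x (f i) = 0} ≤ ∏ i, e i := by
  classical
  have := Fintype.ofFinite {x : Fin k → F // ∀ i, eval x (f i) = 0}
  apply Growth_chain f e he hfe k le_rfl (fun i _ => hbad i)
  have hp : ∀ x : {x : Fin k → F // ∀ i, eval x (f i) = 0}, (RingHom.ker (eval x.1)).IsPrime := fun x => RingHom.ker_isPrime _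
  have := Growth_primes (II f k).radical (fun x : {x : Fin k → F // ∀ i, eval x (f i) = 0} => RingHom.ker (eval x.1))
    hp
    (fun x => by
      rw [(hp x).radical_le_iff, II, Ideal.span_le]
      rintro _ ⟨i, _, rfl⟩
      exact x.2 i)
    (fun x y h => by
      apply Subtype.ext
      funext i
      have : X i - C (x.1 i) ∈ RingHom.ker (eval y.1) := h (by simp [RingHom.mem_ker])
      simp [RingHom.mem_ker, sub_eq_zero] at this
      exact this.symm) 0 (fun _ => Fin.elim0)
    (fun x h hh => by
      obtain ⟨c, rfl⟩ := C_surjective (Fin 0) h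
      simp [RingHom.mem_ker] at hh
      simp [hh])
  rw [Nat.card_eq_fintype_card, Nat.sub_self]
  exact this
end S17
end

section
namespace S17
open MvPolynomial
variable {k : ℕ} {F : Type} [Field F]

theorem count_fiber {k : ℕ} {X : Type} [Finite X] [Nonempty X] (B : Set (Fin k → X)) (s : Fin k) (c C : ℕ)
    (h : ∀ p : Fin k → X, Nat.card {x : X // Function.update p s x ∈ B} * c ≤ C * Nat.card X) :
    Nat.card B * c ≤ C * Nat.card X ^ k := by
  classical
  have := Fintype.ofFinite X
  let E : (Fin k → X) × X ≃ (Fin k → X) × X :=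
    { toFun := fun px => (Function.update px.1 s px.2, px.1 s)
      invFun := fun px => (Function.update px.1 s px.2, px.1 s)
      left_inv := fun px => by simp
      right_inv := fun px => by simp }
  have e1 : {px : (Fin k → X) × X // Function.update px.1 s px.2 ∈ B} ≃ B × X :=
    (Equiv.subtypeEquiv (q := fun py : (Fin k → X) × X => py.1 ∈ B) E (fun px => Iff.rfl)).trans
     { toFun := fun x => (⟨x.1.1, x.2⟩, x.1.2)
       invFun := fun x => ⟨(x.1.1, x.2), x.1.2⟩
       left_inv := fun x => rfl
       right_inv := fun x => rfl }
  have e2 : {px : (Fin k → X) × X // Function.update px.1 s px.2 ∈ B} ≃ Σ p : Fin k → X, {x : X // Function.update p s x ∈ B} :=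
    { toFun := fun x => ⟨x.1.1, x.1.2, x.2⟩
      invFun := fun x => ⟨(x.1, x.2.1), x.2.2⟩
      left_inv := fun x => rfl
      right_inv := fun x => rfl }
  have h1 : Nat.card B * Nat.card X = ∑ p : Fin k → X, Nat.card {x : X // Function.update p s x ∈ B} := by
    rw [← Nat.card_prod, ← Nat.card_congr e1, Nat.card_congr e2, Nat.card_sigma]
  have h2 : (Nat.card B * c) * Nat.card X ≤ (C * Nat.card X ^ k) * Nat.card X := by
    calc (Nat.card B * c) * Nat.card X = (Nat.card B * Nat.card X) * c := by ring
      _ = ∑ p : Fin k → X, Nat.card {x : X // Function.update p s x ∈ B} * c := by rw [h1, Finset.sum_mul]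
      _ ≤ ∑ p : Fin k → X, C * Nat.card X := Finset.sum_le_sum fun p _ => h p
      _ = _ := by simp [Nat.card_eq_fintype_card]; ring
  exact Nat.le_of_mul_le_mul_right h2 Nat.card_pos

instance finiteS [Finite F] (N : ℕ) : Finite (restrictTotalDegree (Fin k) F N) := Module.finite_of_finite F

theorem count_prime [Fintype F] (d : ℕ) (P : Ideal (MvPolynomial (Fin k) F)) (τ : ℕ) (hτ : 0 < τ) (e : Fin τ → Fin k)
    (he : ∀ h : MvPolynomial (Fin τ) F, rename e h ∈ P → h = 0) (g : MvPolynomial (Fin k) F) :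
    Nat.card {p : restrictTotalDegree (Fin k) F d // g + p.1 ∈ P} * Fintype.card F ^ (d + 1) ≤
      Nat.card (restrictTotalDegree (Fin k) F d) := by
  classical
  let i0 : Fin τ := ⟨0, hτ⟩
  let u : (Fin (d+1) → F) → MvPolynomial (Fin τ) F := fun c => ∑ j, monomial (Finsupp.single i0 j.val) (c j)
  have hu : ∀ c j, coeff (Finsupp.single i0 (j : Fin (d+1)).val) (u c) = c j := by
    intro c j
    simp only [u, coeff_sum, coeff_monomial]
    rw [Finset.sum_eq_single j]
    · simp
    · intro b _ hb
      rw [if_neg]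
      intro h
      exact hb (Fin.ext (Finsupp.single_injective _ h))
    · simp
  have hud : ∀ c, (u c).totalDegree ≤ d := by
    intro c
    refine totalDegree_finsetSum_le fun j _ => ?_
    refine (totalDegree_monomial_le _ _).trans ?_
    simp; omega
  let Φ : {p : restrictTotalDegree (Fin k) F d // g + p.1 ∈ P} × (Fin (d+1) → F) → restrictTotalDegree (Fin k) F d :=
    fun x => ⟨x.1.1.1 + rename e (u x.2), by
      refine Submodule.add_mem _ x.1.1.2 ?_
      rw [mem_restrictTotalDegree]
      exact (totalDegree_rename_le _ _).trans (hud _)⟩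
  have hΦ : Function.Injective Φ := by
    rintro ⟨⟨⟨p, hp⟩, hp'⟩, c⟩ ⟨⟨⟨p2, hp2⟩, hp2'⟩, c2⟩ h
    have h1 : p + rename e (u c) = p2 + rename e (u c2) := congrArg Subtype.val h
    have h2 : rename e (u c - u c2) ∈ P := by
      have : rename e (u c - u c2) = (g + p2) - (g + p) := by
        rw [map_sub]; linear_combination h1
      rw [this]; exact Ideal.sub_mem _ hp2' hp'
    have h3 := sub_eq_zero.1 (he _ h2)
    have h4 : c = c2 := by
      funext j; rw [← hu c j, h3, hu]
    subst h4
    have h5 : p = p2 := by simpa using h1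
    subst h5
    rfl
  have := Nat.card_le_card_of_injective Φ hΦ
  rw [Nat.card_prod] at this
  simpa [Nat.card_eq_fintype_card] using this

theorem lemmaA [Fintype F] (d : ℕ) (e : Fin k → ℕ) (he : ∀ i, 0 < e i) (hde : ∀ i, d ≤ e i)
    (g : Fin k → MvPolynomial (Fin k) F) (hg : ∀ i, (g i).totalDegree ≤ e i) :
    Nat.card {p : Fin k → restrictTotalDegree (Fin k) F d //
      ∏ i, e i < Nat.card {x : Fin k → F // ∀ i, eval x (g i + (p i).1) = 0}} * Fintype.card F ^ (d + 1) ≤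
      (k * ∏ i, e i) * Nat.card (restrictTotalDegree (Fin k) F d) ^ k := by
  classical
  let f : (Fin k → restrictTotalDegree (Fin k) F d) → Fin k → MvPolynomial (Fin k) F := fun p i => g i + (p i).1
  have hf : ∀ p i, (f p i).totalDegree ≤ e i := by
    intro p i
    refine (totalDegree_add _ _).trans (max_le (hg i) ?_)
    have := (p i).2
    rw [mem_restrictTotalDegree] at this
    exact this.trans (hde i)
  let B : Fin k → Set (Fin k → restrictTotalDegree (Fin k) F d) := fun s =>
    {p | (∀ i : Fin k, i.val < s.val → ¬ Bad (f p) i) ∧ Bad (f p) s}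
  have hB : ∀ s, Nat.card (B s) * Fintype.card F ^ (d+1) ≤ (∏ i, e i) * Nat.card (restrictTotalDegree (Fin k) F d) ^ k := by
    intro s
    apply count_fiber (B s) s
    intro p
    have hII : ∀ x r, r ≤ s.val → II (f (Function.update p s x)) r = II (f p) r := by
      intro x r hr
      unfold II
      congr 1
      apply Set.image_congr
      intro i hi
      have : i ≠ s := by rintro rfl; simp at hi; omega
      simp [f, Function.update_of_ne this]
    have hfs : ∀ x, f (Function.update p s x) s = g s + x.1 := fun x => by simp [f]
    by_cases hb : ∀ i : Fin k, i.val < s.val → ¬ Bad (f p) i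
    · have hmp := minimalPrimes_card (f p) e he (hf p) s.val s.2.le hb
      have hfin : (II (f p) s.val).minimalPrimes.Finite := Ideal.finite_minimalPrimes_of_isNoetherianRing _ _
      have := hfin.fintype
      let Ψ : {x // Function.update p s x ∈ B s} → Σ P : (II (f p) s.val).minimalPrimes, {x : restrictTotalDegree (Fin k) F d // g s + x.1 ∈ P.1} :=
        fun x => 
          have hx : ∃ P ∈ (II (f p) s.val).minimalPrimes, g s + x.1.1 ∈ P := by
            obtain ⟨x, hx⟩ := x
            obtain ⟨P, hP, hP'⟩ := hx.2
            rw [hII x _ le_rfl] at hP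
            rw [hfs] at hP'
            exact ⟨P, hP, hP'⟩
          ⟨⟨hx.choose, hx.choose_spec.1⟩, ⟨x.1, hx.choose_spec.2⟩⟩
      have hΨ : Function.Injective Ψ := by
        intro a b hab
        apply Subtype.ext
        exact congrArg (fun z : (Σ P : (II (f p) s.val).minimalPrimes, {x : restrictTotalDegree (Fin k) F d // g s + x.1 ∈ P.1}) => z.2.1) hab
      have h1 := Nat.card_le_card_of_injective Ψ hΨ
      rw [Nat.card_sigma] at h1
      calc _ ≤ (∑ P : (II (f p) s.val).minimalPrimes, Nat.card {x : restrictTotalDegree (Fin k) F d // g s + x.1 ∈ P.1}) * Fintype.card F ^ (d+1) := by gcongr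
        _ = ∑ P : (II (f p) s.val).minimalPrimes, Nat.card {x : restrictTotalDegree (Fin k) F d // g s + x.1 ∈ P.1} * Fintype.card F ^ (d+1) := by rw [Finset.sum_mul]
        _ ≤ ∑ P : (II (f p) s.val).minimalPrimes, Nat.card (restrictTotalDegree (Fin k) F d) := by
          refine Finset.sum_le_sum fun P _ => ?_
          obtain ⟨ee, _, hee⟩ := II_height (f p) s.val s.2.le P.1 P.2
          exact count_prime d P.1 _ (by omega) ee hee _
        _ = (II (f p) s.val).minimalPrimes.ncard * Nat.card (restrictTotalDegree (Fin k) F d) := by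
          simp [← Nat.card_eq_fintype_card]
        _ ≤ _ := by gcongr
    · have : IsEmpty {x // Function.update p s x ∈ B s} := by
        constructor
        rintro ⟨x, hx⟩
        apply hb
        intro i hi hbad
        apply hx.1 i hi
        obtain ⟨P, hP, hP'⟩ := hbad
        refine ⟨P, ?_, ?_⟩
        · rwa [hII x _ hi.le]
        · have : i ≠ s := by rintro rfl; simp at hi
          simpa [f, Function.update_of_ne this] using hP'
      simp
  have hsub : {p : Fin k → restrictTotalDegree (Fin k) F d |
      ∏ i, e i < Nat.card {x : Fin k → F // ∀ i, eval x (g i + (p i).1) = 0}} ⊆ ⋃ s, B s := by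
    intro p hp
    simp only [Set.mem_ofPred_eq] at hp
    by_contra hc
    have : ∀ i : Fin k, ¬ Bad (f p) i := by
      have : ∀ n, ∀ i : Fin k, i.val = n → ¬ Bad (f p) i := by
        intro n
        induction n using Nat.strong_induction_on with
        | _ n ih =>
          intro i hi hbad
          apply hc
          rw [Set.mem_iUnion]
          exact ⟨i, fun j hj => ih j.val (by omega) j rfl, hbad⟩
      exact fun i => this _ i rfl
    have := points_card (f p) e he (hf p) this
    exact absurd hp (by simpa [f] using this)
  calc _ ≤ (∑ s, Nat.card (B s)) * Fintype.card F ^ (d+1) := by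
        gcongr
        have h1 : Set.ncard _ ≤ Set.ncard _ := Set.ncard_le_ncard hsub (Set.toFinite _)
        have h2 : Set.ncard (⋃ s, B s) ≤ ∑ s, Set.ncard (B s) := Set.ncard_iUnion_le_of_fintype B
        exact h1.trans h2
    _ = ∑ s, Nat.card (B s) * Fintype.card F ^ (d+1) := by rw [Finset.sum_mul]
    _ ≤ ∑ s : Fin k, (∏ i, e i) * Nat.card (restrictTotalDegree (Fin k) F d) ^ k := Finset.sum_le_sum fun s _ => hB s
    _ = _ := by simp; ring
end S17
end

section
namespace S17
open MvPolynomial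
variable {k : ℕ} {F : Type} [Field F]

theorem sum_translate {V W : Type} [AddGroup V] [Finite V] [Fintype V] [Fintype W] (B : Set V) (φ : W → V) :
    ∑ v : V, Nat.card {x : W // v + φ x ∈ B} = Fintype.card W * Nat.card B := by
  classical
  have h1 : (Σ v : V, {x : W // v + φ x ∈ B}) ≃ (Σ x : W, {v : V // v + φ x ∈ B}) :=
    { toFun := fun a => ⟨a.2.1, a.1, a.2.2⟩
      invFun := fun a => ⟨a.2.1, a.1, a.2.2⟩
      left_inv := fun a => rfl
      right_inv := fun a => rfl }
  rw [← Nat.card_sigma, Nat.card_congr h1, Nat.card_sigma]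
  have : ∀ x : W, Nat.card {v : V // v + φ x ∈ B} = Nat.card B := fun x =>
    Nat.card_congr (Equiv.subtypeEquiv (Equiv.addRight (φ x)) (fun v => Iff.rfl))
  simp_rw [this]
  rw [Finset.sum_const, smul_eq_mul, Finset.card_univ]

theorem count_translate {V W : Type} [AddGroup V] [Finite V] [Finite W] [Nonempty W] (B : Set V) (φ : W → V) (c C : ℕ)
    (h : ∀ v, Nat.card {x : W // v + φ x ∈ B} * c ≤ C * Nat.card W) : Nat.card B * c ≤ C * Nat.card V := by
  have := Fintype.ofFinite V
  have := Fintype.ofFinite W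
  have h1 := sum_translate B φ
  have h2 : (Nat.card B * c) * Nat.card W ≤ (C * Nat.card V) * Nat.card W := by
    calc _ = (Fintype.card W * Nat.card B) * c := by rw [Nat.card_eq_fintype_card (α := W)]; ring
      _ = ∑ v : V, Nat.card {x : W // v + φ x ∈ B} * c := by rw [← h1, Finset.sum_mul]
      _ ≤ ∑ v : V, C * Nat.card W := Finset.sum_le_sum fun v _ => h v
      _ = _ := by simp [Nat.card_eq_fintype_card]; ring
  exact Nat.le_of_mul_le_mul_right h2 Nat.card_pos

theorem count_translate' {V W : Type} [AddGroup V] [Finite V] [Finite W] [Nonempty W] (B : Set V) (φ : W → V) (c C : ℕ)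
    (h : ∀ v, C * Nat.card W ≤ Nat.card {x : W // v + φ x ∈ B} * c) : C * Nat.card V ≤ Nat.card B * c := by
  have := Fintype.ofFinite V
  have := Fintype.ofFinite W
  have h1 := sum_translate B φ
  have h2 : (C * Nat.card V) * Nat.card W ≤ (Nat.card B * c) * Nat.card W := by
    calc _ = ∑ v : V, C * Nat.card W := by simp [Nat.card_eq_fintype_card]; ring
      _ ≤ ∑ v : V, Nat.card {x : W // v + φ x ∈ B} * c := Finset.sum_le_sum fun v _ => h v
      _ = (Fintype.card W * Nat.card B) * c := by rw [← h1, Finset.sum_mul]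
      _ = _ := by rw [Nat.card_eq_fintype_card (α := W)]; ring
  exact Nat.le_of_mul_le_mul_right h2 Nat.card_pos

abbrev Om (k : ℕ) (F : Type) [Field F] (D d n : ℕ) : Type :=
  (Fin k → restrictTotalDegree (Fin k) F D) × (Fin k → Fin n → restrictTotalDegree (Fin k) F d)

noncomputable def ff {D d n : ℕ} (v : Om k F D d n) (i : Fin k) (j : Fin n) : MvPolynomial (Fin k) F :=
  (v.1 i).1 + (v.2 i j).1

theorem ff_deg {D d n : ℕ} (hdD : d ≤ D) (v : Om k F D d n) (i : Fin k) (j : Fin n) : (ff v i j).totalDegree ≤ D := by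
  have h1 := (v.1 i).2
  have h2 := (v.2 i j).2
  rw [mem_restrictTotalDegree] at h1 h2
  exact (totalDegree_add _ _).trans (max_le h1 (h2.trans hdD))

theorem idx_bound [Fintype F] (D d n : ℕ) (hdD : d ≤ D) (hd : 0 < d) (idx : Fin k → Fin k × Fin n)
    (hidx : Function.Injective idx) (hk : 0 < k) (bnd : ℕ) (hb1 : bnd = D ^ k ∨ (bnd = D ^ (k-1) * d ∧ Set.range (fun j => (idx j).1) ≠ Set.univ)) :
    Nat.card {v : Om k F D d n | bnd < Nat.card {x : Fin k → F // ∀ j, eval x (ff v (idx j).1 (idx j).2) = 0}} * Fintype.card F ^ (d+1)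
      ≤ (k * D ^ k) * Nat.card (Om k F D d n) := by
  classical
  have : Nonempty (Fin k) := ⟨⟨0, hk⟩⟩
  let fst : Fin k → Fin k := fun j => (idx j).1
  let rep : Fin k → Fin k := fun j => Function.invFun fst (fst j)
  have hrep1 : ∀ j, fst (rep j) = fst j := fun j => Function.invFun_eq ⟨j, rfl⟩
  have hrep2 : ∀ j, rep (rep j) = rep j := fun j => by
    show Function.invFun fst (fst (rep j)) = _
    rw [hrep1]
  let e : Fin k → ℕ := fun j => if rep j = j then D else d
  have heD : ∀ j, e j ≤ D := fun j => by simp only [e]; split_ifs <;> omega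
  have hed : ∀ j, d ≤ e j := fun j => by simp only [e]; split_ifs <;> omega
  have hprod : ∏ j, e j ≤ D ^ k := by
    calc _ ≤ ∏ j : Fin k, D := Finset.prod_le_prod' fun j _ => heD j
      _ = _ := by simp
  have hprod2 : ∏ j, e j ≤ bnd := by
    rcases hb1 with h | ⟨h, h'⟩
    · rw [h]; exact hprod
    · rw [h]
      have : ∃ j, rep j ≠ j := by
        by_contra hc
        push Not at hc
        have hinj : Function.Injective fst := Function.LeftInverse.injective (g := Function.invFun fst) hc
        exact h' (Set.range_eq_univ.2 (Finite.surjective_of_injective hinj))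
      obtain ⟨j, hj⟩ := this
      rw [← Finset.mul_prod_erase _ _ (Finset.mem_univ j)]
      have h1 : e j = d := by simp [e, hj]
      have h2 : ∏ j ∈ Finset.univ.erase j, e j ≤ D ^ (k-1) := by
        calc _ ≤ ∏ j ∈ Finset.univ.erase j, D := Finset.prod_le_prod' fun j _ => heD j
          _ = _ := by simp
      rw [h1, mul_comm]; gcongr
  let φ : (Fin k → restrictTotalDegree (Fin k) F d) → Om k F D d n := fun x =>
    (0, fun i j => ∑ j', if idx j' = (i, j) then (if rep j' = j' then x j' else x j' + x (rep j')) else 0)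
  have hφ : ∀ v x j, ff (v + φ x) (idx j).1 (idx j).2 = ff v (idx j).1 (idx j).2 + (if rep j = j then (x j).1 else (x j).1 + (x (rep j)).1) := by
    intro v x j
    have : (φ x).2 (idx j).1 (idx j).2 = (if rep j = j then x j else x j + x (rep j)) := by
      simp only [φ]
      rw [Finset.sum_eq_single j]
      · simp
      · intro b _ hb
        rw [if_neg]
        intro h
        exact hb (hidx h)
      · simp
    simp only [ff, Prod.fst_add, Prod.snd_add, Pi.add_apply, Submodule.coe_add, this]
    have h0 : ((φ x).1 (idx j).1).1 = 0 := rfl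
    rw [h0]
    split_ifs
    · ring
    · simp only [Submodule.coe_add]; ring
  refine (count_translate _ φ _ (k * D^k) ?_)
  intro v
  let g : Fin k → MvPolynomial (Fin k) F := fun j => if rep j = j then ff v (idx j).1 (idx j).2 else
    ff v (idx j).1 (idx j).2 - ff v (idx (rep j)).1 (idx (rep j)).2
  have hg : ∀ j, (g j).totalDegree ≤ e j := by
    intro j
    simp only [g, e]
    split_ifs with h
    · exact ff_deg hdD _ _ _
    · have h1 : (idx (rep j)).1 = (idx j).1 := hrep1 j
      have h2 : ff v (idx j).1 (idx j).2 - ff v (idx (rep j)).1 (idx (rep j)).2 = (v.2 (idx j).1 (idx j).2 - v.2 (idx (rep j)).1 (idx (rep j)).2 : restrictTotalDegree (Fin k) F d).1 := by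
        simp only [ff, h1, Submodule.coe_sub]; ring
      rw [h2, ← mem_restrictTotalDegree]
      exact Subtype.prop _
  have hA := lemmaA d e (fun i => lt_of_lt_of_le hd (hed i)) hed g hg
  have hW : Nat.card (Fin k → restrictTotalDegree (Fin k) F d) = Nat.card (restrictTotalDegree (Fin k) F d) ^ k := by
    rw [Nat.card_fun]; simp
  rw [hW]
  refine le_trans (Nat.mul_le_mul_right _ ?_) (hA.trans (by gcongr))
  refine Nat.card_le_card_of_injective (Subtype.map id ?_) (Subtype.map_injective _ Function.injective_id)
  intro x hx
  simp only [Set.mem_ofPred_eq] at hx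
  refine lt_of_le_of_lt hprod2 (lt_of_lt_of_le hx ?_)
  refine Nat.card_le_card_of_injective (Subtype.map id ?_) (Subtype.map_injective _ Function.injective_id)
  intro y hy j
  have h1 := hy j
  have h2 := hy (rep j)
  rw [hφ] at h1 h2
  simp only [id, g]
  by_cases hj : rep j = j
  · simpa [hj] using h1
  · simp only [hj, if_false, hrep2, if_true, map_add, map_sub] at h1 h2 ⊢
    linear_combination h1 - h2

def GoodIdx {D d n : ℕ} (v : Om k F D d n) : Prop :=
  (∀ js : Fin k → Fin n, Nat.card {x : Fin k → F // ∀ i, eval x (ff v i (js i)) = 0} ≤ D ^ k) ∧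
  (∀ idx : Fin k → Fin k × Fin n, Function.Injective idx → (Set.range fun j => (idx j).1) ≠ Set.univ →
    Nat.card {x : Fin k → F // ∀ j, eval x (ff v (idx j).1 (idx j).2) = 0} ≤ D ^ (k-1) * d)

theorem bad_bound [Fintype F] (D d : ℕ) (hdD : d ≤ D) (hd : d = k^2 + 2) (hk : 0 < k) :
    Nat.card {v : Om k F D d (Fintype.card F ^ k) | ¬ GoodIdx v} * Fintype.card F
      ≤ (2 * k ^ k * (k * D ^ k)) * Nat.card (Om k F D d (Fintype.card F ^ k)) := by
  classical
  set n := Fintype.card F ^ k with hn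
  have hq : 0 < Fintype.card F := Fintype.card_pos
  let I := {idx : Fin k → Fin k × Fin n // Function.Injective idx}
  let B1 : I → Set (Om k F D d n) := fun idx => {v | D ^ k < Nat.card {x : Fin k → F // ∀ j, eval x (ff v (idx.1 j).1 (idx.1 j).2) = 0}}
  let B2 : I → Set (Om k F D d n) := fun idx => {v | Set.range (fun j => (idx.1 j).1) ≠ Set.univ ∧ D ^ (k-1) * d < Nat.card {x : Fin k → F // ∀ j, eval x (ff v (idx.1 j).1 (idx.1 j).2) = 0}}
  have h1 : ∀ idx, Nat.card (B1 idx) * Fintype.card F ^ (d+1) ≤ (k * D ^ k) * Nat.card (Om k F D d n) := fun idx =>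
    idx_bound D d n hdD (by omega) idx.1 idx.2 hk (D^k) (Or.inl rfl)
  have h2 : ∀ idx, Nat.card (B2 idx) * Fintype.card F ^ (d+1) ≤ (k * D ^ k) * Nat.card (Om k F D d n) := fun idx => by
    by_cases h : Set.range (fun j => (idx.1 j).1) ≠ Set.univ
    · have := idx_bound (F := F) D d n hdD (by omega) idx.1 idx.2 hk (D^(k-1)*d) (Or.inr ⟨rfl, h⟩)
      simpa [B2, h] using this
    · simp [B2, h]
  have hsub : {v : Om k F D d n | ¬ GoodIdx v} ⊆ (⋃ idx, B1 idx) ∪ (⋃ idx, B2 idx) := by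
    intro v hv
    simp only [Set.mem_ofPred_eq, GoodIdx, not_and_or, not_forall, not_le] at hv
    rcases hv with ⟨js, hjs⟩ | ⟨idx, hi, hr, h⟩
    · left
      rw [Set.mem_iUnion]
      exact ⟨⟨fun j => (j, js j), fun a b h => congrArg Prod.fst h⟩, hjs⟩
    · right
      rw [Set.mem_iUnion]
      exact ⟨⟨idx, hi⟩, hr, h⟩
  have hI : Fintype.card I ≤ k ^ k * Fintype.card F ^ (k^2) := by
    refine (Fintype.card_subtype_le _).trans ?_
    simp [hn, mul_pow, ← pow_mul, pow_two]
  have hcard : Nat.card {v : Om k F D d n | ¬ GoodIdx v} ≤ ∑ idx : I, Nat.card (B1 idx) + ∑ idx : I, Nat.card (B2 idx) := by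
    have h3 : Set.ncard _ ≤ Set.ncard _ := Set.ncard_le_ncard hsub (Set.toFinite _)
    refine h3.trans ((Set.ncard_union_le _ _).trans ?_)
    exact Nat.add_le_add (Set.ncard_iUnion_le_of_fintype B1) (Set.ncard_iUnion_le_of_fintype B2)
  have hmain : (Nat.card {v : Om k F D d n | ¬ GoodIdx v} * Fintype.card F) * Fintype.card F ^ (k^2+2) ≤
      ((2 * k ^ k * (k * D ^ k)) * Nat.card (Om k F D d n)) * Fintype.card F ^ (k^2) := by
    calc _ = Nat.card {v : Om k F D d n | ¬ GoodIdx v} * Fintype.card F ^ (d+1) := by rw [hd]; ring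
      _ ≤ (∑ idx : I, Nat.card (B1 idx) + ∑ idx : I, Nat.card (B2 idx)) * Fintype.card F ^ (d+1) := by gcongr
      _ = ∑ idx : I, (Nat.card (B1 idx) * Fintype.card F ^ (d+1) + Nat.card (B2 idx) * Fintype.card F ^ (d+1)) := by
        rw [Finset.sum_add_distrib, add_mul, Finset.sum_mul, Finset.sum_mul]
      _ ≤ ∑ idx : I, ((k * D ^ k) * Nat.card (Om k F D d n) + (k * D ^ k) * Nat.card (Om k F D d n)) :=
        Finset.sum_le_sum fun idx _ => Nat.add_le_add (h1 idx) (h2 idx)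
      _ = Fintype.card I * (2 * ((k * D ^ k) * Nat.card (Om k F D d n))) := by
        rw [Finset.sum_const, smul_eq_mul, Finset.card_univ]; ring
      _ ≤ (k ^ k * Fintype.card F ^ (k^2)) * (2 * ((k * D ^ k) * Nat.card (Om k F D d n))) := by gcongr
      _ = _ := by ring
  refine Nat.le_of_mul_le_mul_right (hmain.trans ?_) (pow_pos hq (k^2+2))
  gcongr
  · omega
end S17
end

section
namespace S17
open Polynomial

/-- abstract data for the Stepanov argument -/
structure Step (F O G : Type) [Field F] [Fintype F] [CommRing O] [IsDomain O] [Algebra F O]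
    [Group G] [Fintype G] [MulSemiringAction G O] (κ κ' : ℕ) where
  emb : O →ₐ[F] PowerSeries F
  emb_inj : Function.Injective emb
  j : F[X] →ₐ[F] O
  emb_j : ∀ f, emb (j f) = (f : PowerSeries F)
  smul_j : ∀ (g : G) f, g • j f = j f
  W : ℕ → Submodule F O
  W_mono : Monotone W
  W_mul : ∀ {a b x y}, x ∈ W a → y ∈ W b → x * y ∈ W (a + b)
  W_one : 1 ∈ W 0
  W_smul : ∀ (g : G) {a x}, x ∈ W a → g • x ∈ W a
  W_norm : ∀ {a x}, x ∈ W a → ∃ N : F[X], j N = ∏ g : G, g • x ∧ N.natDegree ≤ Fintype.card G * a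
  W_fin : ∀ a, FiniteDimensional F (W a)
  W_dim : ∀ a, Fintype.card G * (a + 1) ≤ Module.finrank F (W a) + Fintype.card G * κ
  s : F[X]
  s_ne : s ≠ 0
  s_deg : s.natDegree ≤ κ'
  δ : Derivation F O O
  δ_X : δ (j X) = j s
  δ_W : ∀ {a x}, x ∈ W a → δ x ∈ W (a + κ')
  Q : F → Ideal O
  σ : F → G
  Q_prime : ∀ t, s.eval t ≠ 0 → (Q t).IsPrime
  Q_X : ∀ t, s.eval t ≠ 0 → j (X - C t) ∈ Q t
  Q_frob : ∀ t, s.eval t ≠ 0 → ∀ x, σ t • x - x ^ Fintype.card F ∈ Q t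
  Q_unram : ∀ t, s.eval t ≠ 0 → ∀ x ∈ Q t, ∃ e ∉ Q t, j (X - C t) ∣ e * x

namespace Step
variable {F O G : Type} [Field F] [Fintype F] [CommRing O] [IsDomain O] [Algebra F O]
    [Group G] [Fintype G] [MulSemiringAction G O] {κ κ' : ℕ} (S : Step F O G κ κ')

/-- local order of vanishing -/
def Ord (P : Ideal O) (t : F) (b : O) (r : ℕ) : Prop := ∃ e ∉ P, S.j (X - C t) ^ r ∣ e * b

/-- vanishing of derivatives -/
def Van (P : Ideal O) : ℕ → O → Prop
  | 0, _ => True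
  | r + 1, x => x ∈ P ∧ Van P r (S.δ x)

lemma j_inj : Function.Injective S.j := by
  intro a b h
  have := congrArg S.emb h
  rw [S.emb_j, S.emb_j] at this
  exact_mod_cast this

lemma ord_mul {t : F} (ht : S.s.eval t ≠ 0) {a b : O} {m r : ℕ} (ha : S.Ord (S.Q t) t a m)
    (hb : S.Ord (S.Q t) t b r) : S.Ord (S.Q t) t (a * b) (m + r) := by
  obtain ⟨e, he, hea⟩ := ha
  obtain ⟨f, hf, hfb⟩ := hb
  have := S.Q_prime t ht
  refine ⟨e * f, fun h => (this.mem_or_mem h).elim he hf, ?_⟩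
  rw [pow_add, show e * f * (a * b) = (e * a) * (f * b) by ring]
  exact mul_dvd_mul hea hfb

lemma ord_zero {t : F} (ht : S.s.eval t ≠ 0) (a : O) : S.Ord (S.Q t) t a 0 := by
  have := S.Q_prime t ht
  exact ⟨1, fun h => this.ne_top ((Ideal.eq_top_iff_one _).2 h), by simp⟩

lemma ord_prod {t : F} (ht : S.s.eval t ≠ 0) {ι : Type} (A : Finset ι) (f : ι → O) (m : ι → ℕ)
    (h : ∀ i ∈ A, S.Ord (S.Q t) t (f i) (m i)) : S.Ord (S.Q t) t (∏ i ∈ A, f i) (∑ i ∈ A, m i) := by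
  classical
  induction A using Finset.induction_on with
  | empty => simpa using S.ord_zero ht 1
  | insert a A ha ih =>
    rw [Finset.prod_insert ha, Finset.sum_insert ha]
    exact S.ord_mul ht (h a (by simp)) (ih fun i hi => h i (by simp [hi]))

lemma j_notMem {t : F} (ht : S.s.eval t ≠ 0) {f : F[X]} (hf : f.eval t ≠ 0) : S.j f ∉ S.Q t := by
  intro h
  have hp := S.Q_prime t ht
  obtain ⟨g, hg⟩ := X_sub_C_dvd_sub_C_eval (p := f) (a := t)
  have h1 : f = (X - C t) * g + C (f.eval t) := by rw [← hg]; ring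
  have h2 : S.j (C (f.eval t)) ∈ S.Q t := by
    have : C (f.eval t) = f - (X - C t) * g := by rw [← hg]; ring
    rw [this, map_sub, map_mul]
    exact Ideal.sub_mem _ h (Ideal.mul_mem_right _ _ (S.Q_X t ht))
  apply hp.ne_top
  apply Ideal.eq_top_of_isUnit_mem _ h2
  exact ((isUnit_iff_ne_zero.2 hf).map C).map S.j

lemma jX_ne (t : F) : S.j (X - C t) ≠ 0 := by
  rw [Ne, map_eq_zero_iff _ S.j_inj]
  exact X_sub_C_ne_zero t

lemma ord_poly {t : F} (ht : S.s.eval t ≠ 0) (r : ℕ) (f : F[X]) (h : S.Ord (S.Q t) t (S.j f) r) :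
    (X - C t) ^ r ∣ f := by
  induction r generalizing f with
  | zero => simp
  | succ r ih =>
    have hp := S.Q_prime t ht
    obtain ⟨e, he, hd⟩ := h
    have hf : f.eval t = 0 := by
      by_contra hne
      have h1 : e * S.j f ∈ S.Q t := by
        refine Ideal.mem_of_dvd _ ((dvd_pow_self _ (Nat.succ_ne_zero r)).trans hd) (S.Q_X t ht)
      exact (hp.mem_or_mem h1).elim he (S.j_notMem ht hne)
    obtain ⟨g, rfl⟩ := dvd_iff_isRoot.2 hf
    rw [pow_succ']
    apply mul_dvd_mul_left
    apply ih
    refine ⟨e, he, ?_⟩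
    rw [map_mul, pow_succ', mul_left_comm] at hd
    exact (mul_dvd_mul_iff_left (S.jX_ne t)).1 hd

lemma δ_j_sub (t : F) : S.δ (S.j (X - C t)) = S.j S.s := by
  rw [map_sub, map_sub, S.δ_X]
  have : S.j (C t) = algebraMap F O t := S.j.commutes t
  rw [this, Derivation.map_algebraMap, sub_zero]

lemma van_mono {P : Ideal O} {r : ℕ} {x : O} (h : S.Van P (r + 1) x) : S.Van P r x := by
  induction r generalizing x with
  | zero => trivial
  | succ r ih => exact ⟨h.1, ih h.2⟩

lemma van_add {P : Ideal O} {r : ℕ} {x y : O} (h : S.Van P r x) (h' : S.Van P r y) :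
    S.Van P r (x + y) := by
  induction r generalizing x y with
  | zero => trivial
  | succ r ih => exact ⟨P.add_mem h.1 h'.1, by rw [map_add]; exact ih h.2 h'.2⟩

lemma van_mul {P : Ideal O} {r : ℕ} (e : O) {x : O} (h : S.Van P r x) :
    S.Van P r (e * x) := by
  induction r generalizing x e with
  | zero => trivial
  | succ r ih =>
    refine ⟨P.mul_mem_left _ h.1, ?_⟩
    rw [Derivation.leibniz, smul_eq_mul, smul_eq_mul, mul_comm x]
    exact S.van_add (ih _ h.2) (ih _ (S.van_mono h))

lemma van_pow {P : Ideal O} [P.IsPrime] {t : F} (hX : S.j (X - C t) ∈ P) (hs : S.j S.s ∉ P)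
    (r : ℕ) (hr : (r.factorial : F) ≠ 0) (g : O) (h : S.Van P (r + 1) (S.j (X - C t) ^ r * g)) :
    g ∈ P := by
  induction r generalizing g with
  | zero => simpa using h.1
  | succ r ih =>
    rw [Nat.factorial_succ, Nat.cast_mul] at hr
    have h2 := h.2
    have e1 : S.δ (S.j (X - C t) ^ (r + 1) * g) =
      S.j (X - C t) ^ r * (((r + 1 : ℕ) : O) * S.j S.s * g + S.j (X - C t) * S.δ g) := by
      rw [Derivation.leibniz, Derivation.leibniz_pow, S.δ_j_sub]
      simp only [smul_eq_mul, nsmul_eq_mul, Nat.add_sub_cancel]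
      ring
    rw [e1] at h2
    have h3 := ih (right_ne_zero_of_mul hr) _ h2
    have h4 : ((r + 1 : ℕ) : O) * S.j S.s * g ∈ P := by
      have := P.sub_mem h3 (P.mul_mem_right (S.δ g) hX)
      simpa using this
    rcases Ideal.IsPrime.mem_or_mem ‹_› h4 with h5 | h5
    · rcases Ideal.IsPrime.mem_or_mem ‹_› h5 with h6 | h6
      · exfalso
        apply Ideal.IsPrime.ne_top ‹P.IsPrime›
        apply Ideal.eq_top_of_isUnit_mem _ h6
        have := (isUnit_iff_ne_zero.2 (left_ne_zero_of_mul hr)).map (algebraMap F O)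
        simpa using this
      · exact absurd h6 hs
    · exact h5

lemma van_ord {P : Ideal O} [hP : P.IsPrime] {t : F} (hX : S.j (X - C t) ∈ P) (hs : S.j S.s ∉ P)
    (hu : ∀ x ∈ P, ∃ e ∉ P, S.j (X - C t) ∣ e * x)
    (r : ℕ) (hr : ∀ i < r, (i.factorial : F) ≠ 0) (b : O) (h : S.Van P r b) :
    S.Ord P t b r := by
  induction r with
  | zero => exact ⟨1, fun h => hP.ne_top ((Ideal.eq_top_iff_one _).2 h), by simp⟩
  | succ r ih =>
    obtain ⟨e, he, g, hg⟩ := ih (fun i hi => hr i (by omega)) (S.van_mono h)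
    have hgP : g ∈ P := by
      apply S.van_pow hX hs r (hr r (by omega))
      rw [← hg]
      exact S.van_mul e h
    obtain ⟨e', he', h', hh⟩ := hu g hgP
    refine ⟨e' * e, fun h => (hP.mem_or_mem h).elim he' he, h', ?_⟩
    rw [mul_assoc, hg, mul_left_comm, hh, pow_succ]; ring

/-- conjugated ideal -/
def Qc (t : F) (τ : G) : Ideal O := (S.Q t).comap (MulSemiringAction.toRingHom G O τ⁻¹)

lemma mem_Qc {t : F} {τ : G} {x : O} : x ∈ S.Qc t τ ↔ τ⁻¹ • x ∈ S.Q t := Iff.rfl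

lemma Qc_unram {t : F} (ht : S.s.eval t ≠ 0) (τ : G) : ∀ x ∈ S.Qc t τ, ∃ e ∉ S.Qc t τ,
    S.j (X - C t) ∣ e * x := by
  intro x hx
  obtain ⟨e, he, y, hy⟩ := S.Q_unram t ht _ (S.mem_Qc.1 hx)
  refine ⟨τ • e, by rw [mem_Qc]; simpa using he, τ • y, ?_⟩
  have := congrArg (τ • ·) hy
  simpa only [smul_mul', smul_inv_smul, S.smul_j] using this

lemma Qc_ord {t : F} {τ : G} {b : O} {r : ℕ} (h : S.Ord (S.Qc t τ) t b r) :
    S.Ord (S.Q t) t (τ⁻¹ • b) r := by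
  obtain ⟨e, he, y, hy⟩ := h
  refine ⟨τ⁻¹ • e, he, τ⁻¹ • y, ?_⟩
  have := congrArg (τ⁻¹ • ·) hy
  simpa only [smul_mul', smul_pow', S.smul_j] using this

lemma Qc_frob {t : F} (ht : S.s.eval t ≠ 0) {τ : G} (x : O) :
    (τ * S.σ t * τ⁻¹) • x - x ^ Fintype.card F ∈ S.Qc t τ := by
  rw [mem_Qc]
  have := S.Q_frob t ht (τ⁻¹ • x)
  rw [smul_sub, smul_pow', ← mul_smul, mul_assoc, inv_mul_cancel_left, mul_smul]
  exact this

/-- the pairs with given conjugated Frobenius -/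
noncomputable def Nset (g : G) : Finset (F × G) := by
  classical
  exact Finset.univ.filter fun x => S.s.eval x.1 ≠ 0 ∧ x.2 * S.σ x.1 * x.2⁻¹ = g

lemma mem_Nset {g : G} {x : F × G} : x ∈ S.Nset g ↔
    S.s.eval x.1 ≠ 0 ∧ x.2 * S.σ x.1 * x.2⁻¹ = g := by
  classical
  simp [Nset]

/-- common degree estimate -/
lemma common (g : G) (b : O) (hb : b ≠ 0) (a r : ℕ) (hba : b ∈ S.W a)
    (h : ∀ x ∈ S.Nset g, S.Ord (S.Qc x.1 x.2) x.1 b r) :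
    r * (S.Nset g).card ≤ Fintype.card G * a := by
  classical
  obtain ⟨N, hN, hdeg⟩ := S.W_norm hba
  have hN0 : N ≠ 0 := by
    rintro rfl
    rw [map_zero] at hN
    obtain ⟨g, -, hg⟩ := Finset.prod_eq_zero_iff.1 hN.symm
    exact hb (by simpa using congrArg (g⁻¹ • ·) hg)
  refine le_trans ?_ hdeg
  set m : F → ℕ := fun t => ((S.Nset g).filter fun x => x.1 = t).card with hm
  have key : ∀ t, (X - C t) ^ (r * m t) ∣ N := by
    intro t
    by_cases ht : S.s.eval t = 0
    · have : m t = 0 := by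
        rw [hm]; simp only [Finset.card_eq_zero]
        apply Finset.filter_eq_empty_iff.2
        rintro x hx rfl
        exact (S.mem_Nset.1 hx).1 ht
      simp [this]
    · apply S.ord_poly ht
      rw [hN]
      let T : Finset G := Finset.univ.filter fun τ => (t, τ⁻¹) ∈ S.Nset g
      have hT : T.card = m t := by
        apply Finset.card_bij (fun τ _ => (t, τ⁻¹))
        · intro τ hτ
          simpa [T] using hτ
        · intro τ _ τ' _ h
          simpa using h
        · rintro ⟨t', τ⟩ hx
          simp only [Finset.mem_filter] at hx
          obtain ⟨hx, rfl⟩ := hx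
          exact ⟨τ⁻¹, by simpa [T] using hx, by simp⟩
      have := S.ord_prod ht Finset.univ (fun τ : G => τ • b) (fun τ => if τ ∈ T then r else 0) ?_
      · rwa [← Finset.sum_filter, Finset.sum_const, smul_eq_mul, mul_comm,
          show (Finset.univ.filter fun τ => τ ∈ T) = T by ext; simp, hT] at this
      · intro τ _
        by_cases hτ : τ ∈ T
        · rw [if_pos hτ]
          have := S.Qc_ord (h _ (Finset.mem_filter.1 hτ).2)
          simpa using this
        · rw [if_neg hτ]; exact S.ord_zero ht _
  have hprod : ∏ t : F, (X - C t) ^ (r * m t) ∣ N := by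
    apply Finset.prod_dvd_of_coprime
    · intro x _ y _ hxy
      exact (pairwise_coprime_X_sub_C Function.injective_id hxy).pow
    · intro t _; exact key t
  have h2 := natDegree_le_of_dvd hprod hN0
  rw [natDegree_prod _ _ (fun t _ => pow_ne_zero _ (X_sub_C_ne_zero t))] at h2
  simp only [natDegree_pow, natDegree_X_sub_C, mul_one, ← Finset.mul_sum] at h2
  rwa [← Finset.card_eq_sum_card_fiberwise (f := Prod.fst) (s := S.Nset g)
    (t := Finset.univ) (fun _ _ => by simp)] at h2

end Step
end S17
end

section
namespace S17
open Polynomial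

lemma pigeon {A B : Type*} [AddGroup A] [AddGroup B] [Finite A] [Finite B] (f : A →+ B)
    (h : Nat.card B < Nat.card A) : ∃ a, a ≠ 0 ∧ f a = 0 := by
  by_contra! hc
  have : Function.Injective f := (injective_iff_map_eq_zero f).2 fun a ha => by
    by_contra h0
    exact hc a h0 ha
  exact absurd (Nat.card_le_card_of_injective f this) (by omega)

namespace Step
variable {F O G : Type} [Field F] [Fintype F] [CommRing O] [IsDomain O] [Algebra F O]
    [Group G] [Fintype G] [MulSemiringAction G O] {κ κ' : ℕ} (S : Step F O G κ κ')

/-- order at the base point -/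
noncomputable def o (b : O) : ℕ := (S.emb b).order.toNat

lemma emb_ne {b : O} (hb : b ≠ 0) : S.emb b ≠ 0 := by
  rwa [Ne, map_eq_zero_iff _ S.emb_inj]

lemma o_spec {b : O} (hb : b ≠ 0) : (S.emb b).order = S.o b :=
  (ENat.natCast_toNat (by rw [Ne, PowerSeries.order_eq_top]; exact S.emb_ne hb)).symm

lemma o_coeff {b : O} (hb : b ≠ 0) : PowerSeries.coeff (S.o b) (S.emb b) ≠ 0 :=
  PowerSeries.coeff_order (S.emb_ne hb)

lemma o_lt {b : O} {i : ℕ} (h : i < S.o b) : PowerSeries.coeff i (S.emb b) = 0 := by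
  by_cases hb : b = 0
  · simp [hb]
  · apply PowerSeries.coeff_of_lt_order
    rw [S.o_spec hb]; exact_mod_cast h

lemma o_mul {a b : O} (ha : a ≠ 0) (hb : b ≠ 0) : S.o (a * b) = S.o a + S.o b := by
  have := S.o_spec (mul_ne_zero ha hb)
  rw [map_mul, PowerSeries.order_mul, S.o_spec ha, S.o_spec hb] at this
  exact_mod_cast this.symm

lemma o_pow {a : O} (ha : a ≠ 0) (m : ℕ) : S.o (a ^ m) = m * S.o a := by
  have := S.o_spec (pow_ne_zero m ha)
  rw [map_pow, PowerSeries.order_pow, S.o_spec ha] at this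
  rw [nsmul_eq_mul] at this
  exact_mod_cast this.symm

lemma o_le {b : O} (hb : b ≠ 0) {a : ℕ} (h : b ∈ S.W a) : S.o b ≤ Fintype.card G * a := by
  classical
  obtain ⟨N, hN, hdeg⟩ := S.W_norm h
  have hN0 : N ≠ 0 := by
    rintro rfl
    rw [map_zero] at hN
    obtain ⟨g, -, hg⟩ := Finset.prod_eq_zero_iff.1 hN.symm
    exact hb (by simpa using congrArg (g⁻¹ • ·) hg)
  refine le_trans ?_ hdeg
  rw [← Finset.mul_prod_erase _ _ (Finset.mem_univ (1 : G)), one_smul] at hN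
  have hj : S.j N ≠ 0 := by rwa [Ne, map_eq_zero_iff _ S.j_inj]
  have h1 := congrArg S.o hN
  rw [S.o_mul hb (right_ne_zero_of_mul (hN ▸ hj))] at h1
  have h2 : S.o (S.j N) ≤ N.natDegree := by
    by_contra hlt
    push Not at hlt
    have := S.o_lt hlt
    rw [S.emb_j, Polynomial.coeff_coe] at this
    exact hN0 (leadingCoeff_eq_zero.1 this)
  omega

lemma exists_orders (a : ℕ) : ∃ T : Finset ℕ, Module.finrank F (S.W a) ≤ T.card ∧
    ∀ t ∈ T, ∃ b ∈ S.W a, b ≠ 0 ∧ S.o b = t := by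
  classical
  have := S.W_fin a
  let T : Finset ℕ := (Finset.range (Fintype.card G * a + 1)).filter
    fun t => ∃ b ∈ S.W a, b ≠ 0 ∧ S.o b = t
  refine ⟨T, ?_, fun t ht => (Finset.mem_filter.1 ht).2⟩
  let f : S.W a →ₗ[F] (T → F) := LinearMap.pi fun t =>
    (PowerSeries.coeff t.1).comp (S.emb.toLinearMap.comp (S.W a).subtype)
  have hf : Function.Injective f := by
    rw [← LinearMap.ker_eq_bot, LinearMap.ker_eq_bot']
    intro b hb
    by_contra h0
    have hb0 : (b : O) ≠ 0 := by simpa using h0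
    have hT : S.o b.1 ∈ T := Finset.mem_filter.2 ⟨Finset.mem_range.2
      (Nat.lt_succ_of_le (S.o_le hb0 b.2)), b.1, b.2, hb0, rfl⟩
    exact S.o_coeff hb0 (congrFun hb ⟨_, hT⟩)
  have := LinearMap.finrank_le_finrank_of_injective hf
  simpa using this

lemma finrank_le (a : ℕ) : Module.finrank F (S.W a) ≤ Fintype.card G * a + 1 := by
  obtain ⟨T, hT, h⟩ := S.exists_orders a
  refine hT.trans ?_
  rw [← Finset.card_range (Fintype.card G * a + 1)]
  apply Finset.card_le_card
  intro t ht
  obtain ⟨b, hb, h0, rfl⟩ := h t ht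
  exact Finset.mem_range.2 (Nat.lt_succ_of_le (S.o_le h0 hb))

lemma exists_c (a m : ℕ) (h : m + Fintype.card G * κ ≤ Fintype.card G * (a + 1)) :
    ∃ c : Fin m → O, (∀ i, c i ∈ S.W a) ∧ (∀ i, c i ≠ 0) ∧ Function.Injective fun i => S.o (c i) := by
  obtain ⟨T, hT, hh⟩ := S.exists_orders a
  have := S.W_dim a
  have hm : m ≤ T.card := by omega
  choose! b hb h0 ho using hh
  let e : Fin m → T := fun i => T.equivFin.symm (Fin.castLE hm i)
  refine ⟨fun i => b (e i), fun i => hb _ (e i).2, fun i => h0 _ (e i).2, ?_⟩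
  intro i j hij
  simp only [ho _ (e i).2, ho _ (e j).2] at hij
  have := Subtype.ext hij
  simpa [e] using this

lemma sum_ne {m : ℕ} (a c : Fin m → O) (q : ℕ) (hc : ∀ i, c i ≠ 0)
    (hinj : Function.Injective fun i => S.o (c i)) (ha : ∀ i, a i ≠ 0 → S.o (a i) < q)
    (h : a ≠ 0) : ∑ i, a i * c i ^ q ≠ 0 := by
  classical
  obtain ⟨i0, hi0⟩ := Function.ne_iff.1 h
  obtain ⟨i, hi, hmin⟩ := (Finset.univ.filter fun i => a i ≠ 0).exists_min_image
    (fun i => S.o (a i * c i ^ q)) ⟨i0, by simpa using hi0⟩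
  simp only [Finset.mem_filter, Finset.mem_univ, true_and] at hi hmin
  intro h0
  have h1 := congrArg (PowerSeries.coeff (S.o (a i * c i ^ q))) (congrArg S.emb h0)
  rw [map_sum, map_sum, Finset.sum_eq_single i] at h1
  · rw [map_zero, map_zero] at h1
    exact S.o_coeff (mul_ne_zero hi (pow_ne_zero _ (hc i))) h1
  · intro j _ hji
    by_cases hj : a j = 0
    · simp [hj]
    apply S.o_lt
    refine lt_of_le_of_ne (hmin j hj) ?_
    rw [S.o_mul hi (pow_ne_zero _ (hc i)), S.o_mul hj (pow_ne_zero _ (hc j)),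
      S.o_pow (hc i), S.o_pow (hc j)]
    intro he
    have hqi := ha i hi
    have hqj := ha j hj
    apply hji
    apply hinj
    show S.o (c j) = S.o (c i)
    have e1 : (S.o (a i) + q * S.o (c i)) / q = S.o (c i) := by
      rw [Nat.add_mul_div_left _ _ (by omega), Nat.div_eq_of_lt hqi, zero_add]
    have e2 : (S.o (a j) + q * S.o (c j)) / q = S.o (c j) := by
      rw [Nat.add_mul_div_left _ _ (by omega), Nat.div_eq_of_lt hqj, zero_add]
    rw [← e1, ← e2, he]
  · simp

lemma W_pow {a : ℕ} {x : O} (h : x ∈ S.W a) (m : ℕ) : x ^ m ∈ S.W (m * a) := by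
  induction m with
  | zero => simpa using S.W_one
  | succ m ih => rw [pow_succ, Nat.succ_mul]; exact S.W_mul ih h

lemma δ_iter {a : ℕ} {x : O} (h : x ∈ S.W a) (r : ℕ) : S.δ^[r] x ∈ S.W (a + r * κ') := by
  induction r with
  | zero => simpa using h
  | succ r ih =>
    rw [Function.iterate_succ_apply', Nat.succ_mul, ← add_assoc]; exact S.δ_W ih

lemma card_W (a : ℕ) : Nat.card (S.W a) = Fintype.card F ^ Module.finrank F (S.W a) := by
  have := S.W_fin a
  have : Fintype (S.W a) := @Fintype.ofFinite _ (Module.finite_of_finite F)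
  rw [Nat.card_eq_fintype_card, Module.card_eq_pow_finrank (K := F)]

lemma finite_W (a : ℕ) : Finite (S.W a) := by
  have := S.W_fin a
  exact Module.finite_of_finite F

omit [IsDomain O] in
lemma card_O_eq : (Fintype.card F : O) = 0 := by
  rw [← map_natCast (algebraMap F O), FiniteField.cast_card_eq_zero, map_zero]

lemma van_iff {P : Ideal O} {r : ℕ} {x : O} : S.Van P r x ↔ ∀ i < r, S.δ^[i] x ∈ P := by
  induction r generalizing x with
  | zero => simp [Van]
  | succ r ih =>
    rw [Van, ih]
    constructor
    · rintro ⟨h0, h⟩ i hi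
      cases i with
      | zero => exact h0
      | succ i => exact h i (by omega)
    · intro h
      exact ⟨h 0 (by omega), fun i hi => h (i + 1) (by omega)⟩

lemma δ_sum {m : ℕ} (a c : Fin m → O) (i : ℕ) :
    S.δ^[i] (∑ x, a x * c x ^ Fintype.card F) = ∑ x, S.δ^[i] (a x) * c x ^ Fintype.card F := by
  induction i with
  | zero => rfl
  | succ i ih =>
    simp only [Function.iterate_succ_apply', ih, map_sum]
    apply Finset.sum_congr rfl
    intro x _
    rw [Derivation.leibniz, Derivation.leibniz_pow]
    simp only [smul_eq_mul, nsmul_eq_mul, card_O_eq, zero_mul, mul_zero, zero_add]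
    rw [mul_comm]

lemma case1 (g : G) (M A l : ℕ) (hM : ∀ i < M, (i.factorial : F) ≠ 0)
    (h1 : M + 1 + Fintype.card G * κ ≤ Fintype.card G * (l + 1))
    (h2 : M * (Fintype.card G * (A + M * κ' + l) + 1) + (M + 1) * (Fintype.card G * κ) <
      (M + 1) * (Fintype.card G * (A + 1)))
    (h3 : Fintype.card G * A < Fintype.card F) :
    M * (S.Nset g).card ≤ Fintype.card G * (A + Fintype.card F * l) := by
  obtain ⟨c, hcW, hc0, hcinj⟩ := S.exists_c l (M + 1) h1
  have := S.finite_W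
  let f : (Fin (M + 1) → S.W A) →+ (Fin M → S.W (A + M * κ' + l)) :=
    { toFun := fun a r => ⟨∑ i, S.δ^[r.1] (a i).1 * g • c i, by
        refine Submodule.sum_mem _ fun i _ => S.W_mul ?_ (S.W_smul g (hcW i))
        refine S.W_mono ?_ (S.δ_iter (a i).2 r)
        have := Nat.mul_le_mul_right κ' r.2.le
        omega⟩
      map_zero' := by
        ext r
        simp [iterate_map_zero]
      map_add' := by
        intro a b
        ext r
        simp [iterate_map_add, add_mul, Finset.sum_add_distrib] }
  obtain ⟨a, ha0, ha⟩ := pigeon f (by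
    rw [Nat.card_fun, Nat.card_fun, S.card_W, S.card_W, ← pow_mul, ← pow_mul]
    simp only [Nat.card_eq_fintype_card, Fintype.card_fin]
    apply Nat.pow_lt_pow_right Fintype.one_lt_card
    have e1 := S.W_dim A
    have e2 := S.finrank_le (A + M * κ' + l)
    have e3 := Nat.mul_le_mul_left (M + 1) e1
    have e4 := Nat.mul_le_mul_right M e2
    nlinarith)
  have hrel : ∀ r < M, ∑ i, S.δ^[r] (a i).1 * g • c i = 0 := by
    intro r hr
    have := congrFun ha ⟨r, hr⟩
    exact congrArg Subtype.val this
  have hne := S.sum_ne (fun i => (a i).1) c (Fintype.card F) hc0 hcinj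
    (fun i hi => (S.o_le hi (a i).2).trans_lt h3) (by
      intro h; apply ha0; ext i; exact congrFun h i)
  refine S.common g _ hne _ _ (Submodule.sum_mem _ fun i _ => S.W_mul (a i).2
    (S.W_pow (hcW i) _)) ?_
  rintro ⟨t, τ⟩ hx
  obtain ⟨ht, hg⟩ := S.mem_Nset.1 hx
  have hQ := S.Q_prime t ht
  have hP : (S.Qc t τ).IsPrime := Ideal.IsPrime.comap _
  refine S.van_ord (P := S.Qc t τ) ?_ ?_ (S.Qc_unram ht τ) M hM _ ?_
  · rw [mem_Qc, S.smul_j]; exact S.Q_X t ht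
  · rw [mem_Qc, S.smul_j]; exact S.j_notMem ht ht
  · rw [S.van_iff]
    intro r hr
    rw [S.δ_sum]
    have : ∑ i, S.δ^[r] (a i).1 * c i ^ Fintype.card F =
      - ∑ i, S.δ^[r] (a i).1 * (g • c i - c i ^ Fintype.card F) := by
      simp only [mul_sub, Finset.sum_sub_distrib, hrel r hr]; simp
    rw [this]
    refine neg_mem (Ideal.sum_mem _ fun i _ => Ideal.mul_mem_left _ _ ?_)
    have := S.Qc_frob ht (τ := τ) (c i)
    simp only at hg
    rwa [hg] at this

lemma case2 (g : G) (p μ q' A l : ℕ) [Fact p.Prime] [CharP F p] (hq : Fintype.card F = q' * p ^ μ)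
    (h1 : p ^ μ + 1 + Fintype.card G * κ ≤ Fintype.card G * (l + 1))
    (h2 : Fintype.card G * (p ^ μ * A + l) + 1 + (p ^ μ + 1) * (Fintype.card G * κ) <
      (p ^ μ + 1) * (Fintype.card G * (A + 1)))
    (h3 : Fintype.card G * A < q') :
    (S.Nset g).card ≤ Fintype.card G * (A + q' * l) := by
  have hCO : CharP O p := charP_of_injective_algebraMap (algebraMap F O).injective p
  obtain ⟨c, hcW, hc0, hcinj⟩ := S.exists_c l (p ^ μ + 1) h1
  have := S.finite_W
  let f : (Fin (p ^ μ + 1) → S.W A) →+ S.W (p ^ μ * A + l) :=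
    { toFun := fun a => ⟨∑ i, (a i).1 ^ p ^ μ * g • c i,
        Submodule.sum_mem _ fun i _ => S.W_mul (S.W_pow (a i).2 _) (S.W_smul g (hcW i))⟩
      map_zero' := by
        ext
        simp [(Nat.pos_of_ne_zero (Fact.out : p.Prime).ne_zero).ne']
      map_add' := by
        intro a b
        ext
        simp [add_pow_char_pow, add_mul, Finset.sum_add_distrib] }
  obtain ⟨a, ha0, ha⟩ := pigeon f (by
    rw [Nat.card_fun, S.card_W, S.card_W, ← pow_mul]
    simp only [Nat.card_eq_fintype_card, Fintype.card_fin]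
    apply Nat.pow_lt_pow_right Fintype.one_lt_card
    have e1 := S.W_dim A
    have e2 := S.finrank_le (p ^ μ * A + l)
    have e3 := Nat.mul_le_mul_left (p ^ μ + 1) e1
    nlinarith)
  have hrel : ∑ i, (a i).1 ^ p ^ μ * g • c i = 0 := congrArg Subtype.val ha
  have hne := S.sum_ne (fun i => (a i).1) c q' hc0 hcinj
    (fun i hi => (S.o_le hi (a i).2).trans_lt h3) (by
      intro h; apply ha0; ext i; exact congrFun h i)
  have := S.common g _ hne (A + q' * l) 1 (Submodule.sum_mem _ fun i _ => S.W_mul (a i).2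
    (S.W_pow (hcW i) _)) ?_
  · simpa using this
  rintro ⟨t, τ⟩ hx
  obtain ⟨ht, hg⟩ := S.mem_Nset.1 hx
  have hQ := S.Q_prime t ht
  have hP : (S.Qc t τ).IsPrime := Ideal.IsPrime.comap _
  have hmem : ∑ i, (a i).1 * c i ^ q' ∈ S.Qc t τ := by
    apply hP.mem_of_pow_mem (p ^ μ)
    rw [sum_pow_char_pow]
    simp only [mul_pow, ← pow_mul, ← hq]
    have : ∑ i, (a i).1 ^ p ^ μ * c i ^ Fintype.card F =
      - ∑ i, (a i).1 ^ p ^ μ * (g • c i - c i ^ Fintype.card F) := by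
      simp only [mul_sub, Finset.sum_sub_distrib, hrel]; simp
    rw [this]
    refine neg_mem (Ideal.sum_mem _ fun i _ => Ideal.mul_mem_left _ _ ?_)
    have := S.Qc_frob ht (τ := τ) (c i)
    simp only at hg
    rwa [hg] at this
  obtain ⟨e, he, hd⟩ := S.Qc_unram ht τ _ hmem
  exact ⟨e, he, by simpa using hd⟩

end Step
end S17
end

section
namespace S17
open Polynomial
namespace Step
variable {F O G : Type} [Field F] [Fintype F] [CommRing O] [IsDomain O] [Algebra F O]
    [Group G] [Fintype G] [MulSemiringAction G O] {κ κ' : ℕ} (S : Step F O G κ κ')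

/-- split parameter values -/
noncomputable def triv : Finset F := by
  classical
  exact Finset.univ.filter fun t => S.s.eval t ≠ 0 ∧ S.σ t = 1

lemma card_N1 : (S.Nset 1).card = Fintype.card G * S.triv.card := by
  classical
  have : S.Nset 1 = S.triv ×ˢ Finset.univ := by
    ext ⟨t, τ⟩
    simp [mem_Nset, triv, conj_eq_one_iff]
  rw [this, Finset.card_product, mul_comm, Finset.card_univ]

lemma sum_N : ∑ g, (S.Nset g).card + Fintype.card G * κ' ≥ Fintype.card G * Fintype.card F := by
  classical
  set good : Finset F := Finset.univ.filter fun t => S.s.eval t ≠ 0 with hg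
  have h1 : ∑ g, (S.Nset g).card = (good ×ˢ (Finset.univ : Finset G)).card := by
    rw [Finset.card_eq_sum_card_fiberwise (f := fun x : F × G => x.2 * S.σ x.1 * x.2⁻¹)
      (t := Finset.univ) (fun _ _ => by simp)]
    apply Finset.sum_congr rfl
    intro g _
    congr 1
    ext ⟨t, τ⟩
    simp [mem_Nset, hg]
  have h2 : Fintype.card F ≤ good.card + κ' := by
    rw [← Finset.card_univ, ← Finset.card_filter_add_card_filter_not (fun t => S.s.eval t ≠ 0)]
    apply Nat.add_le_add_left
    refine le_trans ?_ S.s_deg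
    refine le_trans ?_ (card_roots' S.s)
    refine le_trans ?_ (Multiset.toFinset_card_le _)
    apply Finset.card_le_card
    intro t ht
    simp only [Finset.mem_filter, not_not] at ht
    simpa [S.s_ne] using ht.2
  rw [h1, Finset.card_product, Finset.card_univ]
  nlinarith

lemma bound (n M0 A1 : ℕ) (hn : Fintype.card G = n) (hM0 : 2 ≤ M0)
    (hA1 : A1 = (M0 ^ 2 + 1) * κ + M0 ^ 2 * (M0 ^ 2 * κ' + κ + M0 ^ 2 + 2) + M0 ^ 2 + κ + M0 ^ 2 + 4)
    (hq : M0 ^ 2 * (n * A1 + 1) ≤ Fintype.card F) : ∃ M, M0 ≤ M ∧ ∀ g,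
    M * (S.Nset g).card ≤ n * A1 * M + Fintype.card F * (M + (n * κ + n + 1)) := by
  have hn0 : 0 < n := hn ▸ Fintype.card_pos
  obtain ⟨p, hp⟩ := CharP.exists F
  have hpp : Fact p.Prime := ⟨CharP.char_is_prime F p⟩
  obtain ⟨f, -, hf⟩ := FiniteField.card F p
  have aux : ∀ M, M ≤ M0 ^ 2 → ∃ l A, n * l ≤ M + (n * κ + n + 1) ∧ A ≤ A1 ∧
      M + 1 + n * κ ≤ n * (l + 1) ∧
      M * (n * (A + M * κ' + l) + 1) + (M + 1) * (n * κ) < (M + 1) * (n * (A + 1)) ∧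
      n * (M * A + l) + 1 + (M + 1) * (n * κ) < (M + 1) * (n * (A + 1)) := by
    intro M hM
    have hdiv := Nat.div_add_mod (M + 1) n
    have hmod := Nat.mod_lt (M + 1) hn0
    have hle := Nat.div_le_self (M + 1) n
    set d := (M + 1) / n with hd
    set r := (M + 1) % n with hr
    refine ⟨κ + d + 1, (M + 1) * κ + M * (M * κ' + (κ + d + 1)) + M + (κ + d + 1) + 2, ?_, ?_, ?_, ?_, ?_⟩
    · nlinarith
    · rw [hA1]
      have e1 : (M + 1) * κ ≤ (M0 ^ 2 + 1) * κ := by gcongr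
      have e2 : M * (M * κ' + (κ + d + 1)) ≤ M0 ^ 2 * (M0 ^ 2 * κ' + κ + M0 ^ 2 + 2) := by
        apply Nat.mul_le_mul hM
        have : M * κ' ≤ M0 ^ 2 * κ' := by gcongr
        omega
      omega
    · nlinarith
    · generalize κ + d + 1 = l
      nlinarith [Nat.zero_le (n * l), Nat.mul_le_mul_left M hn0]
    · generalize κ + d + 1 = l
      nlinarith [Nat.zero_le (n * M * (M * κ' + l)), Nat.mul_le_mul_left M hn0]
  by_cases hpM : M0 ≤ p
  · refine ⟨M0, le_rfl, fun g => ?_⟩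
    obtain ⟨l, A, h0, hA, h1, h2, -⟩ := aux M0 (by nlinarith)
    have := S.case1 g M0 A l ?_ (by rwa [hn]) (by rwa [hn]) (by
      rw [hn]
      have e1 : n * A ≤ n * A1 := by gcongr
      have e2 : n * A1 + 1 ≤ M0 ^ 2 * (n * A1 + 1) := Nat.le_mul_of_pos_left _ (by positivity)
      omega)
    · rw [hn] at this
      have e1 : n * A ≤ n * A1 * M0 := by
        calc n * A ≤ n * A1 := by gcongr
          _ ≤ _ := Nat.le_mul_of_pos_right _ (by omega)
      have e2 := Nat.mul_le_mul_left (Fintype.card F) h0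
      nlinarith
    · intro i hi h0
      rw [CharP.cast_eq_zero_iff F p, hpp.out.dvd_factorial] at h0
      omega
  · push Not at hpM
    have hex : ∃ μ, M0 ≤ p ^ μ := ⟨M0, (Nat.lt_pow_self hpp.out.one_lt).le⟩
    classical
    set μ := Nat.find hex with hμ
    have hμ1 : M0 ≤ p ^ μ := Nat.find_spec hex
    have hμ2 : p ^ μ ≤ M0 ^ 2 := by
      cases h : μ with
      | zero => rw [pow_zero]; nlinarith
      | succ ν =>
        have := Nat.find_min hex (m := ν) (by omega)
        push Not at this
        rw [pow_succ, pow_two]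
        exact Nat.mul_le_mul this.le hpM.le
    have hμf : μ ≤ f := by
      rw [← Nat.pow_le_pow_iff_right hpp.out.one_lt, ← hf]
      refine hμ2.trans (le_trans ?_ hq)
      exact Nat.le_mul_of_pos_right _ (by omega)
    have hqq : Fintype.card F = p ^ (f - μ : ℕ) * p ^ μ := by
      rw [hf, ← pow_add]; congr 1; omega
    refine ⟨p ^ μ, hμ1, fun g => ?_⟩
    obtain ⟨l, A, h0, hA, h1, -, h2⟩ := aux (p ^ μ) hμ2
    have := S.case2 g p μ (p ^ (f - μ : ℕ)) A l hqq (by rwa [hn]) (by rwa [hn]) ?_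
    · rw [hn] at this
      have h3 := Nat.mul_le_mul_left (p ^ μ) this
      have e2 := Nat.mul_le_mul_left (Fintype.card F) h0
      have e1 : n * A * p ^ μ ≤ n * A1 * p ^ μ := by gcongr
      calc _ ≤ _ := h3
        _ = n * A * p ^ μ + Fintype.card F * (n * l) := by rw [hqq]; ring
        _ ≤ _ := Nat.add_le_add e1 e2
    · rw [hn]
      have e1 : n * A ≤ n * A1 := by gcongr
      by_contra hlt
      push Not at hlt
      have e3 : p ^ (f - μ : ℕ) * p ^ μ ≤ (n * A1) * M0 ^ 2 := Nat.mul_le_mul (hlt.trans e1) hμ2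
      have : 0 < M0 ^ 2 := by positivity
      nlinarith

end Step

theorem stepU (n κ κ' K : ℕ) (hn : 0 < n) (hK : 0 < K) : ∃ Q0, ∀ (F O G : Type) [Field F] [Fintype F]
    [CommRing O] [IsDomain O] [Algebra F O]
    [Group G] [Fintype G] [MulSemiringAction G O] (S : Step F O G κ κ'), Fintype.card G = n →
    Q0 ≤ Fintype.card F → K * Fintype.card F ≤ K * n * S.triv.card + Fintype.card F := by
  set B := n * κ + n + 1 with hB
  obtain ⟨M0, hM0⟩ : ∃ M0, M0 = 2 * K * n * B := ⟨_, rfl⟩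
  obtain ⟨A1, hA1⟩ : ∃ A1, A1 = (M0 ^ 2 + 1) * κ + M0 ^ 2 * (M0 ^ 2 * κ' + κ + M0 ^ 2 + 2) +
    M0 ^ 2 + κ + M0 ^ 2 + 4 := ⟨_, rfl⟩
  have hB1 : 1 ≤ B := by omega
  have hM2 : 2 ≤ M0 := by
    rw [hM0]
    have : 0 < K * n * B := by positivity
    nlinarith
  refine ⟨M0 ^ 2 * (n * A1 + 1) + 2 * K * n * κ' + 2 * K * n * n * A1, ?_⟩
  intro F O G _ _ _ _ _ _ _ _ S hG hq
  classical
  obtain ⟨M, hM, hb⟩ := S.bound n M0 A1 hG hM2 hA1 (by omega)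
  set q := Fintype.card F with hqd
  have key : ∀ g, 2 * K * n * (S.Nset g).card ≤ q + 2 * K * n * (q + n * A1) := by
    intro g
    have h := hb g
    by_cases hc : (S.Nset g).card ≤ q + n * A1
    · have := Nat.mul_le_mul_left (2 * K * n) hc
      omega
    · push Not at hc
      obtain ⟨e, he⟩ := Nat.exists_eq_add_of_lt hc
      rw [he] at h ⊢
      have h1 : M * (e + 1) ≤ q * B := by nlinarith
      have h2 : M0 * (e + 1) ≤ q * B := le_trans (Nat.mul_le_mul_right _ hM) h1
      rw [hM0] at h2
      have h3 : 2 * K * n * (e + 1) ≤ q := by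
        apply Nat.le_of_mul_le_mul_right (c := B) _ (by omega)
        nlinarith
      nlinarith
  have hs := S.sum_N
  rw [← Finset.add_sum_erase _ _ (Finset.mem_univ (1 : G)), S.card_N1, hG] at hs
  have hsum : 2 * K * n * ∑ g ∈ Finset.univ.erase (1 : G), (S.Nset g).card ≤
      (n - 1) * (q + 2 * K * n * (q + n * A1)) := by
    rw [Finset.mul_sum]
    refine (Finset.sum_le_card_nsmul _ _ _ fun g _ => key g).trans ?_
    rw [Finset.card_erase_of_mem (Finset.mem_univ _), Finset.card_univ, hG, smul_eq_mul]
  obtain ⟨m, rfl⟩ : ∃ m, n = m + 1 := ⟨n - 1, by omega⟩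
  rw [Nat.add_sub_cancel] at hsum
  set U := ∑ g ∈ Finset.univ.erase (1 : G), (S.Nset g).card
  set T := S.triv.card
  rw [← hqd] at hs
  have h1 := Nat.mul_le_mul_left (2 * K * (m + 1)) hs
  have hq2 : 2 * K * (m + 1) * κ' + 2 * K * (m + 1) * (m + 1) * A1 ≤ q := by
    have := Nat.zero_le (M0 ^ 2 * ((m + 1) * A1 + 1)); omega
  have h3 := Nat.mul_le_mul_left (m + 1) hq2
  apply Nat.le_of_mul_le_mul_left (c := 2 * (m + 1)) _ (by omega)
  clear hb key hq hs hM hA1 hM0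
  clear_value U T q
  zify at h1 h3 hsum hq2 ⊢
  nlinarith [mul_nonneg (mul_nonneg (Int.natCast_nonneg K) (Int.natCast_nonneg A1)) (sq_nonneg ((m : ℤ) + 1))]

end S17
end

section
namespace S17
set_option linter.unusedSectionVars false
open Polynomial

section Gal
variable {F O ι : Type} (L : Type) [Field F] [CommRing O] [IsDomain O] [Algebra F[X] O] [Field L]
  [Algebra O L] [IsFractionRing O L] [Algebra F[X] L] [IsScalarTower F[X] O L] [Algebra (RatFunc F) L]
  [IsScalarTower F[X] (RatFunc F) L] [Fintype ι] {y : ι → O} {P : F[X][X]}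
  (hgen : Algebra.adjoin F[X] (Set.range y) = ⊤)
  (hP : P.map (algebraMap F[X] O) = ∏ i, (X - C (y i))) (hy : Function.Injective y)

include hP in
lemma PL : (P.map (algebraMap F[X] (RatFunc F))).map (algebraMap (RatFunc F) L) =
    ∏ i, (X - C (algebraMap O L (y i))) := by
  rw [map_map, ← IsScalarTower.algebraMap_eq, IsScalarTower.algebraMap_eq F[X] O L, ← map_map, hP,
    Polynomial.map_prod]
  simp

lemma algO_inj : Function.Injective (algebraMap O L) := IsFractionRing.injective O L

include L in
lemma alg_inj : Function.Injective (algebraMap F[X] O) := by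
  have h : Function.Injective (algebraMap F[X] L) := by
    rw [IsScalarTower.algebraMap_eq F[X] (RatFunc F) L]
    exact (algebraMap (RatFunc F) L).injective.comp (IsFractionRing.injective F[X] (RatFunc F))
  rw [IsScalarTower.algebraMap_eq F[X] O L] at h
  rw [RingHom.coe_comp] at h
  exact h.of_comp

include hP in
lemma Pmonic (hinj : Function.Injective (algebraMap F[X] O)) : P.Monic := by
  have : (P.map (algebraMap F[X] O)).Monic := by
    rw [hP]; exact monic_prod_of_monic _ _ fun i _ => monic_X_sub_C _
  exact monic_of_injective hinj this

include hP in
lemma P_root (i : ι) : aeval (y i) P = 0 := by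
  classical
  rw [aeval_def, ← eval_map, hP, eval_prod]
  exact Finset.prod_eq_zero (Finset.mem_univ i) (by simp)

include hgen hP in
lemma O_int (hinj : Function.Injective (algebraMap F[X] O)) : Algebra.IsIntegral F[X] O := by
  rw [← integralClosure_eq_top_iff, eq_top_iff, ← hgen, Algebra.adjoin_le_iff]
  rintro _ ⟨i, rfl⟩
  exact ⟨P, Pmonic hP hinj, P_root hP i⟩

include hgen hP in
lemma isSplit : IsSplittingField (RatFunc F) L (P.map (algebraMap F[X] (RatFunc F))) := by
  rw [isSplittingField_iff_intermediateField]
  refine ⟨?_, ?_⟩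
  · rw [PL L hP]
    exact Splits.prod fun i _ => Splits.X_sub_C _
  · rw [eq_top_iff]
    rintro x -
    have hPne : P.map (algebraMap F[X] (RatFunc F)) ≠ 0 :=
      ((Pmonic hP (alg_inj L)).map _).ne_zero
    set E := IntermediateField.adjoin (RatFunc F) ((P.map (algebraMap F[X] (RatFunc F))).rootSet L)
    have hO : ∀ o : O, algebraMap O L o ∈ E := by
      intro o
      have ho : o ∈ Algebra.adjoin F[X] (Set.range y) := by rw [hgen]; trivial
      induction ho using Algebra.adjoin_induction with
      | mem x hx =>
        obtain ⟨i, rfl⟩ := hx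
        apply IntermediateField.subset_adjoin
        rw [mem_rootSet]
        refine ⟨hPne, ?_⟩
        rw [aeval_map_algebraMap, aeval_algebraMap_apply, P_root hP, map_zero]
      | algebraMap r =>
        rw [← IsScalarTower.algebraMap_apply, IsScalarTower.algebraMap_apply F[X] (RatFunc F) L]
        exact E.algebraMap_mem _
      | add x y _ _ hx hy => rw [map_add]; exact E.add_mem hx hy
      | mul x y _ _ hx hy => rw [map_mul]; exact E.mul_mem hx hy
    obtain ⟨a, b, hb, rfl⟩ := IsFractionRing.div_surjective O x
    exact E.div_mem (hO a) (hO b)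

include hgen hP hy in
lemma isGal : IsGalois (RatFunc F) L := by
  have := isSplit L hgen hP
  apply IsGalois.of_separable_splitting_field (p := P.map (algebraMap F[X] (RatFunc F)))
  rw [← separable_map (algebraMap (RatFunc F) L), PL L hP, separable_prod_X_sub_C_iff]
  exact (algO_inj L).comp hy

include hgen hP in
lemma finDim : FiniteDimensional (RatFunc F) L := by
  have := isSplit L hgen hP
  exact IsSplittingField.finiteDimensional L (P.map (algebraMap F[X] (RatFunc F)))

include hgen hP in
lemma gal_restr (σ : Gal(L/(RatFunc F))) (o : O) : ∃ z : O, algebraMap O L z = σ (algebraMap O L o) := by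
  have ho : o ∈ Algebra.adjoin F[X] (Set.range y) := by rw [hgen]; trivial
  induction ho using Algebra.adjoin_induction with
  | mem x hx =>
    obtain ⟨i, rfl⟩ := hx
    have h1 : aeval (σ (algebraMap O L (y i))) (P.map (algebraMap F[X] (RatFunc F))) = 0 := by
      rw [show σ (algebraMap O L (y i)) = σ.toAlgHom (algebraMap O L (y i)) from rfl,
        aeval_algHom_apply, aeval_map_algebraMap, aeval_algebraMap_apply, P_root hP, map_zero, map_zero]
    rw [aeval_def, ← eval_map, PL L hP, eval_prod, Finset.prod_eq_zero_iff] at h1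
    obtain ⟨k, -, hk⟩ := h1
    refine ⟨y k, ?_⟩
    simp only [eval_sub, eval_X, eval_C] at hk
    exact (sub_eq_zero.1 hk).symm
  | algebraMap r =>
    refine ⟨algebraMap _ _ r, ?_⟩
    rw [← IsScalarTower.algebraMap_apply, IsScalarTower.algebraMap_apply F[X] (RatFunc F) L]
    exact (σ.commutes _).symm
  | add x y _ _ hx hy =>
    obtain ⟨a, ha⟩ := hx
    obtain ⟨b, hb⟩ := hy
    exact ⟨a + b, by simp [ha, hb]⟩
  | mul x y _ _ hx hy =>
    obtain ⟨a, ha⟩ := hx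
    obtain ⟨b, hb⟩ := hy
    exact ⟨a * b, by simp [ha, hb]⟩

include hgen hP in
lemma gal_surj : Function.Bijective (IsFractionRing.fieldEquivOfAlgEquivHom (A := F[X]) (B := O)
    (RatFunc F) L) := by
  refine ⟨IsFractionRing.fieldEquivOfAlgEquivHom_injective _ _ _ _, fun σ => ?_⟩
  choose f hf using gal_restr L hgen hP σ
  choose f' hf' using gal_restr L hgen hP σ.symm
  have hinj := algO_inj (O := O) L
  let g : O ≃ₐ[F[X]] O :=
    { toFun := f
      invFun := f'
      left_inv := fun x => hinj (by rw [hf', hf]; simp)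
      right_inv := fun x => hinj (by rw [hf, hf']; simp)
      map_mul' := fun a b => hinj (by simp [hf])
      map_add' := fun a b => hinj (by simp [hf])
      commutes' := fun r => hinj (by
        rw [hf, ← IsScalarTower.algebraMap_apply, IsScalarTower.algebraMap_apply F[X] (RatFunc F) L]
        exact (σ.commutes _)) }
  refine ⟨g, ?_⟩
  have hg : ∀ o : O, IsFractionRing.fieldEquivOfAlgEquivHom (RatFunc F) L g (algebraMap O L o) =
      σ (algebraMap O L o) := by
    intro o
    rw [← hf o]
    exact IsFractionRing.fieldEquivOfAlgEquiv_algebraMap (RatFunc F) L L g o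
  ext x
  obtain ⟨a, b, hb, rfl⟩ := IsFractionRing.div_surjective O x
  rw [map_div₀, map_div₀, hg, hg]

/-- identification of automorphism groups -/
noncomputable def galEquiv : (O ≃ₐ[F[X]] O) ≃ Gal(L/(RatFunc F)) :=
  Equiv.ofBijective _ (gal_surj L hgen hP)

lemma galEquiv_apply (g : O ≃ₐ[F[X]] O) (o : O) :
    galEquiv L hgen hP g (algebraMap O L o) = algebraMap O L (g o) :=
  IsFractionRing.fieldEquivOfAlgEquiv_algebraMap (RatFunc F) L L g o

include L hgen hP in
lemma finG : Finite (O ≃ₐ[F[X]] O) := by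
  have := finDim L hgen hP
  exact Finite.of_equiv _ (galEquiv L hgen hP).symm

include hgen hP hy in
lemma cardG : Nat.card (O ≃ₐ[F[X]] O) = Module.finrank (RatFunc F) L := by
  have := finDim L hgen hP
  have := isGal L hgen hP hy
  rw [← IsGalois.card_aut_eq_finrank (RatFunc F) L]
  exact Nat.card_congr (galEquiv L hgen hP)

include L hgen hP in
lemma descend {x : RatFunc F} {o : O} (h : algebraMap (RatFunc F) L x = algebraMap O L o) :
    ∃ f : F[X], algebraMap F[X] O f = o ∧ algebraMap F[X] (RatFunc F) f = x := by
  have hint := O_int hgen hP (alg_inj L)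
  have h1 : IsIntegral F[X] (algebraMap (RatFunc F) L x) := by
    rw [h]; exact (hint.isIntegral o).algebraMap
  rw [isIntegral_algebraMap_iff (algebraMap (RatFunc F) L).injective] at h1
  obtain ⟨f, rfl⟩ := IsIntegrallyClosed.isIntegral_iff.1 h1
  refine ⟨f, algO_inj L ?_, rfl⟩
  rw [← h, ← IsScalarTower.algebraMap_apply, ← IsScalarTower.algebraMap_apply]

include L hgen hP hy in
lemma isInv : Algebra.IsInvariant F[X] O (O ≃ₐ[F[X]] O) := by
  have := finDim L hgen hP
  have := isGal L hgen hP hy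
  refine ⟨fun b hb => ?_⟩
  have : algebraMap O L b ∈ Set.range (algebraMap (RatFunc F) L) := by
    rw [IsGalois.mem_range_algebraMap_iff_fixed]
    intro σ
    obtain ⟨g, rfl⟩ := (galEquiv L hgen hP).surjective σ
    rw [galEquiv_apply]
    exact congrArg _ (hb g)
  obtain ⟨x, hx⟩ := this
  obtain ⟨f, hf, -⟩ := descend L hgen hP hx
  exact ⟨f, hf⟩

end Gal
end S17
end

section
namespace S17
set_option linter.unusedSectionVars false
open Polynomial

section W
variable {F O ι : Type} [Field F] [CommRing O] [IsDomain O] [Algebra F[X] O]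
  [Algebra F O] [IsScalarTower F F[X] O] [Fintype ι]

/-- filtration by weight -/
def WW (F : Type) [Field F] [Algebra F[X] O] [Algebra F O] (y : ι → O) (c l : ℕ) : Submodule F O :=
  Submodule.span F {x | ∃ (i : ℕ) (e : ι → ℕ), i + c * ∑ j, e j ≤ l ∧
    x = algebraMap F[X] O X ^ i * ∏ j, y j ^ e j}

lemma WW_mono (y : ι → O) (c : ℕ) : Monotone (WW F y c) := by
  intro a b hab
  apply Submodule.span_mono
  rintro x ⟨i, e, h, rfl⟩
  exact ⟨i, e, h.trans hab, rfl⟩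

lemma WW_mul (y : ι → O) (c : ℕ) {a b : ℕ} {x z : O} (hx : x ∈ WW F y c a) (hz : z ∈ WW F y c b) :
    x * z ∈ WW F y c (a + b) := by
  have : WW F y c a * WW F y c b ≤ WW F y c (a + b) := by
    rw [WW, WW, Submodule.span_mul_span]
    apply Submodule.span_mono
    rintro _ ⟨_, ⟨i, e, h, rfl⟩, _, ⟨i', e', h', rfl⟩, rfl⟩
    refine ⟨i + i', e + e', ?_, ?_⟩
    · simp only [Pi.add_apply, Finset.sum_add_distrib, mul_add]; omega
    · simp only [Pi.add_apply, pow_add, Finset.prod_mul_distrib]; ring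
  exact this (Submodule.mul_mem_mul hx hz)

lemma WW_one (y : ι → O) (c : ℕ) : 1 ∈ WW F y c 0 :=
  Submodule.subset_span ⟨0, 0, by simp, by simp⟩

lemma WW_X (y : ι → O) (c : ℕ) : algebraMap F[X] O X ∈ WW F y c 1 :=
  Submodule.subset_span ⟨1, 0, by simp, by simp⟩

lemma WW_y (y : ι → O) (c : ℕ) (k : ι) : y k ∈ WW F y c c := by
  classical
  exact Submodule.subset_span ⟨0, Pi.single k 1, by simp, by
    rw [Finset.prod_eq_single k]
    · simp
    · intro b _ hb; simp [hb]
    · simp⟩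

lemma WW_pow (y : ι → O) (c : ℕ) {a : ℕ} {x : O} (h : x ∈ WW F y c a) (m : ℕ) :
    x ^ m ∈ WW F y c (m * a) := by
  induction m with
  | zero => simpa using WW_one y c
  | succ m ih => rw [pow_succ, Nat.succ_mul]; exact WW_mul y c ih h

lemma WW_prod (y : ι → O) (c : ℕ) {κ : Type} (A : Finset κ) (f : κ → O) (a : ℕ)
    (h : ∀ i ∈ A, f i ∈ WW F y c a) : ∏ i ∈ A, f i ∈ WW F y c (A.card * a) := by
  classical
  induction A using Finset.induction_on with
  | empty => simpa using WW_one y c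
  | insert x A hx ih =>
    rw [Finset.prod_insert hx, Finset.card_insert_of_notMem hx, Nat.succ_mul, add_comm]
    exact WW_mul y c (h x (by simp)) (ih fun i hi => h i (by simp [hi]))

lemma WW_poly (y : ι → O) (c : ℕ) (f : F[X]) {d : ℕ} (hf : f.natDegree ≤ d) :
    algebraMap F[X] O f ∈ WW F y c d := by
  rw [f.as_sum_range, map_sum]
  refine Submodule.sum_mem _ fun i hi => ?_
  rw [← C_mul_X_pow_eq_monomial, map_mul, map_pow]
  have h1 : algebraMap F[X] O (C (f.coeff i)) = algebraMap F O (f.coeff i) :=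
    (IsScalarTower.algebraMap_apply F F[X] O _).symm
  rw [h1, ← Algebra.smul_def]
  apply Submodule.smul_mem
  have := WW_pow y c (WW_X (F := F) y c) i
  refine WW_mono y c ?_ this
  have := Finset.mem_range.1 hi
  omega

lemma WW_aeval (y : ι → O) (c : ℕ) (f : F[X][X]) (k : ι) {d m : ℕ} (hf : f.natDegree ≤ m)
    (hd : ∀ i, (f.coeff i).natDegree ≤ d) : aeval (y k) f ∈ WW F y c (d + m * c) := by
  rw [aeval_eq_sum_range]
  refine Submodule.sum_mem _ fun i hi => ?_
  rw [Algebra.smul_def]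
  refine WW_mul y c (WW_poly y c _ (hd i)) ?_
  refine WW_mono y c ?_ (WW_pow y c (WW_y (F := F) y c k) i)
  apply Nat.mul_le_mul_right
  have := Finset.mem_range.1 hi
  omega

lemma WW_ind (y : ι → O) (c : ℕ) (p : ℕ → O → Prop) (h1 : p 0 1) (hX : p 1 (algebraMap F[X] O X))
    (hy : ∀ i, p c (y i)) (hmul : ∀ a b x z, p a x → p b z → p (a + b) (x * z))
    (hmono : ∀ a b x, a ≤ b → p a x → p b x) (hadd : ∀ a x z, p a x → p a z → p a (x + z))
    (hsmul : ∀ a (r : F) x, p a x → p a (r • x)) {l : ℕ} {x : O} (hx : x ∈ WW F y c l) : p l x := by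
  classical
  have hpow : ∀ a x m, p a x → p (m * a) (x ^ m) := by
    intro a x m h
    induction m with
    | zero => simpa using h1
    | succ m ih => rw [pow_succ, Nat.succ_mul]; exact hmul _ _ _ _ ih h
  have h0 : ∀ a, p a 0 := fun a => by
    have := hsmul a 0 1 (hmono 0 a _ (Nat.zero_le a) h1)
    simpa using this
  induction hx using Submodule.span_induction with
  | mem x h =>
    obtain ⟨i, e, hle, rfl⟩ := h
    refine hmono _ _ _ hle (hmul _ _ _ _ (by simpa using hpow _ _ i hX) ?_)
    have : ∀ A : Finset ι, p (c * ∑ j ∈ A, e j) (∏ j ∈ A, y j ^ e j) := by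
      intro A
      induction A using Finset.induction_on with
      | empty => simpa using h1
      | insert x A hx ih =>
        rw [Finset.prod_insert hx, Finset.sum_insert hx, mul_add]
        refine hmul _ _ _ _ ?_ ih
        rw [mul_comm c]; exact hpow _ _ _ (hy x)
    exact this _
  | zero => exact h0 _
  | add x z _ _ hx hz => exact hadd _ _ _ hx hz
  | smul r x _ hx => exact hsmul _ _ _ hx

lemma WW_fin (y : ι → O) (c : ℕ) (hc : 0 < c) (l : ℕ) : FiniteDimensional F (WW F y c l) := by
  classical
  apply FiniteDimensional.span_of_finite
  apply Set.Finite.subset (s := (fun x : ℕ × (ι → ℕ) => algebraMap F[X] O X ^ x.1 * ∏ j, y j ^ x.2 j) ''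
    (Set.Iic (l, fun _ => l)))
  · exact (Set.finite_Iic _).image _
  · rintro x ⟨i, e, h, rfl⟩
    refine ⟨(i, e), ⟨by simp only; omega, fun k => ?_⟩, rfl⟩
    have h1 : e k ≤ ∑ j, e j := Finset.single_le_sum (fun _ _ => Nat.zero_le _) (Finset.mem_univ k)
    have h2 : ∑ j, e j ≤ c * ∑ j, e j := Nat.le_mul_of_pos_left _ hc
    simp only; omega

variable (L : Type) [Field L]
  [Algebra O L] [IsFractionRing O L] [Algebra F[X] L] [IsScalarTower F[X] O L] [Algebra (RatFunc F) L]
  [IsScalarTower F[X] (RatFunc F) L] {y : ι → O} {P : F[X][X]}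
  (hgen : Algebra.adjoin F[X] (Set.range y) = ⊤)
  (hP : P.map (algebraMap F[X] O) = ∏ i, (X - C (y i))) (hy : Function.Injective y)
  (c : ℕ) (hc : 0 < c) (hPc : ∀ i, (P.coeff i).natDegree ≤ c)

/-- t in L -/
noncomputable def tL : L := algebraMap F[X] L X

lemma tL_eq : tL (F := F) L = algebraMap (RatFunc F) L RatFunc.X := by
  rw [tL, IsScalarTower.algebraMap_apply F[X] (RatFunc F) L, RatFunc.algebraMap_X]

lemma tL_ne : tL (F := F) L ≠ 0 := by
  rw [tL_eq, Ne, map_eq_zero]; exact RatFunc.X_ne_zero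

include hP in
lemma y_perm (g : O ≃ₐ[F[X]] O) (i : ι) : ∃ k, g (y i) = y k := by
  have h1 : aeval (g (y i)) P = 0 := by
    rw [show g (y i) = g.toAlgHom (y i) from rfl, aeval_algHom_apply, P_root hP, map_zero]
  rw [aeval_def, ← eval_map, hP, eval_prod, Finset.prod_eq_zero_iff] at h1
  obtain ⟨k, -, hk⟩ := h1
  exact ⟨k, by simpa [sub_eq_zero] using hk⟩

include hP in
lemma WW_G (g : O ≃ₐ[F[X]] O) {l : ℕ} {x : O} (hx : x ∈ WW F y c l) : g x ∈ WW F y c l := by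
  refine WW_ind y c (fun l x => g x ∈ WW F y c l) ?_ ?_ ?_ ?_ ?_ ?_ ?_ hx
  · simpa using WW_one y c
  · simpa using WW_X y c
  · intro i
    obtain ⟨k, hk⟩ := y_perm hP g i
    rw [hk]; exact WW_y y c k
  · intro a b x z hx hz
    rw [map_mul]; exact WW_mul y c hx hz
  · intro a b x hab hx
    exact WW_mono y c hab hx
  · intro a x z hx hz
    rw [map_add]; exact Submodule.add_mem _ hx hz
  · intro a r x hx
    have : g (r • x) = r • g x := by
      rw [← algebraMap_smul F[X] r x, ← algebraMap_smul F[X] r (g x), map_smul]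
    rw [this]; exact Submodule.smul_mem _ _ hx

open Classical in
lemma infty_int (k : ℕ) (f : F[X]) (hf : f.natDegree ≤ k) :
    algebraMap F[X] (RatFunc F) f * (RatFunc.X ^ k)⁻¹ ∈ (RatFunc.inftyValuation F).integer := by
  by_cases h0 : f = 0
  · simp [h0]
  rw [Valuation.mem_integer_iff, map_mul, map_inv₀, RatFunc.inftyValuation_apply,
    RatFunc.inftyValuation.polynomial F h0, map_pow, RatFunc.inftyValuation.X, ← WithZero.exp_nsmul,
    ← WithZero.exp_neg, ← WithZero.exp_add, ← WithZero.exp_zero, WithZero.exp_le_exp]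
  simp; omega

open Classical in
lemma infty_int' (k : ℕ) (f : F[X]) (hf : algebraMap F[X] (RatFunc F) f * (RatFunc.X ^ k)⁻¹ ∈
    (RatFunc.inftyValuation F).integer) : f.natDegree ≤ k := by
  by_cases h0 : f = 0
  · simp [h0]
  rw [Valuation.mem_integer_iff, map_mul, map_inv₀, RatFunc.inftyValuation_apply,
    RatFunc.inftyValuation.polynomial F h0, map_pow, RatFunc.inftyValuation.X, ← WithZero.exp_nsmul,
    ← WithZero.exp_neg, ← WithZero.exp_add, ← WithZero.exp_zero, WithZero.exp_le_exp] at hf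
  simp at hf; omega

open Classical in
/-- integral at infinity -/
def IntInf (F : Type) [Field F] (L : Type) [Field L] [Algebra (RatFunc F) L] (z : L) : Prop :=
  IsIntegral (RatFunc.inftyValuation F).integer z

open Classical in
lemma intInf_alg (z : RatFunc F) (hz : z ∈ (RatFunc.inftyValuation F).integer) :
    IntInf F L (algebraMap (RatFunc F) L z) := by
  have : algebraMap (RatFunc F) L z = algebraMap (RatFunc.inftyValuation F).integer L ⟨z, hz⟩ := rfl
  rw [IntInf, this]
  exact isIntegral_algebraMap

include hP hPc hc in
lemma intInf_y (i : ι) : IntInf F L (algebraMap O L (y i) * (tL (F := F) L ^ c)⁻¹) := by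
  classical
  have hmon := Pmonic hP (alg_inj L)
  set V := (RatFunc.inftyValuation F).integer
  have hmem : ∀ k, algebraMap F[X] (RatFunc F) (P.coeff k) * (RatFunc.X ^ (c * (P.natDegree - k)))⁻¹ ∈ V := by
    intro k
    apply infty_int
    by_cases hk : k < P.natDegree
    · exact (hPc k).trans (Nat.le_mul_of_pos_right _ (by omega))
    · rcases (not_lt.1 hk).eq_or_lt with h | h
      · rw [← h, coeff_natDegree, hmon.leadingCoeff]; simp
      · rw [coeff_eq_zero_of_natDegree_lt h]; simp
  set N := P.natDegree
  let R : V[X] := X ^ N + ∑ k ∈ Finset.range N, C ⟨_, hmem k⟩ * X ^ k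
  have ht := tL_ne (F := F) L
  refine ⟨R, ?_, ?_⟩
  · apply monic_X_pow_add
    rw [degree_lt_iff_coeff_zero]
    intro m hm
    simp only [finsetSum_coeff, coeff_C_mul, coeff_X_pow]
    apply Finset.sum_eq_zero
    intro k hk
    rw [if_neg (by have := Finset.mem_range.1 hk; omega), mul_zero]
  · have h0 := P_root hP i
    have h1 := congrArg (algebraMap O L) h0
    rw [aeval_eq_sum_range, Finset.sum_range_succ, coeff_natDegree, hmon.leadingCoeff, one_smul,
      map_add, map_zero, map_sum] at h1
    have h2 : eval₂ (algebraMap V L) (algebraMap O L (y i) * (tL (F := F) L ^ c)⁻¹) R =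
      (tL (F := F) L ^ (c * N))⁻¹ * (∑ x ∈ Finset.range N, algebraMap O L (P.coeff x • y i ^ x)
         + algebraMap O L (y i ^ N)) := by
      simp only [R, eval₂_add, eval₂_pow, eval₂_X, eval₂_finsetSum, eval₂_mul, eval₂_C]
      rw [add_comm, mul_add, Finset.mul_sum]
      congr 1
      · apply Finset.sum_congr rfl
        intro k hk
        have hkN : k < N := Finset.mem_range.1 hk
        have e1 : algebraMap V L ⟨_, hmem k⟩ = algebraMap (RatFunc F) L
          (algebraMap F[X] (RatFunc F) (P.coeff k) * (RatFunc.X ^ (c * (N - k)))⁻¹) := rfl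
        rw [e1, map_mul, map_inv₀, map_pow, ← tL_eq, ← IsScalarTower.algebraMap_apply,
          Algebra.smul_def, map_mul, ← IsScalarTower.algebraMap_apply, map_pow, mul_pow, inv_pow,
          ← pow_mul]
        have e2 : tL (F := F) L ^ (c * N) = tL (F := F) L ^ (c * (N - k)) * tL (F := F) L ^ (c * k) := by
          rw [← pow_add, ← mul_add]; congr 2; omega
        rw [e2, mul_inv]; ring
      · rw [map_pow, mul_pow, inv_pow, ← pow_mul, mul_comm]
    rw [h2, h1, mul_zero]

include hP hPc hc in
lemma intInf_W {l : ℕ} {x : O} (hx : x ∈ WW F y c l) :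
    IntInf F L (algebraMap O L x * (tL (F := F) L ^ l)⁻¹) := by
  classical
  have ht := tL_ne (F := F) L
  have hXi : IntInf F L (tL (F := F) L)⁻¹ := by
    have := intInf_alg L _ (infty_int (F := F) 1 1 (by simp))
    simpa [tL_eq] using this
  refine WW_ind y c (fun l x => IntInf F L (algebraMap O L x * (tL (F := F) L ^ l)⁻¹))
    ?_ ?_ ?_ ?_ ?_ ?_ ?_ hx
  · have : IntInf F L 1 := isIntegral_one
    simpa using this
  · have : algebraMap O L (algebraMap F[X] O X) = tL (F := F) L := by
      rw [← IsScalarTower.algebraMap_apply]; rfl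
    simp only [this, pow_one, mul_inv_cancel₀ ht]
    exact isIntegral_one
  · exact intInf_y L hP c hc hPc
  · intro a b x z hx hz
    have : IntInf F L _ := IsIntegral.mul hx hz
    rw [map_mul, pow_add, mul_inv]
    convert this using 1; ring
  · intro a b x hab hx
    obtain ⟨d, rfl⟩ := Nat.exists_eq_add_of_le hab
    have : IntInf F L _ := IsIntegral.mul hx (IsIntegral.pow hXi d)
    rw [pow_add, mul_inv]
    convert this using 1; rw [inv_pow]; ring
  · intro a x z hx hz
    have := IsIntegral.add hx hz
    rwa [← add_mul, ← map_add] at this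
  · intro a r x hx
    have h1 : IntInf F L (algebraMap F[X] L (C r)) := by
      have := intInf_alg L _ (infty_int (F := F) 0 (C r) (by simp))
      simp only [pow_zero, inv_one, mul_one, ← IsScalarTower.algebraMap_apply] at this
      exact this
    have := IsIntegral.mul h1 hx
    rw [Algebra.smul_def, map_mul, IsScalarTower.algebraMap_apply F F[X] O,
      ← IsScalarTower.algebraMap_apply F[X] O L, mul_assoc]
    exact this

include L hP hPc hc hy hgen in
lemma WW_norm [Fintype (O ≃ₐ[F[X]] O)] {l : ℕ} {x : O} (hx : x ∈ WW F y c l) :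
    ∃ N : F[X], algebraMap F[X] O N = ∏ g : O ≃ₐ[F[X]] O, g • x ∧
      N.natDegree ≤ Fintype.card (O ≃ₐ[F[X]] O) * l := by
  classical
  have := finDim L hgen hP
  have := isGal L hgen hP hy
  have h1 := Algebra.norm_eq_prod_automorphisms (RatFunc F) (algebraMap O L x)
  have h2 : ∏ σ : Gal(L/(RatFunc F)), σ (algebraMap O L x) =
      algebraMap O L (∏ g : O ≃ₐ[F[X]] O, g • x) := by
    rw [← (galEquiv L hgen hP).prod_comp, map_prod]
    apply Finset.prod_congr rfl
    intro g _
    rw [galEquiv_apply]; rfl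
  obtain ⟨N, hN, hN2⟩ := descend L hgen hP (h1.trans h2)
  refine ⟨N, hN, ?_⟩
  apply infty_int'
  have h3 : IntInf F L (∏ g : O ≃ₐ[F[X]] O, (algebraMap O L (g x) * (tL (F := F) L ^ l)⁻¹)) :=
    IsIntegral.prod _ fun g _ => intInf_W L hP c hc hPc (WW_G hP c g hx)
  rw [Finset.prod_mul_distrib, Finset.prod_const, Finset.card_univ, ← map_prod] at h3
  have h4 : algebraMap O L (∏ g : O ≃ₐ[F[X]] O, g x) = algebraMap (RatFunc F) L (algebraMap _ _ N) := by
    rw [← IsScalarTower.algebraMap_apply, IsScalarTower.algebraMap_apply F[X] O L, hN]; rfl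
  rw [h4, tL_eq, ← map_pow, ← map_inv₀, ← map_pow, ← map_mul, inv_pow, ← pow_mul, IntInf,
    isIntegral_algebraMap_iff (algebraMap (RatFunc F) L).injective] at h3
  have := Valuation.Integers.mem_of_integral (Valuation.integer.integers (RatFunc.inftyValuation F)) h3
  rwa [mul_comm l] at this

end W
end S17
end

section
namespace S17
set_option linter.unusedSectionVars false
open Polynomial

lemma span_mono_top {K L ι : Type} [Field K] [CommRing L] [Algebra K L] [Fintype ι] (z : ι → L)
    (p : K[X]) (hp : p.Monic) (hz : ∀ i, aeval (z i) p = 0)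
    (hgen : Algebra.adjoin K (Set.range z) = ⊤) :
    Submodule.span K (Set.range fun e : ι → Fin p.natDegree => ∏ i, z i ^ (e i : ℕ)) = ⊤ := by
  classical
  rw [eq_top_iff]
  rintro x -
  have hx : x ∈ Algebra.adjoin K (Set.range z) := by rw [hgen]; trivial
  rw [Algebra.adjoin_range_eq_range_aeval] at hx
  obtain ⟨f, rfl⟩ := hx
  show MvPolynomial.aeval z f ∈ _
  rw [MvPolynomial.aeval_def, MvPolynomial.eval₂_eq']
  refine Submodule.sum_mem _ fun m _ => ?_
  rw [← Algebra.smul_def]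
  apply Submodule.smul_mem
  have h1 : ∀ i, z i ^ m i ∈ Submodule.span K (Set.range fun r : Fin p.natDegree => z i ^ (r : ℕ)) := by
    intro i
    have h2 : z i ^ m i = aeval (z i) ((X ^ m i : K[X]) %ₘ p) := by
      conv_lhs => rw [← aeval_X_pow (R := K) (z i), ← modByMonic_add_div (X ^ m i : K[X]) p]
      rw [map_add, map_mul, hz, zero_mul, add_zero]
    rw [h2]
    by_cases hp0 : p.natDegree = 0
    · rw [eq_one_of_monic_natDegree_zero hp hp0]; simp
    rw [aeval_eq_sum_range' (natDegree_modByMonic_lt _ hp (by rintro rfl; simp at hp0))]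
    refine Submodule.sum_mem _ fun r hr => Submodule.smul_mem _ _ (Submodule.subset_span
      ⟨⟨r, Finset.mem_range.1 hr⟩, rfl⟩)
  have h4 : ∀ A : Finset ι, ∏ i ∈ A, z i ^ m i ∈
      ∏ i ∈ A, Submodule.span K (Set.range fun r : Fin p.natDegree => z i ^ (r : ℕ)) := by
    intro A
    induction A using Finset.induction_on with
    | empty => simpa using ⟨1, map_one (algebraMap K L)⟩
    | insert x A hx ih =>
      rw [Finset.prod_insert hx, Finset.prod_insert hx]
      exact Submodule.mul_mem_mul (h1 x) ih
  have h3 : ∏ i, z i ^ m i ∈ ∏ i, Submodule.span K (Set.range fun r : Fin p.natDegree => z i ^ (r : ℕ)) :=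
    h4 Finset.univ
  rw [Submodule.prod_span] at h3
  refine Submodule.span_mono ?_ h3
  intro a ha
  rw [Set.mem_fintype_prod] at ha
  obtain ⟨g, hg, rfl⟩ := ha
  choose e he using hg
  exact ⟨e, by simp [he]⟩

section W
variable {F O ι : Type} [Field F] [CommRing O] [IsDomain O] [Algebra F[X] O]
  [Algebra F O] [IsScalarTower F F[X] O] [Fintype ι]
variable (L : Type) [Field L]
  [Algebra O L] [IsFractionRing O L] [Algebra F[X] L] [IsScalarTower F[X] O L] [Algebra (RatFunc F) L]
  [IsScalarTower F[X] (RatFunc F) L] {y : ι → O} {P : F[X][X]}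
  (hgen : Algebra.adjoin F[X] (Set.range y) = ⊤)
  (hP : P.map (algebraMap F[X] O) = ∏ i, (X - C (y i))) (hy : Function.Injective y)
  (c : ℕ) (hc : 0 < c) (hPc : ∀ i, (P.coeff i).natDegree ≤ c)

include L hP in
lemma Pdeg : P.natDegree = Fintype.card ι := by
  have h := congrArg natDegree hP
  rwa [natDegree_map_eq_of_injective (alg_inj L), natDegree_prod _ _ (fun i _ => X_sub_C_ne_zero _),
    Finset.sum_congr rfl (fun i _ => natDegree_X_sub_C _), Finset.sum_const, smul_eq_mul, mul_one,
    Finset.card_univ] at h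

include L hP hgen hy hc in
lemma WW_dim (l : ℕ) : Nat.card (O ≃ₐ[F[X]] O) * (l + 1) ≤ Module.finrank F (WW F y c l) +
    Nat.card (O ≃ₐ[F[X]] O) * (c * (Fintype.card ι * Fintype.card ι)) := by
  classical
  set κ := c * (Fintype.card ι * Fintype.card ι) with hκ
  by_cases hl : l < κ
  · have := Nat.mul_le_mul_left (Nat.card (O ≃ₐ[F[X]] O)) (show l + 1 ≤ κ from hl)
    omega
  push Not at hl
  have hfd := finDim L hgen hP
  have hsp := isSplit L hgen hP
  have hmon := Pmonic hP (alg_inj L)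
  have hroot : (P.map (algebraMap F[X] (RatFunc F))).rootSet L = Set.range fun i => algebraMap O L (y i) := by
    ext x
    rw [mem_rootSet, aeval_def, ← eval_map, PL L hP, eval_prod, Finset.prod_eq_zero_iff]
    constructor
    · rintro ⟨-, i, -, hi⟩
      rw [eval_sub, eval_X, eval_C, sub_eq_zero] at hi
      exact ⟨i, hi.symm⟩
    · rintro ⟨i, rfl⟩
      exact ⟨(hmon.map _).ne_zero, i, Finset.mem_univ i, by simp⟩
  have hadj := hsp.adjoin_rootSet
  rw [hroot] at hadj
  have hspan := span_mono_top (fun i => algebraMap O L (y i)) (P.map (algebraMap F[X] (RatFunc F)))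
    (hmon.map _) (by
      intro i
      rw [aeval_map_algebraMap, aeval_algebraMap_apply, P_root hP, map_zero]) hadj
  obtain ⟨b, hb, hbs, hli⟩ := exists_linearIndependent (RatFunc F) (Set.range fun e : ι →
    Fin (P.map (algebraMap F[X] (RatFunc F))).natDegree => ∏ i, algebraMap O L (y i) ^ (e i : ℕ))
  rw [hspan] at hbs
  have hbf' : Finite b := ((Set.finite_range _).subset hb).to_subtype
  have hbf : Fintype b := Fintype.ofFinite b
  have hcard : Fintype.card b = Nat.card (O ≃ₐ[F[X]] O) := by
    rw [cardG L hgen hP hy]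
    have B := Module.Basis.mk hli (by rw [Subtype.range_coe]; exact hbs.ge)
    rw [Module.finrank_eq_card_basis B]
  choose e he using fun x : b => hb x.2
  let w : b → O := fun x => ∏ i, y i ^ (e x i : ℕ)
  have hw : ∀ x, algebraMap O L (w x) = x.1 := by
    intro x
    rw [← he x]; simp [w]
  have hwli : LinearIndependent F[X] w := by
    have h1 : LinearIndependent F[X] (fun x : b => (x : L)) :=
      hli.restrict_scalars (by
        have := IsFractionRing.injective F[X] (RatFunc F)
        intro f g h
        apply this
        simpa [Algebra.smul_def] using h)
    refine LinearIndependent.of_comp (IsScalarTower.toAlgHom F[X] O L).toLinearMap ?_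
    convert h1 using 1
    ext x; exact hw x
  have hXli : LinearIndependent F (fun r : Fin (l - κ + 1) => (X : F[X]) ^ (r : ℕ)) := by
    have := (basisMonomials F).linearIndependent.comp (fun r : Fin (l - κ + 1) => (r : ℕ))
      Fin.val_injective
    convert this using 1
    ext r : 1
    simp [X_pow_eq_monomial]
  have hall := linearIndependent_smul hXli hwli
  have hmem : ∀ x : Fin (l - κ + 1) × b, (X : F[X]) ^ (x.1 : ℕ) • w x.2 ∈ WW F y c l := by
    rintro ⟨r, x⟩
    apply Submodule.subset_span
    refine ⟨r, fun i => e x i, ?_, by rw [Algebra.smul_def, map_pow]⟩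
    have h1 : ∑ j, (e x j : ℕ) ≤ Fintype.card ι * Fintype.card ι := by
      have : ∀ j ∈ (Finset.univ : Finset ι), (e x j : ℕ) ≤ Fintype.card ι := by
        intro j _
        have h6 : (P.map (algebraMap F[X] (RatFunc F))).natDegree = Fintype.card ι := by
          rw [hmon.natDegree_map, Pdeg L hP]
        exact (e x j).2.le.trans h6.le
      have := Finset.sum_le_card_nsmul _ _ _ this
      simpa using this
    have h2 := Nat.mul_le_mul_left c h1
    have := r.2
    simp only at *
    omega
  have hfin := WW_fin (F := F) y c hc l
  have hli2 : LinearIndependent F (fun x : Fin (l - κ + 1) × b => (⟨_, hmem x⟩ : WW F y c l)) :=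
    LinearIndependent.of_comp (WW F y c l).subtype hall
  have := hli2.fintype_card_le_finrank
  rw [Fintype.card_prod, Fintype.card_fin, hcard] at this
  have h5 : l + 1 = (l - κ + 1) + κ := by omega
  rw [h5, mul_add, mul_comm _ (l - κ + 1)]
  omega

end W
end S17
end

section
namespace S17
set_option linter.unusedSectionVars false
open Polynomial

section W
variable {F O ι : Type} [Field F] [CommRing O] [IsDomain O] [Algebra F[X] O]
  [Algebra F O] [IsScalarTower F F[X] O] [Fintype ι]
variable (L : Type) [Field L]
  [Algebra O L] [IsFractionRing O L] [Algebra F[X] L] [IsScalarTower F[X] O L] [Algebra (RatFunc F) L]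
  [IsScalarTower F[X] (RatFunc F) L] {y : ι → O} {P : F[X][X]}
  (hgen : Algebra.adjoin F[X] (Set.range y) = ⊤)
  (hP : P.map (algebraMap F[X] O) = ∏ i, (X - C (y i))) (hy : Function.Injective y)
  (c : ℕ) (hc : 0 < c) (hPc : ∀ i, (P.coeff i).natDegree ≤ c)

include hP hy in
lemma dP_ne (i : ι) : aeval (y i) (derivative P) ≠ 0 := by
  intro h
  set K := FractionRing O
  have hinj : Function.Injective (algebraMap O K) := IsFractionRing.injective O K
  have h1 : (∏ i, (X - C (algebraMap O K (y i)))).Separable :=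
    separable_prod_X_sub_C_iff.2 (hinj.comp hy)
  have h2 : ∏ i, (X - C (algebraMap O K (y i))) = (P.map (algebraMap F[X] O)).map (algebraMap O K) := by
    rw [hP, Polynomial.map_prod]; simp
  have h3 := h1.eval₂_derivative_ne_zero (RingHom.id K) (x := algebraMap O K (y i)) (by
    rw [h2, eval₂_id, eval_map_apply, eval_map, ← aeval_def, P_root hP, map_zero])
  apply h3
  rw [h2, eval₂_id, derivative_map, derivative_map, eval_map_apply, eval_map, ← aeval_def, h, map_zero]

include hPc in
lemma dPc (i : ℕ) : ((derivative P).coeff i).natDegree ≤ c := by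
  rw [coeff_derivative]
  have : (P.coeff (i + 1) * (i + 1 : F[X])) = P.coeff (i + 1) * C (i + 1 : F) := by simp
  rw [this]
  exact (natDegree_mul_C_le _ _).trans (hPc _)

include L hP hPc in
lemma dP_W (i : ι) : aeval (y i) (derivative P) ∈ WW F y c (c + Fintype.card ι * c) :=
  WW_aeval y c _ i ((natDegree_derivative_le _).trans (by rw [Pdeg L hP]; omega)) (dPc c hPc)

include L hgen hP hy hc hPc in
lemma exists_s : ∃ s : F[X], algebraMap F[X] O s = ∏ i, aeval (y i) (derivative P) ∧ s ≠ 0 ∧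
    s.natDegree ≤ Fintype.card ι * (c + Fintype.card ι * c) := by
  classical
  have hI := isInv L hgen hP hy
  have := finG L hgen hP
  have := Fintype.ofFinite (O ≃ₐ[F[X]] O)
  have hinj := alg_inj (F := F) (O := O) L
  obtain ⟨s, hs⟩ := hI.isInvariant (∏ i, aeval (y i) (derivative P)) (by
    intro g
    choose π hπ using y_perm hP g
    have hb : Function.Bijective π := by
      rw [← Finite.injective_iff_bijective]
      intro a b hab
      apply hy
      apply g.injective
      rw [hπ, hπ, hab]
    rw [Finset.smul_prod']
    rw [← hb.prod_comp (fun i => aeval (y i) (derivative P))]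
    refine Finset.prod_congr rfl fun i _ => ?_
    rw [← hπ, show g (y i) = g.toAlgHom (y i) from rfl, aeval_algHom_apply]
    rfl)
  refine ⟨s, hs, ?_, ?_⟩
  · rintro rfl
    rw [map_zero, eq_comm, Finset.prod_eq_zero_iff] at hs
    obtain ⟨i, -, hi⟩ := hs
    exact dP_ne hP hy i hi
  · have hW : algebraMap F[X] O s ∈ WW F y c (Fintype.card ι * (c + Fintype.card ι * c)) := by
      rw [hs]
      exact WW_prod y c Finset.univ _ _ fun i _ => dP_W L hP c hPc i
    obtain ⟨N, hN, hd⟩ := WW_norm L hgen hP hy c hc hPc hW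
    have h1 : N = s ^ Fintype.card (O ≃ₐ[F[X]] O) := by
      apply hinj
      rw [hN, map_pow]
      rw [Finset.prod_congr rfl (fun g _ => show g • algebraMap F[X] O s = algebraMap F[X] O s from g.commutes s)]
      simp
    rw [h1, natDegree_pow] at hd
    exact Nat.le_of_mul_le_mul_left hd Fintype.card_pos

lemma sep_inj {R : Type} [CommRing R] [IsDomain R] (ψ : O →+* R)
    (hP : P.map (algebraMap F[X] O) = ∏ i, (X - C (y i)))
    (hψ : ψ (∏ i, aeval (y i) (derivative P)) ≠ 0) : Function.Injective (fun i => ψ (y i)) := by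
  classical
  intro i j hij
  by_contra hne
  apply hψ
  rw [map_prod]
  refine Finset.prod_eq_zero (Finset.mem_univ i) ?_
  have h1 : ψ (aeval (y i) (derivative P)) =
      eval (ψ (y i)) (derivative ((P.map (algebraMap F[X] O)).map ψ)) := by
    rw [derivative_map, derivative_map, eval_map_apply, eval_map, ← aeval_def]
  have h2 : (P.map (algebraMap F[X] O)).map ψ = (X - C (ψ (y i))) * ((X - C (ψ (y i))) *
      ∏ l ∈ (Finset.univ.erase i).erase j, (X - C (ψ (y l)))) := by
    rw [hP, Polynomial.map_prod, ← Finset.mul_prod_erase _ _ (Finset.mem_univ i),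
      ← Finset.mul_prod_erase _ _ (show j ∈ Finset.univ.erase i by simp [Ne.symm hne])]
    simp only [Polynomial.map_sub, map_X, map_C]
    simp only at hij
    rw [← hij]
  rw [h1, h2]
  simp [derivative_mul]

/-- derivative in the coefficients -/
noncomputable def Pt (f : F[X][X]) : F[X][X] :=
  ∑ i ∈ Finset.range (f.natDegree + 1), monomial i (derivative (f.coeff i))

lemma Pt_deg (f : F[X][X]) : (Pt f).natDegree ≤ f.natDegree := by
  refine natDegree_sum_le_of_forall_le _ _ fun i hi => ?_
  exact (natDegree_monomial_le _).trans (by simpa [Nat.lt_succ_iff] using hi)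

lemma Pt_c (f : F[X][X]) {c : ℕ} (h : ∀ i, (f.coeff i).natDegree ≤ c) (i : ℕ) :
    ((Pt f).coeff i).natDegree ≤ c := by
  rw [Pt, finsetSum_coeff]
  refine natDegree_sum_le_of_forall_le _ _ fun j hj => ?_
  rw [coeff_monomial]
  split_ifs
  · exact (natDegree_derivative_le _).trans ((Nat.sub_le _ _).trans (h _))
  · simp

lemma d_aeval (f : F[X][X]) (v : PowerSeries F) : PowerSeries.derivative F (aeval v f) =
    aeval v (Pt f) + aeval v (derivative f) * PowerSeries.derivative F v := by
  have h1 : aeval v (derivative f) = ∑ i ∈ Finset.range (f.natDegree + 1),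
      aeval v (derivative (monomial i (f.coeff i))) := by
    conv_lhs => rw [f.as_sum_range]
    rw [derivative_sum, map_sum]
  conv_lhs => rw [f.as_sum_range]
  rw [h1, Pt, map_sum, map_sum, map_sum, Finset.sum_mul, ← Finset.sum_add_distrib]
  refine Finset.sum_congr rfl fun i _ => ?_
  rw [derivative_monomial, aeval_monomial, aeval_monomial, aeval_monomial, Derivation.leibniz,
    Derivation.leibniz_pow]
  have h2 : ∀ g : F[X], algebraMap F[X] (PowerSeries F) g = (g : PowerSeries F) := fun g => rfl
  rw [h2, h2, h2, PowerSeries.derivative_coe]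
  have h3 : ((i : F[X]) : PowerSeries F) = (i : PowerSeries F) :=
    map_natCast (algebraMap F[X] (PowerSeries F)) i
  simp only [smul_eq_mul, nsmul_eq_mul, Polynomial.coe_mul, h3]
  ring

variable (em : O →ₐ[F] PowerSeries F) (hem : Function.Injective em)
  (hej : ∀ f : F[X], em (algebraMap F[X] O f) = (f : PowerSeries F))

include hej in
lemma em_aeval (f : F[X][X]) (x : O) : em (aeval x f) = aeval (em x) f := by
  rw [aeval_eq_sum_range, aeval_eq_sum_range, map_sum]
  refine Finset.sum_congr rfl fun i _ => ?_
  rw [Algebra.smul_def, Algebra.smul_def, map_mul, map_pow, hej]; rfl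

include L hP hPc hej in
lemma d_y {s : F[X]} (hs : algebraMap F[X] O s = ∏ i, aeval (y i) (derivative P)) (i : ι) :
    ∃ z ∈ WW F y c (Fintype.card ι * (c + Fintype.card ι * c)),
      em z = s * PowerSeries.derivative F (em (y i)) := by
  classical
  refine ⟨- ((∏ j ∈ Finset.univ.erase i, aeval (y j) (derivative P)) * aeval (y i) (Pt P)), ?_, ?_⟩
  · apply Submodule.neg_mem
    have h1 := WW_prod y c (Finset.univ.erase i) _ _ fun i _ => dP_W L hP c hPc i
    have h2 : aeval (y i) (Pt P) ∈ WW F y c (c + Fintype.card ι * c) :=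
      WW_aeval y c _ i ((Pt_deg P).trans (Pdeg L hP).le) (Pt_c P hPc)
    have h3 := WW_mul y c h1 h2
    convert h3 using 2
    rw [Finset.card_erase_of_mem (Finset.mem_univ i), Finset.card_univ, ← Nat.succ_mul]
    congr 1
    have : 0 < Fintype.card ι := Fintype.card_pos_iff.2 ⟨i⟩
    omega
  · have h1 := d_aeval P (em (y i))
    rw [← em_aeval em hej, P_root hP, map_zero, map_zero, ← em_aeval em hej, ← em_aeval em hej] at h1
    have h2 : em (aeval (y i) (Pt P)) =
      - (em (aeval (y i) (derivative P)) * PowerSeries.derivative F (em (y i))) :=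
        eq_neg_of_add_eq_zero_left h1.symm
    rw [← hej, hs, ← Finset.mul_prod_erase _ _ (Finset.mem_univ i), map_neg, map_mul, h2, map_mul]
    ring

include L hgen hP hPc hej in
lemma d_O {s : F[X]} (hs : algebraMap F[X] O s = ∏ i, aeval (y i) (derivative P)) (x : O) :
    ∃ z, em z = s * PowerSeries.derivative F (em x) := by
  have ho : x ∈ Algebra.adjoin F[X] (Set.range y) := by rw [hgen]; trivial
  induction ho using Algebra.adjoin_induction with
  | mem x hx =>
    obtain ⟨i, rfl⟩ := hx
    obtain ⟨z, -, h⟩ := d_y L hP c hPc em hej hs i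
    exact ⟨z, h⟩
  | algebraMap r =>
    refine ⟨algebraMap _ _ (s * derivative r), ?_⟩
    rw [hej, hej, PowerSeries.derivative_coe, Polynomial.coe_mul]
  | add x y _ _ hx hy =>
    obtain ⟨a, ha⟩ := hx
    obtain ⟨b, hb⟩ := hy
    exact ⟨a + b, by simp [ha, hb, mul_add]⟩
  | mul x y _ _ hx hy =>
    obtain ⟨a, ha⟩ := hx
    obtain ⟨b, hb⟩ := hy
    refine ⟨x * b + y * a, ?_⟩
    simp only [map_add, map_mul, ha, hb, Derivation.leibniz, smul_eq_mul]
    ring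

include L hgen hP hPc hej hem in
lemma exists_δ {s : F[X]} (hs : algebraMap F[X] O s = ∏ i, aeval (y i) (derivative P))
    (hsd : s.natDegree ≤ Fintype.card ι * (c + Fintype.card ι * c)) :
    ∃ δ : Derivation F O O, δ (algebraMap F[X] O X) = algebraMap F[X] O s ∧
      ∀ a x, x ∈ WW F y c a → δ x ∈ WW F y c (a + Fintype.card ι * (c + Fintype.card ι * c)) := by
  choose f hf using d_O L hgen hP c hPc em hej hs
  let δl : O →ₗ[F] O :=
    { toFun := f
      map_add' := fun a b => hem (by simp [hf, mul_add])
      map_smul' := fun r a => hem (by simp [hf]) }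
  let δ : Derivation F O O := Derivation.mk' δl (fun a b => hem (by
    show em (f (a * b)) = em (a • f b + b • f a)
    simp only [map_add, map_mul, hf, Derivation.leibniz, smul_eq_mul]
    ring))
  have hδ : ∀ x, em (δ x) = s * PowerSeries.derivative F (em x) := hf
  have hX : δ (algebraMap F[X] O X) = algebraMap F[X] O s := hem (by
    rw [hδ, hej, hej, PowerSeries.derivative_coe]; simp)
  refine ⟨δ, hX, fun a x hx => ?_⟩
  refine (WW_ind y c (fun a x => x ∈ WW F y c a ∧
    δ x ∈ WW F y c (a + Fintype.card ι * (c + Fintype.card ι * c))) ?_ ?_ ?_ ?_ ?_ ?_ ?_ hx).2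
  · exact ⟨WW_one y c, by simp⟩
  · refine ⟨WW_X y c, ?_⟩
    rw [hX]
    exact WW_mono y c (by omega) (WW_poly y c s hsd)
  · intro i
    refine ⟨WW_y y c i, ?_⟩
    obtain ⟨z, hz, h⟩ := d_y L hP c hPc em hej hs i
    have : δ (y i) = z := hem (by rw [hδ, h])
    rw [this]
    exact WW_mono y c (by omega) hz
  · rintro a b x z ⟨h1, h2⟩ ⟨h3, h4⟩
    refine ⟨WW_mul y c h1 h3, ?_⟩
    rw [Derivation.leibniz, smul_eq_mul, smul_eq_mul]
    apply Submodule.add_mem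
    · convert WW_mul y c h1 h4 using 2; ring
    · convert WW_mul y c h3 h2 using 2; ring
  · rintro a b x h ⟨h1, h2⟩
    exact ⟨WW_mono y c h h1, WW_mono y c (by omega) h2⟩
  · rintro a x z ⟨h1, h2⟩ ⟨h3, h4⟩
    exact ⟨Submodule.add_mem _ h1 h3, by rw [map_add]; exact Submodule.add_mem _ h2 h4⟩
  · rintro a r x ⟨h1, h2⟩
    exact ⟨Submodule.smul_mem _ _ h1, by rw [Derivation.map_smul]; exact Submodule.smul_mem _ _ h2⟩
end W
end S17
end

section
namespace S17
set_option linter.unusedSectionVars false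
open Polynomial

section W
variable {F O ι : Type} [Field F] [Fintype F] [CommRing O] [IsDomain O] [Algebra F[X] O]
  [Algebra F O] [IsScalarTower F F[X] O] [Fintype ι]
  {y : ι → O} {P : F[X][X]}
  (hgen : Algebra.adjoin F[X] (Set.range y) = ⊤)
  (hP : P.map (algebraMap F[X] O) = ∏ i, (X - C (y i)))
  (hinj : Function.Injective (algebraMap F[X] O))

lemma alg_C (a : F) : algebraMap F[X] O (C a) = algebraMap F O a :=
  (IsScalarTower.algebraMap_apply F F[X] O _).symm

lemma red_mem (t : F) {I : Ideal O} (hI : algebraMap F[X] O (X - C t) ∈ I) (f : F[X]) :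
    algebraMap F[X] O f - algebraMap F O (f.eval t) ∈ I := by
  rw [← alg_C, ← map_sub]
  obtain ⟨g, hg⟩ := X_sub_C_dvd_sub_C_eval (a := t) (p := f)
  rw [hg, map_mul]
  exact I.mul_mem_right _ hI

lemma red_aeval (t : F) {I : Ideal O} (hI : algebraMap F[X] O (X - C t) ∈ I) (f : F[X][X]) (x : O) :
    aeval x f - aeval x (f.map (evalRingHom t)) ∈ I := by
  induction f using Polynomial.induction_on' with
  | add p q hp hq =>
    have := I.add_mem hp hq
    convert this using 1
    simp only [map_add, Polynomial.map_add]; ring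
  | monomial n a =>
    rw [map_monomial, aeval_monomial, aeval_monomial, ← sub_mul]
    exact I.mul_mem_right _ (red_mem t hI a)

include hgen hP hinj in
lemma res_fin (t : F) (Q : Ideal O) (hQ : algebraMap F[X] O (X - C t) ∈ Q) : Finite (O ⧸ Q) := by
  classical
  have h1 : Algebra.FiniteType F[X] O := ⟨⟨Finset.univ.image y, by simpa using hgen⟩⟩
  have h2 : Algebra.FiniteType F O := Algebra.FiniteType.trans (S := F[X]) inferInstance h1
  have h3 : Algebra.FiniteType F (O ⧸ Q) :=
    Algebra.FiniteType.of_surjective (Ideal.Quotient.mkₐ F Q) (Ideal.Quotient.mkₐ_surjective F Q)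
  have h4 : Algebra.IsIntegral F (O ⧸ Q) := by
    refine ⟨fun x => ?_⟩
    obtain ⟨x, rfl⟩ := Ideal.Quotient.mkₐ_surjective F Q x
    obtain ⟨g, hg, hx⟩ := (O_int hgen hP hinj).isIntegral x
    refine ⟨g.map (evalRingHom t), hg.map _, ?_⟩
    rw [← aeval_def, aeval_algHom_apply]
    have h5 := red_aeval t hQ g x
    rw [aeval_def, hx, zero_sub, Q.neg_mem_iff] at h5
    exact Ideal.Quotient.eq_zero_iff_mem.2 h5
  have := Algebra.IsIntegral.finite (R := F) (A := O ⧸ Q)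
  exact Module.finite_of_finite F

include hgen hP hinj in
lemma unram (t : F) (Q : Ideal O) [Q.IsPrime] (hQ : algebraMap F[X] O (X - C t) ∈ Q)
    (hs : ∏ i, aeval (y i) (derivative P) ∉ Q) {x : O} (hx : x ∈ Q) :
    ∃ e ∉ Q, algebraMap F[X] O (X - C t) ∣ e * x := by
  classical
  have hf := res_fin hgen hP hinj t Q hQ
  have := Fintype.ofFinite (O ⧸ Q)
  let fld : Field (O ⧸ Q) := Fintype.fieldOfDomain (O ⧸ Q)
  set m := Fintype.card (O ⧸ Q) with hm
  have hpow : ∀ a : O ⧸ Q, a ^ m = a := fun a => FiniteField.pow_card a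
  have hm1 : 1 < m := Fintype.one_lt_card
  obtain ⟨p, hp⟩ := CharP.exists F
  have hpp : Fact p.Prime := ⟨CharP.char_is_prime F p⟩
  have hpO : CharP O p := charP_of_injective_algebraMap (algebraMap F O).injective p
  have hpR : CharP (O ⧸ Q) p := charP_of_injective_algebraMap (algebraMap F (O ⧸ Q)).injective p
  obtain ⟨n, -, hmn⟩ := FiniteField.card (O ⧸ Q) p
  have hmn : m = p ^ (n : ℕ) := hmn
  set I := Ideal.span {algebraMap F[X] O (X - C t)} with hI
  have hIm : algebraMap F[X] O (X - C t) ∈ I := Ideal.mem_span_singleton_self _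
  set ψ : O →+* O ⧸ Q := Ideal.Quotient.mk Q
  have hyi : Function.Injective fun i => ψ (y i) :=
    sep_inj ψ hP (fun h => hs (Ideal.Quotient.eq_zero_iff_mem.1 h))
  have hP0 : (P.map (evalRingHom t)).map (algebraMap F (O ⧸ Q)) = ∏ i, (X - C (ψ (y i))) := by
    have h1 : (algebraMap F (O ⧸ Q)).comp (evalRingHom t) = ψ.comp (algebraMap F[X] O) := by
      ext f
      · simp only [RingHom.comp_apply, coe_evalRingHom, eval_C]
        rw [alg_C]; rfl
      · simp only [RingHom.comp_apply, coe_evalRingHom, eval_X]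
        have := red_mem t hQ X
        rw [eval_X] at this
        exact ((Ideal.Quotient.eq).2 this).symm
    rw [map_map, h1, ← map_map, hP, Polynomial.map_prod]
    simp
  have hdvd : P.map (evalRingHom t) ∣ X ^ m - X := by
    rw [← map_dvd_map' (algebraMap F (O ⧸ Q)), hP0]
    apply Finset.prod_dvd_of_coprime
    · intro i _ j _ hij
      exact pairwise_coprime_X_sub_C hyi hij
    · intro i _
      rw [dvd_iff_isRoot]
      simp [hpow]
  have hF : ∀ a : F, a ^ m = a := fun a => (algebraMap F (O ⧸ Q)).injective (by
    rw [map_pow, hpow])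
  have hall : ∀ x : O, x ^ m - x ∈ I := by
    intro x
    have ho : x ∈ Algebra.adjoin F[X] (Set.range y) := by rw [hgen]; trivial
    induction ho using Algebra.adjoin_induction with
    | mem x hx =>
      obtain ⟨i, rfl⟩ := hx
      obtain ⟨h, hh⟩ := hdvd
      have h1 := congrArg (aeval (y i)) hh
      rw [map_mul, map_sub, aeval_X_pow, aeval_X] at h1
      rw [h1]
      refine I.mul_mem_right _ ?_
      have := red_aeval t hIm P (y i)
      rwa [P_root hP, zero_sub, I.neg_mem_iff] at this
    | algebraMap r =>
      have h1 := red_mem t hIm (r ^ m - r)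
      simpa [hF] using h1
    | add x z _ _ hx hz =>
      have := I.add_mem hx hz
      rw [hmn] at this ⊢
      rw [add_pow_char_pow]
      convert this using 1; ring
    | mul x z _ _ hx hz =>
      have := I.add_mem (I.mul_mem_right (z ^ m) hx) (I.mul_mem_left x hz)
      convert this using 1; ring
  refine ⟨x ^ (m - 1) - 1, ?_, ?_⟩
  · intro h
    have h1 : x ^ (m - 1) ∈ Q := Ideal.pow_mem_of_mem _ hx _ (by omega)
    have h2 := Q.sub_mem h1 h
    rw [sub_sub_cancel] at h2
    exact (Ideal.ne_top_iff_one Q).1 (Ideal.IsPrime.ne_top') h2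
  · have h1 := hall x
    rw [hI, Ideal.mem_span_singleton] at h1
    convert h1 using 1
    rw [sub_mul, one_mul, ← pow_succ]
    congr 2
    omega

include hgen hP hinj in
lemma exists_Q (t : F) [Finite (O ≃ₐ[F[X]] O)] [Algebra.IsInvariant F[X] O (O ≃ₐ[F[X]] O)] :
    ∃ (Q : Ideal O) (σ : O ≃ₐ[F[X]] O), Q.IsPrime ∧ Q.comap (algebraMap F[X] O) = Ideal.span {X - C t} ∧
      algebraMap F[X] O (X - C t) ∈ Q ∧ ∀ x, σ • x - x ^ Fintype.card F ∈ Q := by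
  have hint := O_int hgen hP hinj
  have hpr : (Ideal.span {X - C t} : Ideal F[X]).IsPrime :=
    (Ideal.span_singleton_prime (X_sub_C_ne_zero t)).2 (prime_X_sub_C t)
  obtain ⟨Q, -, hQ, hc⟩ := Ideal.exists_ideal_over_prime_of_isIntegral (S := O) (Ideal.span {X - C t})
    ⊥ (by
      intro x hx
      have : x = 0 := hinj (by simpa using hx)
      simp [this])
  have hm : algebraMap F[X] O (X - C t) ∈ Q := by
    rw [← Ideal.mem_comap, hc]; exact Ideal.mem_span_singleton_self _
  have hf := res_fin hgen hP hinj t Q hm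
  obtain ⟨σ, hσ⟩ := IsArithFrobAt.exists_of_isInvariant F[X] (O ≃ₐ[F[X]] O) Q
  refine ⟨Q, σ, hQ, hc, hm, fun x => ?_⟩
  have h1 := hσ x
  have h2 : Nat.card (F[X] ⧸ Q.under F[X]) = Fintype.card F := by
    rw [Ideal.under_def, hc, Nat.card_congr (quotientSpanXSubCAlgEquiv t).toEquiv, Nat.card_eq_fintype_card]
  rw [h2] at h1
  exact h1

lemma card_le_q {R : Type} [CommRing R] [IsDomain R] [Fintype R] (q : ℕ) (hq : 1 < q)
    (h : ∀ a : R, a ^ q = a) : Fintype.card R ≤ q := by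
  classical
  have hd : (X ^ q - X : R[X]).natDegree = q := by
    rw [natDegree_sub_eq_left_of_natDegree_lt] <;> simp [hq]
  have hne : (X ^ q - X : R[X]) ≠ 0 := by
    intro h0; rw [h0] at hd; simp at hd; omega
  have h1 : (Finset.univ : Finset R).val ≤ (X ^ q - X : R[X]).roots := by
    rw [Multiset.le_iff_subset Finset.univ.nodup]
    intro a _
    rw [mem_roots hne]
    simp [h]
  have h2 := Multiset.card_le_card h1
  have h3 := card_roots' (X ^ q - X : R[X])
  rw [hd] at h3
  exact h2.trans h3

include hgen hP hinj in
lemma triv_hom (t : F) (Q : Ideal O) [Q.IsPrime] (hQ : algebraMap F[X] O (X - C t) ∈ Q)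
    (h : ∀ x : O, x - x ^ Fintype.card F ∈ Q) : ∃ φ : O →ₐ[F] F, φ (algebraMap F[X] O X) = t := by
  classical
  have hf := res_fin hgen hP hinj t Q hQ
  have := Fintype.ofFinite (O ⧸ Q)
  have hpow : ∀ a : O ⧸ Q, a ^ Fintype.card F = a := by
    intro a
    obtain ⟨a, rfl⟩ := Ideal.Quotient.mk_surjective a
    rw [← map_pow]
    exact ((Ideal.Quotient.eq).2 (h a)).symm
  have hq : 1 < Fintype.card F := Fintype.one_lt_card
  have hle : Fintype.card (O ⧸ Q) ≤ Fintype.card F := card_le_q _ hq hpow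
  have hb : Function.Bijective (algebraMap F (O ⧸ Q)) := by
    rw [Fintype.bijective_iff_injective_and_card]
    have hi : Function.Injective (algebraMap F (O ⧸ Q)) := (algebraMap F (O ⧸ Q)).injective
    exact ⟨hi, le_antisymm (Fintype.card_le_of_injective _ hi) hle⟩
  let e : F ≃ₐ[F] (O ⧸ Q) := AlgEquiv.ofBijective (Algebra.ofId F (O ⧸ Q)) hb
  refine ⟨e.symm.toAlgHom.comp (Ideal.Quotient.mkₐ F Q), ?_⟩
  have h1 : Ideal.Quotient.mkₐ F Q (algebraMap F[X] O X) = e t := by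
    have := red_mem t hQ X
    rw [eval_X] at this
    exact ((Ideal.Quotient.eq).2 this)
  show e.symm (Ideal.Quotient.mkₐ F Q (algebraMap F[X] O X)) = t
  rw [h1, AlgEquiv.symm_apply_apply]
end W
end S17
end

section
namespace S17
set_option linter.unusedSectionVars false
open Polynomial

section W
variable {F O ι : Type} [Field F] [Fintype F] [CommRing O] [IsDomain O] [Algebra F[X] O]
  [Algebra F O] [IsScalarTower F F[X] O] [Fintype ι]
variable (L : Type) [Field L]
  [Algebra O L] [IsFractionRing O L] [Algebra F[X] L] [IsScalarTower F[X] O L] [Algebra (RatFunc F) L]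
  [IsScalarTower F[X] (RatFunc F) L] {y : ι → O} {P : F[X][X]}
  (hgen : Algebra.adjoin F[X] (Set.range y) = ⊤)
  (hP : P.map (algebraMap F[X] O) = ∏ i, (X - C (y i))) (hy : Function.Injective y)
  (c : ℕ) (hc : 0 < c) (hPc : ∀ i, (P.coeff i).natDegree ≤ c)
  (em : O →ₐ[F] PowerSeries F) (hem : Function.Injective em)
  (hej : ∀ f : F[X], em (algebraMap F[X] O f) = (f : PowerSeries F))

include L hgen hP hy hc hPc em hem hej in
lemma exists_step [Fintype (O ≃ₐ[F[X]] O)] :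
    ∃ S : Step F O (O ≃ₐ[F[X]] O) (c * (Fintype.card ι * Fintype.card ι))
      (Fintype.card ι * (c + Fintype.card ι * c)),
      ∀ t ∈ S.triv, ∃ φ : O →ₐ[F] F, φ (algebraMap F[X] O X) = t ∧ Function.Injective fun i => φ (y i) := by
  classical
  have hinj := alg_inj (F := F) (O := O) L
  have hI := isInv L hgen hP hy
  obtain ⟨s, hs, hs0, hsd⟩ := exists_s L hgen hP hy c hc hPc
  obtain ⟨δ, hδX, hδW⟩ := exists_δ L hgen hP c hPc em hem hej hs hsd
  choose Q σ hQp hQc hQX hQf using fun t : F => exists_Q hgen hP hinj t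
  have hsQ : ∀ t, s.eval t ≠ 0 → algebraMap F[X] O s ∉ Q t := by
    intro t ht h
    rw [← Ideal.mem_comap, hQc, Ideal.mem_span_singleton, dvd_iff_isRoot] at h
    exact ht h
  let S : Step F O (O ≃ₐ[F[X]] O) (c * (Fintype.card ι * Fintype.card ι))
      (Fintype.card ι * (c + Fintype.card ι * c)) :=
    { emb := em
      emb_inj := hem
      j := IsScalarTower.toAlgHom F F[X] O
      emb_j := hej
      smul_j := fun g f => g.commutes f
      W := WW F y c
      W_mono := WW_mono y c
      W_mul := fun h1 h2 => WW_mul y c h1 h2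
      W_one := WW_one y c
      W_smul := fun g _ _ h => WW_G hP c g h
      W_norm := fun h => WW_norm L hgen hP hy c hc hPc h
      W_fin := fun a => WW_fin y c hc a
      W_dim := fun a => by
        have := WW_dim L hgen hP hy c hc a
        rwa [Nat.card_eq_fintype_card] at this
      s := s
      s_ne := hs0
      s_deg := hsd
      δ := δ
      δ_X := hδX
      δ_W := fun {a x} h => hδW a x h
      Q := Q
      σ := σ
      Q_prime := fun t _ => hQp t
      Q_X := fun t _ => hQX t
      Q_frob := fun t _ => hQf t
      Q_unram := fun t ht x hx => by
        have := hQp t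
        exact unram hgen hP hinj t (Q t) (hQX t) (by rw [← hs]; exact hsQ t ht) hx }
  refine ⟨S, fun t ht => ?_⟩
  have ht' : s.eval t ≠ 0 ∧ σ t = 1 := by simpa [Step.triv] using ht
  have := hQp t
  obtain ⟨φ, hφ⟩ := triv_hom hgen hP hinj t (Q t) (hQX t) (by
    intro x
    have := hQf t x
    rwa [ht'.2, one_smul] at this)
  refine ⟨φ, hφ, ?_⟩
  have h2 : ∀ f : F[X], φ (algebraMap F[X] O f) = f.eval t := by
    intro f
    have h3 : (φ.comp (IsScalarTower.toAlgHom F F[X] O)) = aeval t := by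
      ext; simpa using hφ
    have := DFunLike.congr_fun h3 f
    simpa [coe_aeval_eq_eval] using this
  exact sep_inj φ.toRingHom hP (by
    rw [← hs]
    show φ (algebraMap F[X] O s) ≠ 0
    rw [h2]; exact ht'.1)
end W

theorem thmU (N c n0 K : ℕ) (hc : 0 < c) (hK : 0 < K) : ∃ Q0 : ℕ, ∀ (F : Type) [Field F] [Fintype F]
    (ι : Type) [Fintype ι] (y : ι → PowerSeries F) (P : F[X][X]), Fintype.card ι = N →
    P.map (algebraMap F[X] (PowerSeries F)) = ∏ i, (X - C (y i)) → Function.Injective y →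
    (∀ i, (P.coeff i).natDegree ≤ c) →
    Nat.card (Algebra.adjoin F[X] (Set.range y) ≃ₐ[F[X]] Algebra.adjoin F[X] (Set.range y)) ≤ n0 →
    Q0 ≤ Fintype.card F →
    K * Fintype.card F ≤ K * n0 * Nat.card {t : F // ∃ φ : Algebra.adjoin F[X] (Set.range y) →ₐ[F] F,
      φ (algebraMap F[X] _ X) = t ∧ Function.Injective fun i => φ ⟨y i, Algebra.subset_adjoin ⟨i, rfl⟩⟩}
      + Fintype.card F := by
  classical
  choose Q0 hQ0 using fun n : ℕ => fun hn : 0 < n =>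
    stepU n (c * (N * N)) (N * (c + N * c)) K hn hK
  refine ⟨∑ n ∈ Finset.range (n0 + 1), if hn : 0 < n then Q0 n hn else 0, ?_⟩
  intro F _ _ ι _ y P hN hP hy hPc hG hq
  subst hN
  set O := Algebra.adjoin F[X] (Set.range y) with hO
  let y' : ι → O := fun i => ⟨y i, Algebra.subset_adjoin ⟨i, rfl⟩⟩
  have hinj : Function.Injective (algebraMap F[X] (PowerSeries F)) := Polynomial.coe_injective F
  have hinjO : Function.Injective (algebraMap F[X] O) := by
    intro a b h
    exact hinj (congrArg Subtype.val h)
  let L := FractionRing O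
  have hinjL : Function.Injective (algebraMap F[X] L) := by
    rw [IsScalarTower.algebraMap_eq F[X] O L]
    exact (IsFractionRing.injective O L).comp hinjO
  let _ : Algebra (RatFunc F) L := (IsFractionRing.lift hinjL : RatFunc F →+* L).toAlgebra
  have _ : IsScalarTower F[X] (RatFunc F) L := IsScalarTower.of_algebraMap_eq fun f =>
    (IsFractionRing.lift_algebraMap hinjL f).symm
  have hP' : P.map (algebraMap F[X] O) = ∏ i, (X - C (y' i)) := by
    have h1 : Function.Injective (algebraMap O (PowerSeries F)) := Subtype.val_injective
    apply Polynomial.map_injective _ h1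
    rw [map_map, Polynomial.map_prod]
    simp only [Polynomial.map_sub, map_X, map_C]
    exact hP
  have hy' : Function.Injective y' := fun i j h => hy (congrArg Subtype.val h)
  have hgen : Algebra.adjoin F[X] (Set.range y') = ⊤ := by
    have := Algebra.adjoin_adjoin_coe_preimage (R := F[X]) (s := Set.range y)
    convert this using 2
    ext z
    constructor
    · rintro ⟨i, rfl⟩; exact ⟨i, rfl⟩
    · rintro ⟨i, h⟩; exact ⟨i, Subtype.ext h⟩
  let em : O →ₐ[F] PowerSeries F := O.val.restrictScalars F
  have hem : Function.Injective em := Subtype.val_injective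
  have := finG L hgen hP'
  have := Fintype.ofFinite (O ≃ₐ[F[X]] O)
  obtain ⟨S, hS⟩ := exists_step L hgen hP' hy' c hc hPc em hem (fun f => rfl)
  rw [Nat.card_eq_fintype_card] at hG
  have hn : 0 < Fintype.card (O ≃ₐ[F[X]] O) := Fintype.card_pos
  have hle : Q0 (Fintype.card (O ≃ₐ[F[X]] O)) hn ≤ Fintype.card F := by
    refine le_trans ?_ hq
    have := Finset.single_le_sum (f := fun n => if hn : 0 < n then Q0 n hn else 0)
      (fun _ _ => Nat.zero_le _) (Finset.mem_range.2 (Nat.lt_succ_of_le hG))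
    simpa [hn] using this
  have h1 := hQ0 _ hn F O (O ≃ₐ[F[X]] O) S rfl hle
  refine h1.trans (Nat.add_le_add_right ?_ _)
  apply Nat.mul_le_mul (Nat.mul_le_mul_left _ hG)
  rw [← Nat.card_eq_finsetCard]
  exact Nat.card_le_card_of_injective (fun t : S.triv => ⟨t.1, hS t.1 t.2⟩) (fun a b h => by
    have h2 := congrArg (fun z => z.1) h
    exact Subtype.ext h2)
end S17
end

section
namespace S17
open MvPolynomial

/-- Existence input: proportion of systems with at least `D^k` rational zeros. -/
def P3Stmt (k D : ℕ) : Prop := ∃ Q : ℕ, ∀ (F : Type) [Field F] [Fintype F], Q ≤ Fintype.card F →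
  2 * Nat.card (Fin k → restrictTotalDegree (Fin k) F D) ≤
    3 * (D ^ k).factorial * Nat.card {f : Fin k → restrictTotalDegree (Fin k) F D //
      D ^ k ≤ Nat.card {x : Fin k → F // ∀ i, eval x (f i).1 = 0}}

theorem exact_zeros (k D : ℕ) (hD : 0 < D) (h : P3Stmt k D) :
    ∃ Q : ℕ, ∀ (F : Type) [Field F] [Fintype F], Q ≤ Fintype.card F →
  5 * Nat.card (Fin k → restrictTotalDegree (Fin k) F D) ≤
    Nat.card {f : Fin k → restrictTotalDegree (Fin k) F D //
      Nat.card {x : Fin k → F // ∀ i, eval x (f i).1 = 0} = D ^ k} * (8 * (D ^ k).factorial) := by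
  obtain ⟨Q, hQ⟩ := h
  refine ⟨max Q (24 * (D^k).factorial * (k * D^k)), fun F _ _ hF => ?_⟩
  have h1 := hQ F ((le_max_left _ _).trans hF)
  have h2 := lemmaA (k := k) (F := F) D (fun _ => D) (fun _ => hD) (fun _ => le_rfl) (fun _ => 0) (by simp)
  simp only [Finset.prod_const, Finset.card_univ, Fintype.card_fin, zero_add] at h2
  have hW : Nat.card (Fin k → restrictTotalDegree (Fin k) F D) = Nat.card (restrictTotalDegree (Fin k) F D) ^ k := by
    rw [Nat.card_fun]; simp
  rw [← hW] at h2
  set W := Nat.card (Fin k → restrictTotalDegree (Fin k) F D)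
  set q := Fintype.card F with hq
  have hq0 : 0 < q := Fintype.card_pos
  set A : Set (Fin k → restrictTotalDegree (Fin k) F D) := {f | D ^ k ≤ Nat.card {x : Fin k → F // ∀ i, eval x (f i).1 = 0}} with hA
  set B : Set (Fin k → restrictTotalDegree (Fin k) F D) := {f | Nat.card {x : Fin k → F // ∀ i, eval x (f i).1 = 0} = D ^ k} with hB
  set C : Set (Fin k → restrictTotalDegree (Fin k) F D) := {f | D ^ k < Nat.card {x : Fin k → F // ∀ i, eval x (f i).1 = 0}} with hC
  have h3 : A.ncard ≤ B.ncard + C.ncard := by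
    refine (Set.ncard_le_ncard (t := B ∪ C) ?_ (Set.toFinite _)).trans (Set.ncard_union_le _ _)
    intro f hf
    rcases (show D ^ k ≤ _ from hf).eq_or_lt with h | h
    · left; exact h.symm
    · right; exact h
  have h1' : 2 * W ≤ 3 * (D ^ k).factorial * A.ncard := h1
  have h2' : C.ncard * q ^ (D + 1) ≤ k * D ^ k * W := h2
  show 5 * W ≤ B.ncard * (8 * (D ^ k).factorial)
  have h4 : C.ncard * q ≤ k * D ^ k * W := by
    refine le_trans ?_ h2'
    gcongr
    exact Nat.le_self_pow (by omega) q
  have h5 : 24 * (D^k).factorial * (k * D^k) ≤ q := (le_max_right _ _).trans hF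
  have h6 : (24 * (D ^ k).factorial * C.ncard) * q ≤ W * q := by
    calc _ = 24 * (D ^ k).factorial * (C.ncard * q) := by ring
      _ ≤ 24 * (D ^ k).factorial * (k * D ^ k * W) := by gcongr
      _ = (24 * (D^k).factorial * (k * D^k)) * W := by ring
      _ ≤ q * W := by gcongr
      _ = _ := by ring
  have h7 := Nat.le_of_mul_le_mul_right h6 hq0
  have h8 : 3 * (D ^ k).factorial * A.ncard ≤ 3 * (D ^ k).factorial * (B.ncard + C.ncard) := by gcongr
  nlinarith

theorem many_js (k D d : ℕ) (hdD : d ≤ D) (F : Type) [Field F] [Fintype F] (n : ℕ)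
    (h : 5 * Nat.card (Fin k → restrictTotalDegree (Fin k) F D) ≤
      Nat.card {f : Fin k → restrictTotalDegree (Fin k) F D //
      Nat.card {x : Fin k → F // ∀ i, eval x (f i).1 = 0} = D ^ k} * (8 * (D ^ k).factorial)) :
    3 * Nat.card (Om k F D d n) ≤ 8 * (D^k).factorial * Nat.card {v : Om k F D d n |
      n ^ k ≤ 4 * (D^k).factorial * Nat.card {js : Fin k → Fin n // Nat.card {x : Fin k → F // ∀ i, eval x (ff v i (js i)) = 0} = D ^ k}} := by
  classical
  have hfin := Fintype.ofFinite (Om k F D d n)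
  set Z : Om k F D d n → (Fin k → Fin n) → Prop := fun v js => Nat.card {x : Fin k → F // ∀ i, eval x (ff v i (js i)) = 0} = D ^ k
  set M := (D^k).factorial
  have hjs : ∀ js, 5 * Nat.card (Om k F D d n) ≤ Nat.card {v | Z v js} * (8 * M) := by
    intro js
    apply count_translate' {v | Z v js} (fun x : Fin k → restrictTotalDegree (Fin k) F D => ((x, 0) : Om k F D d n))
    intro v
    refine h.trans_eq ?_
    congr 1
    let s : Fin k → restrictTotalDegree (Fin k) F D := fun i => ⟨ff v i (js i), by
      rw [mem_restrictTotalDegree]; exact ff_deg hdD _ _ _⟩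
    refine (Nat.card_congr (Equiv.subtypeEquiv (Equiv.addLeft s) fun x => ?_)).symm
    have : ∀ i, ff (v + ((x, 0) : Om k F D d n)) i (js i) = ((Equiv.addLeft s) x i).1 := by
      intro i
      simp only [ff, s, Equiv.coe_addLeft, Pi.add_apply, Submodule.coe_add, Prod.fst_add, Prod.snd_add, Pi.zero_apply, Submodule.coe_zero]
      ring
    simp only [Set.mem_ofPred_eq, Z, this]
  have hsum : ∑ v : Om k F D d n, Nat.card {js // Z v js} = ∑ js, Nat.card {v | Z v js} := by
    have e : (Σ v : Om k F D d n, {js // Z v js}) ≃ (Σ js, {v | Z v js}) :=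
      { toFun := fun a => ⟨a.2.1, a.1, a.2.2⟩
        invFun := fun a => ⟨a.2.1, a.1, a.2.2⟩
        left_inv := fun a => rfl
        right_inv := fun a => rfl }
    rw [← Nat.card_sigma, Nat.card_congr e, Nat.card_sigma]
  set G : Set (Om k F D d n) := {v | n ^ k ≤ 4 * M * Nat.card {js // Z v js}} with hG
  have hbd : ∀ v, 4 * M * Nat.card {js // Z v js} ≤ (if v ∈ G then 4 * M * n ^ k else 0) + n ^ k := by
    intro v
    split_ifs with hv
    · have : Nat.card {js // Z v js} ≤ n ^ k := by
        rw [Nat.card_eq_fintype_card]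
        refine (Fintype.card_subtype_le _).trans ?_
        simp
      nlinarith [Nat.zero_le (4 * M)]
    · simp only [hG, Set.mem_ofPred_eq, not_le] at hv
      omega
  have h1 : ∑ v : Om k F D d n, (4 * M * Nat.card {js // Z v js}) ≤ (4 * M * n^k) * Nat.card G + n ^ k * Nat.card (Om k F D d n) := by
    refine (Finset.sum_le_sum fun v _ => hbd v).trans ?_
    rw [Finset.sum_add_distrib, ← Finset.sum_filter, Finset.sum_const, Finset.sum_const]
    have : Nat.card G = (Finset.univ.filter (fun v => v ∈ G)).card := by
      rw [Nat.card_eq_fintype_card, Fintype.card_subtype]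
    rw [this, Nat.card_eq_fintype_card (α := Om k F D d n)]
    simp only [smul_eq_mul, Finset.card_univ]
    exact le_of_eq (by ring)
  rw [← Finset.mul_sum, hsum] at h1
  have h2 : n ^ k * (5 * Nat.card (Om k F D d n)) ≤ (∑ js : Fin k → Fin n, Nat.card {v | Z v js}) * (8 * M) := by
    rw [Finset.sum_mul]
    calc _ = ∑ js : Fin k → Fin n, 5 * Nat.card (Om k F D d n) := by
          rw [Finset.sum_const, smul_eq_mul, Finset.card_univ]; simp
      _ ≤ _ := Finset.sum_le_sum fun js _ => hjs js
  show 3 * Nat.card (Om k F D d n) ≤ 8 * M * Nat.card G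
  rcases Nat.eq_zero_or_pos (n^k) with h0 | h0
  · have : G = Set.univ := by ext v; simp [hG, h0]
    rw [this]
    have hM : 1 ≤ M := Nat.factorial_pos _
    have : Nat.card (Set.univ : Set (Om k F D d n)) = Nat.card (Om k F D d n) := Nat.card_congr (Equiv.Set.univ _)
    rw [this]
    gcongr
    omega
  · have h3 : (3 * Nat.card (Om k F D d n)) * n^k ≤ (8 * M * Nat.card G) * n^k := by nlinarith
    exact Nat.le_of_mul_le_mul_right h3 h0

theorem assembly (P3 : ∀ k D, 0 < k → 0 < D → P3Stmt k D) (k lam : ℕ) (hk : 0 < k) (hlam : 1 < lam)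
    (d D : ℕ) (hd : d = k ^ 2 + 2) (hD : D = lam * d) :
    ∃ Q : ℕ, ∀ (F : Type) [Field F] [Fintype F], Q ≤ Fintype.card F →
      (1 / (4 * (Nat.factorial (D ^ k) : ℝ))) *
          (Nat.card {wp : (Fin k → MvPolynomial (Fin k) F) ×
              (Fin k → Fin (Fintype.card F ^ k) → MvPolynomial (Fin k) F) //
            (∀ i, (wp.1 i).totalDegree ≤ D) ∧
              ∀ i j, (wp.2 i j).totalDegree ≤ d} : ℝ) ≤
        (Nat.card {wp : (Fin k → MvPolynomial (Fin k) F) ×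
            (Fin k → Fin (Fintype.card F ^ k) → MvPolynomial (Fin k) F) //
          ((∀ i, (wp.1 i).totalDegree ≤ D) ∧
            ∀ i j, (wp.2 i j).totalDegree ≤ d) ∧
          (∀ js : Fin k → Fin (Fintype.card F ^ k),
            Nat.card {x : Fin k → F //
              ∀ i, MvPolynomial.eval x (wp.1 i + wp.2 i (js i)) = 0} ≤ D ^ k) ∧
          (((Fintype.card F : ℝ) ^ k) ^ k / (4 * (Nat.factorial (D ^ k) : ℝ)) ≤
            (Nat.card {js : Fin k → Fin (Fintype.card F ^ k) //
              Nat.card {x : Fin k → F //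
                ∀ i, MvPolynomial.eval x (wp.1 i + wp.2 i (js i)) = 0} =
                D ^ k} : ℝ)) ∧
          (∀ idx : Fin k → Fin k × Fin (Fintype.card F ^ k),
            Function.Injective idx →
            (Set.range fun j => (idx j).1) ≠ Set.univ →
            (Nat.card {x : Fin k → F //
              ∀ j, MvPolynomial.eval x
                (wp.1 (idx j).1 + wp.2 (idx j).1 (idx j).2) = 0} : ℝ) ≤
              (D : ℝ) ^ k / (lam : ℝ))} : ℝ) := by
  have hd0 : 0 < d := by omega
  have hdD : d ≤ D := by rw [hD]; nlinarith
  obtain ⟨Q, hQ⟩ := exact_zeros k D (by omega) (P3 k D hk (by omega))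
  set M := (D^k).factorial with hM
  have hM0 : 0 < M := Nat.factorial_pos _
  refine ⟨max Q (8 * M * (2 * k ^ k * (k * D ^ k))), fun F _ _ hF => ?_⟩
  set n := Fintype.card F ^ k with hn
  have h1 := many_js k D d hdD F n (hQ F ((le_max_left _ _).trans hF))
  have h2 := bad_bound (F := F) D d hdD hd hk
  have hq : 8 * M * (2 * k ^ k * (k * D ^ k)) ≤ Fintype.card F := (le_max_right _ _).trans hF
  have hq0 : 0 < Fintype.card F := Fintype.card_pos
  rw [← hM] at h1
  rw [← hn] at h2
  set G : Set (Om k F D d n) := {v : Om k F D d n |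
      n ^ k ≤ 4 * M * Nat.card {js : Fin k → Fin n // Nat.card {x : Fin k → F // ∀ i, eval x (ff v i (js i)) = 0} = D ^ k}} with hG
  set B : Set (Om k F D d n) := {v | ¬ GoodIdx v} with hB
  have h3 : 8 * M * Nat.card B ≤ Nat.card (Om k F D d n) := by
    refine Nat.le_of_mul_le_mul_right (c := Fintype.card F) ?_ hq0
    calc _ = 8 * M * (Nat.card B * Fintype.card F) := by ring
      _ ≤ 8 * M * (2 * k ^ k * (k * D ^ k) * Nat.card (Om k F D d n)) := by gcongr
      _ = (8 * M * (2 * k ^ k * (k * D ^ k))) * Nat.card (Om k F D d n) := by ring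
      _ ≤ Fintype.card F * Nat.card (Om k F D d n) := by gcongr
      _ = _ := by ring
  have h4 : Nat.card G ≤ Nat.card (G \ B : Set (Om k F D d n)) + Nat.card B := by
    have : G.ncard ≤ (G \ B).ncard + B.ncard := by
      refine (Set.ncard_le_ncard (t := (G \ B) ∪ B) ?_ (Set.toFinite _)).trans (Set.ncard_union_le _ _)
      simp
    exact this
  have h5 : Nat.card (Om k F D d n) ≤ 4 * M * Nat.card (G \ B : Set (Om k F D d n)) := by
    have : 8 * M * Nat.card G ≤ 8 * M * (Nat.card (G \ B : Set (Om k F D d n)) + Nat.card B) := by gcongr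
    nlinarith
  let toWP : Om k F D d n → (Fin k → MvPolynomial (Fin k) F) × (Fin k → Fin n → MvPolynomial (Fin k) F) :=
    fun v => (fun i => (v.1 i).1, fun i j => (v.2 i j).1)
  have hdeg : ∀ v, (∀ i, ((toWP v).1 i).totalDegree ≤ D) ∧ ∀ i j, ((toWP v).2 i j).totalDegree ≤ d := by
    intro v
    refine ⟨fun i => ?_, fun i j => ?_⟩
    · have := (v.1 i).2; rwa [mem_restrictTotalDegree] at this
    · have := (v.2 i j).2; rwa [mem_restrictTotalDegree] at this
  have hinj : Function.Injective toWP := by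
    intro v w h
    refine Prod.ext ?_ ?_
    · funext i
      exact Subtype.ext (congrFun (congrArg Prod.fst h) i)
    · funext i j
      exact Subtype.ext (congrFun (congrFun (congrArg Prod.snd h) i) j)
  let ofWP : {wp : (Fin k → MvPolynomial (Fin k) F) × (Fin k → Fin n → MvPolynomial (Fin k) F) //
            (∀ i, (wp.1 i).totalDegree ≤ D) ∧ ∀ i j, (wp.2 i j).totalDegree ≤ d} → Om k F D d n :=
    fun wp => (fun i => ⟨wp.1.1 i, by rw [mem_restrictTotalDegree]; exact wp.2.1 i⟩,
      fun i j => ⟨wp.1.2 i j, by rw [mem_restrictTotalDegree]; exact wp.2.2 i j⟩)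
  have hofinj : Function.Injective ofWP := by
    intro v w h
    apply Subtype.ext
    have := congrArg toWP h
    exact this
  have hfin : Finite {wp : (Fin k → MvPolynomial (Fin k) F) × (Fin k → Fin n → MvPolynomial (Fin k) F) //
            (∀ i, (wp.1 i).totalDegree ≤ D) ∧ ∀ i j, (wp.2 i j).totalDegree ≤ d} := Finite.of_injective ofWP hofinj
  have h6 := Nat.card_le_card_of_injective ofWP hofinj
  have hM0' : (0:ℝ) < 4 * (M:ℝ) := by positivity
  rw [one_div, inv_mul_le_iff₀ hM0']
  have h7 : Nat.card (Om k F D d n) ≤ 4 * M * Nat.card (G \ B : Set (Om k F D d n)) := h5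
  refine le_trans (Nat.cast_le.2 (h6.trans h7)) ?_
  push_cast
  refine mul_le_mul_of_nonneg_left ?_ hM0'.le
  refine Nat.cast_le.2 ?_
  refine @Nat.card_le_card_of_injective _ _ ?_ (fun v => ⟨toWP v.1, hdeg v.1, ?_, ?_, ?_⟩) ?_
  · exact Finite.of_injective (fun x => (⟨x.1, x.2.1⟩ : {wp : (Fin k → MvPolynomial (Fin k) F) × (Fin k → Fin n → MvPolynomial (Fin k) F) //
            (∀ i, (wp.1 i).totalDegree ≤ D) ∧ ∀ i j, (wp.2 i j).totalDegree ≤ d})) (fun a b h => Subtype.ext (congrArg (fun z => z.1) h))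
  · have := v.2.2
    simp only [hB, Set.mem_ofPred_eq, not_not] at this
    exact this.1
  · have h8 : n ^ k ≤ _ := v.2.1
    rw [div_le_iff₀ hM0']
    have h9 : ((n ^ k : ℕ) : ℝ) ≤ _ := Nat.cast_le.2 h8
    have h10 : ((n ^ k : ℕ) : ℝ) = ((Fintype.card F : ℝ) ^ k) ^ k := by simp only [hn]; push_cast; ring
    rw [h10, Nat.cast_mul] at h9
    refine h9.trans (le_of_eq ?_)
    rw [mul_comm]
    push_cast
    rfl
  · intro idx hi hr
    have := v.2.2
    simp only [hB, Set.mem_ofPred_eq, not_not] at this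
    have h8 := this.2 idx hi hr
    have h9 : (D:ℝ)^k / lam = ((D ^ (k-1) * d : ℕ) : ℝ) := by
      have hl : (lam : ℝ) ≠ 0 := by positivity
      obtain ⟨k', rfl⟩ : ∃ k', k = k' + 1 := ⟨k-1, by omega⟩
      rw [div_eq_iff hl]
      push_cast
      rw [pow_succ]
      have : (D:ℝ) = lam * d := by exact_mod_cast hD
      rw [mul_assoc, mul_comm (d:ℝ), ← this]
    rw [h9]
    exact Nat.cast_le.2 h8
  · intro a b h
    exact Subtype.ext (hinj (congrArg Subtype.val h))
end S17
end

section
namespace S17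
open MvPolynomial

section New
variable {F : Type} [Field F] {k D : ℕ}

/-- the split system -/
noncomputable def f0 (α : Fin D → F) (i : Fin k) : MvPolynomial (Fin k) F := ∏ l, (X i - C (α l))

/-- zeros of the pencil at parameter `t` -/
def IsZ (α : Fin D → F) (g : Fin k → MvPolynomial (Fin k) F) {T : Type} [CommRing T] [Algebra F T]
    (t : T) (w : Fin k → T) : Prop := ∀ i, aeval w (f0 α i) + t * aeval w (g i) = 0

lemma aeval_f0 (α : Fin D → F) {T : Type} [CommRing T] [Algebra F T] (w : Fin k → T) (i : Fin k) :
    aeval w (f0 α i) = ∏ l, (w i - algebraMap F T (α l)) := by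
  simp [f0, map_prod]

lemma IsZ.map {α : Fin D → F} {g : Fin k → MvPolynomial (Fin k) F} {T T' : Type} [CommRing T] [Algebra F T]
    [CommRing T'] [Algebra F T'] {t : T} {w : Fin k → T} (h : IsZ α g t w) (ψ : T →ₐ[F] T') :
    IsZ α g (ψ t) (fun i => ψ (w i)) := by
  intro i
  have h1 : ∀ p : MvPolynomial (Fin k) F, aeval (fun i => ψ (w i)) p = ψ (aeval w p) := by
    intro p
    have := MvPolynomial.comp_aeval_apply (f := w) ψ p
    exact this.symm
  rw [h1, h1, ← map_mul, ← map_add, h i, map_zero]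

lemma IsZ.of_map {α : Fin D → F} {g : Fin k → MvPolynomial (Fin k) F} {T T' : Type} [CommRing T] [Algebra F T]
    [CommRing T'] [Algebra F T'] {t : T} {w : Fin k → T} (ψ : T →ₐ[F] T') (hψ : Function.Injective ψ)
    (h : IsZ α g (ψ t) (fun i => ψ (w i))) : IsZ α g t w := by
  intro i
  have h1 : ∀ p : MvPolynomial (Fin k) F, aeval (fun i => ψ (w i)) p = ψ (aeval w p) := by
    intro p
    have := MvPolynomial.comp_aeval_apply (f := w) ψ p
    exact this.symm
  apply hψ
  have := h i
  rw [h1, h1, ← map_mul, ← map_add] at this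
  rw [this, map_zero]

lemma aeval_congr {R : Type} [CommRing R] [Algebra F R] (d : R) (w w' : Fin k → R) (h : ∀ i, d ∣ w i - w' i)
    (p : MvPolynomial (Fin k) F) : d ∣ aeval w p - aeval w' p := by
  induction p using MvPolynomial.induction_on with
  | C a => simp
  | add p q hp hq =>
    rw [map_add, map_add, add_sub_add_comm]; exact dvd_add hp hq
  | mul_X p i hp =>
    rw [map_mul, map_mul, aeval_X, aeval_X,
      show aeval w p * w i - aeval w' p * w' i = (aeval w p - aeval w' p) * w i +
        aeval w' p * (w i - w' i) by ring]
    exact dvd_add (hp.mul_right _) ((h i).mul_left _)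

variable (α : Fin D → F) (hα : Function.Injective α) (g : Fin k → MvPolynomial (Fin k) F) (a : Fin k → Fin D)

/-- cofactor -/
noncomputable def hh (i : Fin k) (w : Fin k → PowerSeries F) : PowerSeries F :=
  aeval w (∏ l ∈ Finset.univ.erase (a i), (X i - C (α l)))

/-- Newton map -/
noncomputable def PhiN (w : Fin k → PowerSeries F) (i : Fin k) : PowerSeries F :=
  PowerSeries.C (α (a i)) - PowerSeries.X * (aeval w (g i) * (hh α a i w)⁻¹)

/-- initial value -/
def Ini (w : Fin k → PowerSeries F) : Prop := ∀ i, PowerSeries.constantCoeff (w i) = α (a i)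

lemma hh_eq (i : Fin k) (w : Fin k → PowerSeries F) :
    hh α a i w = ∏ l ∈ Finset.univ.erase (a i), (w i - PowerSeries.C (α l)) := by
  simp only [hh, map_prod, map_sub, aeval_X, algHom_C]
  rfl

include hα in
lemma hh_ne (i : Fin k) (w : Fin k → PowerSeries F) (hw : Ini α a w) :
    PowerSeries.constantCoeff (hh α a i w) ≠ 0 := by
  rw [hh_eq, map_prod, Finset.prod_ne_zero_iff]
  intro l hl
  rw [map_sub, hw i, PowerSeries.constantCoeff_C, sub_ne_zero]
  exact fun h => (Finset.ne_of_mem_erase hl) (hα h).symm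

lemma Phi_ini (w : Fin k → PowerSeries F) : Ini α a (PhiN α g a w) := by
  intro i
  simp [PhiN]

lemma f0_hh (i : Fin k) (w : Fin k → PowerSeries F) :
    aeval w (f0 α i) = (w i - PowerSeries.C (α (a i))) * hh α a i w := by
  rw [aeval_f0, hh_eq, Finset.mul_prod_erase _ (fun l => w i - PowerSeries.C (α l)) (Finset.mem_univ (a i))]
  rfl

include hα in
lemma fix_iff (w : Fin k → PowerSeries F) (hw : Ini α a w) :
    PhiN α g a w = w ↔ IsZ α g PowerSeries.X w := by
  have key : ∀ i, PhiN α g a w i = w i ↔ aeval w (f0 α i) + PowerSeries.X * aeval w (g i) = 0 := by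
    intro i
    have h1 := PowerSeries.mul_inv_cancel _ (hh_ne α hα a i w hw)
    have h0 : hh α a i w ≠ 0 := by
      intro h; rw [h, zero_mul] at h1; exact zero_ne_one h1
    rw [f0_hh α a]
    constructor
    · intro h
      rw [PhiN] at h
      linear_combination (-(hh α a i w)) * h - (PowerSeries.X * aeval w (g i)) * h1
    · intro h
      apply mul_right_cancel₀ h0
      rw [PhiN]
      linear_combination -h - (PowerSeries.X * aeval w (g i)) * h1
  constructor
  · intro h i; exact (key i).1 (congrFun h i)
  · intro h; ext1 i; exact (key i).2 (h i)

include hα in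
lemma contr (n : ℕ) (w w' : Fin k → PowerSeries F) (hw : Ini α a w) (hw' : Ini α a w')
    (h : ∀ i, PowerSeries.X ^ n ∣ w i - w' i) (i : Fin k) :
    PowerSeries.X ^ (n + 1) ∣ PhiN α g a w i - PhiN α g a w' i := by
  have h1 := PowerSeries.mul_inv_cancel _ (hh_ne α hα a i w hw)
  have h2 := PowerSeries.mul_inv_cancel _ (hh_ne α hα a i w' hw')
  have h3 := aeval_congr _ w w' h (g i)
  have h4 : PowerSeries.X ^ n ∣ hh α a i w - hh α a i w' := aeval_congr _ w w' h _
  have : PhiN α g a w i - PhiN α g a w' i = PowerSeries.X *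
      (-((aeval w (g i) - aeval w' (g i)) * (hh α a i w)⁻¹) +
      (hh α a i w - hh α a i w') * (aeval w' (g i) * (hh α a i w)⁻¹ * (hh α a i w')⁻¹)) := by
    rw [PhiN, PhiN]
    set u := (hh α a i w)⁻¹
    set v := (hh α a i w')⁻¹
    linear_combination (PowerSeries.X * aeval w' (g i) * u) * h2 - (PowerSeries.X * aeval w' (g i) * v) * h1
  rw [this, pow_succ']
  exact mul_dvd_mul_left _ (dvd_add ((h3.mul_right _).neg_right) (h4.mul_right _))

lemma ps_eq_of_dvd (x y : PowerSeries F) (h : ∀ n, PowerSeries.X ^ n ∣ x - y) : x = y := by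
  rw [← sub_eq_zero]
  ext n
  rw [map_zero]
  exact (PowerSeries.X_pow_dvd_iff.1 (h (n + 1))) n (Nat.lt_succ_self n)

include hα in
lemma z_unique (w w' : Fin k → PowerSeries F) (hw : Ini α a w) (hw' : Ini α a w')
    (h : IsZ α g PowerSeries.X w) (h' : IsZ α g PowerSeries.X w') : w = w' := by
  rw [← fix_iff α hα g a w hw] at h
  rw [← fix_iff α hα g a w' hw'] at h'
  have : ∀ n i, PowerSeries.X ^ n ∣ w i - w' i := by
    intro n
    induction n with
    | zero => simp
    | succ n ih =>
      intro i
      have := contr α hα g a n w w' hw hw' ih i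
      rwa [h, h'] at this
  ext1 i
  exact ps_eq_of_dvd _ _ fun n => this n i

include hα in
lemma z_exists : ∃ z : Fin k → PowerSeries F, Ini α a z ∧ IsZ α g PowerSeries.X z := by
  let s : ℕ → Fin k → PowerSeries F := fun n => (PhiN α g a)^[n] (fun i => PowerSeries.C (α (a i)))
  have hs : ∀ n, s (n + 1) = PhiN α g a (s n) := fun n => Function.iterate_succ_apply' _ _ _
  have hini : ∀ n, Ini α a (s n) := by
    intro n
    cases n with
    | zero => intro i; simp [s]
    | succ n => rw [hs]; exact Phi_ini α g a _
  have hstep : ∀ n i, PowerSeries.X ^ n ∣ s (n + 1) i - s n i := by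
    intro n
    induction n with
    | zero => simp
    | succ n ih =>
      intro i
      have := contr α hα g a n _ _ (hini (n + 1)) (hini n) ih i
      rwa [← hs, ← hs] at this
  have hco : ∀ n m i, PowerSeries.X ^ n ∣ s (n + m) i - s n i := by
    intro n m i
    induction m with
    | zero => simp
    | succ m ih =>
      have h1 := (pow_dvd_pow PowerSeries.X (Nat.le_add_right n m)).trans (hstep (n + m) i)
      have := dvd_add h1 ih
      rwa [sub_add_sub_cancel] at this
  let z : Fin k → PowerSeries F := fun i => PowerSeries.mk fun n => PowerSeries.coeff n (s (n + 1) i)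
  have hz : ∀ n i, PowerSeries.X ^ n ∣ z i - s n i := by
    intro n i
    rw [PowerSeries.X_pow_dvd_iff]
    intro m hm
    rw [map_sub, PowerSeries.coeff_mk]
    have h1 := hco (m + 1) (n - (m + 1)) i
    rw [show m + 1 + (n - (m + 1)) = n by omega] at h1
    have h2 := (PowerSeries.X_pow_dvd_iff.1 h1) m (Nat.lt_succ_self m)
    rw [map_sub] at h2
    rw [← neg_sub, h2, neg_zero]
  have hzi : Ini α a z := by
    intro i
    have := (PowerSeries.X_pow_dvd_iff.1 (hz 1 i)) 0 (by omega)
    rw [map_sub, PowerSeries.coeff_zero_eq_constantCoeff_apply,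
      PowerSeries.coeff_zero_eq_constantCoeff_apply, hini 1 i, sub_eq_zero] at this
    exact this
  refine ⟨z, hzi, (fix_iff α hα g a z hzi).1 ?_⟩
  ext1 i
  apply ps_eq_of_dvd
  intro n
  have h1 := contr α hα g a n z (s n) hzi (hini n) (hz n) i
  rw [← hs] at h1
  have h2 := dvd_sub h1 (hz (n + 1) i)
  rw [sub_sub_sub_cancel_right] at h2
  exact (pow_dvd_pow _ (Nat.le_succ n)).trans h2

/-- every zero over power series starts at a grid point -/
lemma ini_exists (w : Fin k → PowerSeries F) (h : IsZ α g PowerSeries.X w) : ∃ a, Ini α a w := by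
  have : ∀ i, ∃ l, PowerSeries.constantCoeff (w i) = α l := by
    intro i
    have h1 := congrArg PowerSeries.constantCoeff (h i)
    rw [aeval_f0, map_add, map_mul, PowerSeries.constantCoeff_X, zero_mul, add_zero, map_zero, map_prod,
      Finset.prod_eq_zero_iff] at h1
    obtain ⟨l, -, hl⟩ := h1
    refine ⟨l, ?_⟩
    rw [map_sub, sub_eq_zero] at hl
    rw [hl]
    exact PowerSeries.constantCoeff_C _
  choose a ha using this
  exact ⟨a, ha⟩

end New
end S17
end

section
namespace S17
open MvPolynomial
set_option linter.unusedSectionVars false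

section Red
variable {F : Type} [Field F] {k D : ℕ}

lemma aeval_fam {T : Type} [CommRing T] [Algebra F T] {I : Type} [Fintype I] (e : I → (Fin k →₀ ℕ))
    (he : Function.Injective e) (p : MvPolynomial (Fin k) F) (hp : ∀ s ∈ p.support, s ∈ Set.range e)
    (z : Fin k → T) : aeval z p = ∑ i, algebraMap F T (coeff (e i) p) * ∏ j, z j ^ (e i j) := by
  classical
  rw [aeval_def, eval₂_eq']
  rw [← Finset.sum_image (s := Finset.univ) (g := e)
    (f := fun s => algebraMap F T (coeff s p) * ∏ j, z j ^ (s j)) (fun a _ b _ h => he h)]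
  apply Finset.sum_subset
  · intro s hs
    obtain ⟨i, rfl⟩ := hp s hs
    simp
  · intro s _ hs
    rw [notMem_support_iff.1 hs, map_zero, zero_mul]

/-- lower part of the split polynomial -/
noncomputable def lowp (α : Fin D → F) : Polynomial F :=
  Polynomial.X ^ D - ∏ l, (Polynomial.X - Polynomial.C (α l))

lemma lowp_deg (hD : 0 < D) (α : Fin D → F) : (lowp α).natDegree < D := by
  have hm : (∏ l, (Polynomial.X - Polynomial.C (α l))).Monic := Polynomial.monic_prod_X_sub_C _ _
  have hn : (∏ l, (Polynomial.X - Polynomial.C (α l))).natDegree = D := by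
    rw [Polynomial.natDegree_finsetProd_X_sub_C_eq_card]; simp
  by_cases h : lowp α = 0
  · rw [h]; simpa using hD
  rw [Polynomial.natDegree_lt_iff_degree_lt h]
  have := Polynomial.degree_sub_lt_left (p := (Polynomial.X ^ D : Polynomial F)) (q := ∏ l, (Polynomial.X - Polynomial.C (α l)))
    (by rw [Polynomial.degree_X_pow, Polynomial.degree_eq_natDegree hm.ne_zero, hn]) (by simp)
    (by rw [hm.leadingCoeff, Polynomial.leadingCoeff_X_pow])
  rwa [Polynomial.degree_X_pow] at this

lemma td_aeval (i : Fin k) (p : Polynomial F) :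
    (Polynomial.aeval (X i : MvPolynomial (Fin k) F) p).totalDegree ≤ p.natDegree := by
  rw [Polynomial.aeval_eq_sum_range]
  apply totalDegree_finsetSum_le
  intro j hj
  refine (totalDegree_smul_le _ _).trans ((totalDegree_pow _ _).trans ?_)
  rw [totalDegree_X, mul_one]
  exact Nat.lt_succ_iff.1 (Finset.mem_range.1 hj)

lemma f0_low (α : Fin D → F) (i : Fin k) :
    f0 α i = X i ^ D - Polynomial.aeval (X i : MvPolynomial (Fin k) F) (lowp α) := by
  simp [f0, lowp, map_prod, MvPolynomial.algebraMap_eq]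

/-- reducible with remainder -/
def Redu (α : Fin D → F) (g : Fin k → MvPolynomial (Fin k) F) (n : ℕ) (p : MvPolynomial (Fin k) F) : Prop :=
  ∃ w b : MvPolynomial (Fin k) F, w.totalDegree ≤ n ∧ (∀ s ∈ b.support, ∀ i, s i < D) ∧
    ∀ z : Fin k → PowerSeries F, IsZ α g PowerSeries.X z →
      aeval z p + PowerSeries.X * aeval z w = aeval z b

lemma Redu.add {α : Fin D → F} {g : Fin k → MvPolynomial (Fin k) F} {n : ℕ} {p p' : MvPolynomial (Fin k) F}
    (h : Redu α g n p) (h' : Redu α g n p') : Redu α g n (p + p') := by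
  classical
  obtain ⟨w, b, h1, h2, h3⟩ := h
  obtain ⟨w', b', h1', h2', h3'⟩ := h'
  refine ⟨w + w', b + b', (totalDegree_add _ _).trans (max_le h1 h1'), ?_, ?_⟩
  · intro s hs
    rcases Finset.mem_union.1 (support_add hs) with h | h
    · exact h2 s h
    · exact h2' s h
  · intro z hz
    rw [map_add, map_add, map_add, ← h3 z hz, ← h3' z hz]; ring

lemma Redu.smul {α : Fin D → F} {g : Fin k → MvPolynomial (Fin k) F} {n : ℕ} {p : MvPolynomial (Fin k) F}
    (h : Redu α g n p) (c : F) : Redu α g n (c • p) := by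
  obtain ⟨w, b, h1, h2, h3⟩ := h
  refine ⟨c • w, c • b, (totalDegree_smul_le _ _).trans h1, fun s hs => h2 s (support_smul hs), ?_⟩
  intro z hz
  rw [map_smul, map_smul, map_smul, ← h3 z hz, smul_add, mul_smul_comm]

lemma Redu.mono {α : Fin D → F} {g : Fin k → MvPolynomial (Fin k) F} {n n' : ℕ} {p : MvPolynomial (Fin k) F}
    (h : Redu α g n p) (hn : n ≤ n') : Redu α g n' p := by
  obtain ⟨w, b, h1, h2, h3⟩ := h
  exact ⟨w, b, h1.trans hn, h2, h3⟩

lemma redu (hD : 0 < D) (α : Fin D → F) (g : Fin k → MvPolynomial (Fin k) F)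
    (hg : ∀ i, (g i).totalDegree ≤ D) (n : ℕ) : ∀ p : MvPolynomial (Fin k) F, p.totalDegree ≤ n → Redu α g n p := by
  classical
  induction n using Nat.strong_induction_on with
  | _ n ih =>
  have hmon : ∀ s : Fin k →₀ ℕ, s.degree ≤ n → Redu α g n (monomial s 1) := by
    intro s hs
    by_cases hbox : ∀ i, s i < D
    · refine ⟨0, monomial s 1, by simp, ?_, by simp⟩
      intro s' hs'
      have := support_monomial_subset hs'
      rw [Finset.mem_singleton] at this
      rwa [this]
    push Not at hbox
    obtain ⟨i, hi⟩ := hbox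
    obtain ⟨s', rfl⟩ : ∃ s', s = s' + Finsupp.single i D := by
      refine ⟨s - Finsupp.single i D, ?_⟩
      rw [tsub_add_cancel_of_le]
      rwa [Finsupp.single_le_iff]
    rw [map_add, Finsupp.degree_single] at hs
    set l := Polynomial.aeval (X i : MvPolynomial (Fin k) F) (lowp α) with hl
    have hld : l.totalDegree < D := (td_aeval i _).trans_lt (lowp_deg hD α)
    have hs'd : (monomial s' (1:F)).totalDegree = s'.degree := by
      rw [totalDegree_monomial _ one_ne_zero]; rfl
    have e1 : (monomial (s' + Finsupp.single i D) 1 : MvPolynomial (Fin k) F) = monomial s' 1 * (f0 α i + l) := by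
      rw [f0_low, hl, sub_add_cancel, X_pow_eq_monomial, monomial_mul, mul_one]
    obtain ⟨w, b, h1, h2, h3⟩ := ih (n - 1) (by omega) (monomial s' 1 * l) (by
      refine (totalDegree_mul _ _).trans ?_
      rw [hs'd]; omega)
    refine ⟨w + monomial s' 1 * g i, b, ?_, h2, ?_⟩
    · refine (totalDegree_add _ _).trans (max_le (by omega) ?_)
      refine (totalDegree_mul _ _).trans ?_
      rw [hs'd]
      have := hg i
      omega
    · intro z hz
      rw [e1, ← h3 z hz]
      have := hz i
      simp only [map_mul, map_add]
      linear_combination (aeval z (monomial s' (1:F))) * this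
  intro p hp
  rw [p.as_sum]
  have : ∀ A : Finset (Fin k →₀ ℕ), A ⊆ p.support → Redu α g n (∑ v ∈ A, monomial v (coeff v p)) := by
    intro A
    induction A using Finset.induction_on with
    | empty => intro _; exact ⟨0, 0, by simp, by simp, by simp⟩
    | insert s A hs ihA =>
      intro h
      rw [Finset.sum_insert hs]
      refine Redu.add ?_ (ihA ((Finset.subset_insert _ _).trans h))
      have := (hmon s ((le_totalDegree (h (Finset.mem_insert_self _ _))).trans hp)).smul (coeff s p)
      rwa [smul_monomial, smul_eq_mul, mul_one] at this
  exact this _ subset_rfl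

/-- monomials of bounded degree -/
noncomputable def monF (k E : ℕ) : Finset (Fin k →₀ ℕ) := (Finsupp.finite_of_degree_le (σ := Fin k) E).toFinset

lemma mem_monF (k E : ℕ) (s : Fin k →₀ ℕ) : s ∈ monF k E ↔ s.degree ≤ E := by
  simp [monF]

/-- filtration lemma for determinants -/
lemma det_filt {S : Type} [CommRing S] (W : ℕ → AddSubgroup S) (one : 1 ∈ W 0)
    (mul : ∀ a b x y, x ∈ W a → y ∈ W b → x * y ∈ W (a + b)) {n : Type} [Fintype n] [DecidableEq n]
    (M : Matrix n n S) (c : ℕ) (h : ∀ i j, M i j ∈ W c) : M.det ∈ W (Fintype.card n * c) := by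
  have hp : ∀ (f : n → S) (_ : ∀ i, f i ∈ W c) (s : Finset n), ∏ i ∈ s, f i ∈ W (s.card * c) := by
    intro f hf s
    induction s using Finset.induction_on with
    | empty => simpa using one
    | insert i s hi ih =>
      rw [Finset.prod_insert hi, Finset.card_insert_of_notMem hi, add_mul, one_mul, add_comm]
      exact mul _ _ _ _ (hf i) ih
  rw [Matrix.det_apply]
  refine sum_mem fun σ _ => ?_
  have := hp (fun i => M (σ i) i) (fun i => h _ _) Finset.univ
  rw [Finset.card_univ] at this
  rcases Int.units_eq_one_or (Equiv.Perm.sign σ) with h | h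
  · rw [h, one_smul]; exact this
  · rw [h, Units.neg_smul, one_smul]; exact neg_mem this

/-- degree filtration -/
def W1 (F : Type) [Field F] (a : ℕ) : AddSubgroup (Polynomial F) where
  carrier := {p | p.natDegree ≤ a}
  zero_mem' := by simp
  add_mem' := fun {x y} hx hy => (Polynomial.natDegree_add_le _ _).trans (max_le hx hy)
  neg_mem' := fun {x} hx => by
    show (-x).natDegree ≤ a
    rw [Polynomial.natDegree_neg]; exact hx

lemma mem_W1 (a : ℕ) (p : Polynomial F) : p ∈ W1 F a ↔ p.natDegree ≤ a := Iff.rfl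

lemma W1_one : (1 : Polynomial F) ∈ W1 F 0 := by simp [mem_W1]

lemma W1_mul (a b : ℕ) (x y : Polynomial F) (hx : x ∈ W1 F a) (hy : y ∈ W1 F b) : x * y ∈ W1 F (a + b) :=
  Polynomial.natDegree_mul_le.trans (add_le_add hx hy)

/-- coefficientwise degree filtration -/
def W2 (F : Type) [Field F] (a : ℕ) : AddSubgroup (Polynomial (Polynomial F)) where
  carrier := {p | ∀ i, p.coeff i ∈ W1 F a}
  zero_mem' := fun i => by rw [Polynomial.coeff_zero]; exact zero_mem _
  add_mem' := fun {x y} hx hy i => by rw [Polynomial.coeff_add]; exact add_mem (hx i) (hy i)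
  neg_mem' := fun {x} hx i => by rw [Polynomial.coeff_neg]; exact neg_mem (hx i)

lemma mem_W2 (a : ℕ) (p : Polynomial (Polynomial F)) : p ∈ W2 F a ↔ ∀ i, p.coeff i ∈ W1 F a := Iff.rfl

lemma W2_one : (1 : Polynomial (Polynomial F)) ∈ W2 F 0 := by
  intro i
  rw [Polynomial.coeff_one]
  split_ifs
  · exact W1_one
  · exact zero_mem _

lemma W2_mul (a b : ℕ) (x y : Polynomial (Polynomial F)) (hx : x ∈ W2 F a) (hy : y ∈ W2 F b) :
    x * y ∈ W2 F (a + b) := by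
  intro i
  rw [Polynomial.coeff_mul]
  exact sum_mem fun j _ => W1_mul _ _ _ _ (hx _) (hy _)

lemma W1_C (c : F) : Polynomial.C c ∈ W1 F 0 := by simp [mem_W1]

end Red
end S17
end

section
namespace S17
open MvPolynomial
set_option linter.unusedSectionVars false

section Elim
variable {F : Type} [Field F] {k D : ℕ}

/-- number of monomials -/
noncomputable def nu (k D : ℕ) : ℕ := (monF k (k * D)).card

/-- box exponents -/
noncomputable def eB (a : Fin k → Fin D) : Fin k →₀ ℕ := Finsupp.equivFunOnFinite.symm fun j => (a j : ℕ)

lemma eB_apply (a : Fin k → Fin D) (j : Fin k) : eB a j = a j := rfl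

lemma eB_inj : Function.Injective (eB : (Fin k → Fin D) → _) := by
  intro a b h
  ext j
  have := DFunLike.congr_fun h j
  exact this

lemma redu_mat (hD : 0 < D) (α : Fin D → F) (g : Fin k → MvPolynomial (Fin k) F)
    (hg : ∀ i, (g i).totalDegree ≤ D) (E : ℕ) : ∃ (Nm : Matrix (monF k E) (monF k E) F)
      (Bm : Matrix (monF k E) (Fin k → Fin D) F), ∀ z : Fin k → PowerSeries F, IsZ α g PowerSeries.X z →
      ∀ s : monF k E, (∏ j, z j ^ (s.1 j)) + PowerSeries.X * ∑ s' : monF k E, PowerSeries.C (Nm s s') * ∏ j, z j ^ (s'.1 j) =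
        ∑ a, PowerSeries.C (Bm s a) * ∏ j, z j ^ (a j : ℕ) := by
  have h : ∀ s : monF k E, Redu α g E (monomial s.1 1) := by
    intro s
    apply redu hD α g hg E
    rw [totalDegree_monomial _ one_ne_zero]
    exact (mem_monF _ _ _).1 s.2
  choose w b h1 h2 h3 using h
  refine ⟨fun s s' => coeff s'.1 (w s), fun s a => coeff (eB a) (b s), fun z hz s => ?_⟩
  have := h3 s z hz
  rw [aeval_fam (T := PowerSeries F) (fun s : monF k E => s.1) Subtype.val_injective (w s) (by
      intro s' hs'
      exact ⟨⟨s', (mem_monF _ _ _).2 ((le_totalDegree hs').trans (h1 s))⟩, rfl⟩),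
    aeval_fam (T := PowerSeries F) eB eB_inj (b s) (by
      intro s' hs'
      exact ⟨fun j => ⟨s' j, h2 s s' hs' j⟩, by ext j; rfl⟩), aeval_monomial, map_one, one_mul,
    Finsupp.prod_fintype _ _ (by simp)] at this
  exact this

lemma eigen_root {S : Type} [CommRing S] [IsDomain S] {n : Type} [Fintype n] [DecidableEq n] (M : Matrix n n S)
    (v : n → S) (hv : v ≠ 0) (y : S) (h : M.mulVec v = y • v) : M.charpoly.eval y = 0 := by
  rw [Matrix.eval_charpoly, ← Matrix.exists_mulVec_eq_zero_iff]
  refine ⟨v, hv, ?_⟩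
  rw [Matrix.sub_mulVec, h]
  ext i
  simp [Matrix.scalar_apply]

lemma charpoly_W2 {n : Type} [Fintype n] [DecidableEq n] (M : Matrix n n (Polynomial F)) (c : ℕ)
    (h : ∀ i j, M i j ∈ W1 F c) : M.charpoly ∈ W2 F (Fintype.card n * c) := by
  rw [Matrix.charpoly]
  apply det_filt _ W2_one W2_mul
  intro i j l
  have hC : ∀ p ∈ W1 F c, (Polynomial.C p).coeff l ∈ W1 F c := by
    intro p hp
    rw [Polynomial.coeff_C]
    split_ifs
    · exact hp
    · exact zero_mem _
  by_cases hij : i = j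
  · subst hij
    rw [Matrix.charmatrix_apply_eq, Polynomial.coeff_sub]
    refine sub_mem ?_ (hC _ (h i i))
    rw [Polynomial.coeff_X]
    split_ifs
    · simp [mem_W1]
    · exact zero_mem _
  · rw [Matrix.charmatrix_apply_ne _ _ _ hij, Polynomial.coeff_neg]
    exact neg_mem (hC _ (h i j))

lemma W1_mono {a b : ℕ} (h : a ≤ b) {p : Polynomial F} (hp : p ∈ W1 F a) : p ∈ W1 F b := le_trans hp h

theorem elim (hk : 0 < k) (hD : 0 < D) (α : Fin D → F) (g : Fin k → MvPolynomial (Fin k) F)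
    (hg : ∀ i, (g i).totalDegree ≤ D) : ∃ R : Polynomial F, R.natDegree ≤ nu k D ∧ R.coeff 0 = 1 ∧
    ∀ u : MvPolynomial (Fin k) F, u.totalDegree ≤ 1 → ∃ P : Polynomial (Polynomial F),
      P.Monic ∧ P.natDegree = D ^ k ∧ (∀ i, (P.coeff i).natDegree ≤ D ^ k * nu k D) ∧
      ∀ z : Fin k → PowerSeries F, IsZ α g PowerSeries.X z →
        (P.map (algebraMap (Polynomial F) (PowerSeries F))).eval (algebraMap (Polynomial F) (PowerSeries F) R * aeval z u) = 0 := by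
  classical
  obtain ⟨I, hI⟩ : ∃ I, I = monF k (k * D) := ⟨_, rfl⟩
  have hred := redu_mat hD α g hg (k * D)
  rw [← hI] at hred
  obtain ⟨Nm, Bm, hNB⟩ := hred
  have hcI : Fintype.card I = nu k D := by rw [hI]; exact Fintype.card_coe _
  let M1 : Matrix I I (Polynomial F) := 1 + (Polynomial.X : Polynomial F) • Nm.map Polynomial.C
  have hM1 : ∀ i j, M1 i j ∈ W1 F 1 := by
    intro i j
    rw [show M1 i j = (1 : Matrix I I (Polynomial F)) i j + Polynomial.X * Polynomial.C (Nm i j) from rfl]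
    refine add_mem ?_ ?_
    · rw [Matrix.one_apply]
      split_ifs
      · exact W1_mono (Nat.zero_le _) W1_one
      · exact zero_mem _
    · exact W1_mul 1 0 _ _ (by simp [mem_W1]) (W1_C _)
  have hadj : ∀ i j, M1.adjugate i j ∈ W1 F (nu k D) := by
    intro i j
    rw [Matrix.adjugate_apply, ← hcI, ← mul_one (Fintype.card I)]
    apply det_filt _ W1_one W1_mul
    intro a b
    rw [Matrix.updateRow_apply]
    split_ifs
    · rw [Pi.single_apply]
      split_ifs
      · exact W1_mono (Nat.zero_le _) W1_one
      · exact zero_mem _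
    · exact hM1 a b
  refine ⟨M1.det, ?_, ?_, ?_⟩
  · have := det_filt _ W1_one W1_mul M1 1 hM1
    rwa [hcI, mul_one] at this
  · rw [Polynomial.coeff_zero_eq_eval_zero, ← Polynomial.coe_evalRingHom, RingHom.map_det]
    have : (Polynomial.evalRingHom (0:F)).mapMatrix M1 = 1 := by
      ext i j
      simp only [M1, RingHom.mapMatrix_apply, Matrix.map_apply, Matrix.add_apply, Matrix.smul_apply,
        Polynomial.coe_evalRingHom, Polynomial.eval_add, smul_eq_mul, Polynomial.eval_mul, Polynomial.eval_X,
        zero_mul, add_zero, Matrix.one_apply]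
      split_ifs <;> simp
    rw [this, Matrix.det_one]
  intro u hu
  let Cu : Matrix (Fin k → Fin D) I F := fun a s => coeff s.1 (u * monomial (eB a) 1)
  let M : Matrix (Fin k → Fin D) (Fin k → Fin D) (Polynomial F) :=
    (Cu.map Polynomial.C) * M1.adjugate * (Bm.map Polynomial.C)
  have hM : ∀ i j, M i j ∈ W1 F (nu k D) := by
    intro i j
    rw [show M i j = ∑ s', (∑ s, (Cu.map Polynomial.C) i s * M1.adjugate s s') * (Bm.map Polynomial.C) s' j from by
      simp only [M, Matrix.mul_apply]]
    refine sum_mem fun s' _ => ?_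
    have := W1_mul (nu k D) 0 _ _ (sum_mem fun s (_ : s ∈ Finset.univ) =>
      W1_mono (by omega) (W1_mul 0 (nu k D) _ _ (W1_C (Cu i s)) (hadj s s'))) (W1_C (Bm s' j))
    exact this
  refine ⟨M.charpoly, Matrix.charpoly_monic _, ?_, ?_, ?_⟩
  · rw [Matrix.charpoly_natDegree_eq_dim]; simp
  · have := charpoly_W2 M (nu k D) hM
    intro i
    have := this i
    rwa [mem_W1, Fintype.card_fun, Fintype.card_fin, Fintype.card_fin] at this
  intro z hz
  let ι := algebraMap (Polynomial F) (PowerSeries F)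
  have hιC : ∀ c, ι (Polynomial.C c) = PowerSeries.C c := fun c => by
    show ((Polynomial.C c : Polynomial F) : PowerSeries F) = _
    exact Polynomial.coe_C c
  have hιX : ι Polynomial.X = PowerSeries.X := Polynomial.coe_X
  let vI : I → PowerSeries F := fun s => ∏ j, z j ^ (s.1 j)
  let vB : (Fin k → Fin D) → PowerSeries F := fun a => ∏ j, z j ^ (a j : ℕ)
  have e1 : (M1.map ι).mulVec vI = ((Bm.map Polynomial.C).map ι).mulVec vB := by
    ext1 s
    have := hNB z hz s
    simp only [Matrix.mulVec, dotProduct, Matrix.map_apply, hιC]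
    rw [show ∑ a, PowerSeries.C (Bm s a) * vB a = _ from this.symm]
    simp only [M1, Matrix.add_apply, map_add, add_mul, Finset.sum_add_distrib, Matrix.smul_apply, smul_eq_mul,
      Matrix.map_apply, map_mul, hιX, hιC, Matrix.one_apply]
    rw [Finset.mul_sum]
    congr 1
    · simp [vI]
    · simp [vI, mul_assoc]
  have e2 : ((Cu.map Polynomial.C).map ι).mulVec vI = (aeval z u) • vB := by
    ext1 a
    simp only [Matrix.mulVec, dotProduct, Matrix.map_apply, hιC, Pi.smul_apply, smul_eq_mul]
    have h1 : vB a = aeval z (monomial (eB a) (1:F)) := by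
      rw [aeval_monomial, map_one, one_mul, Finsupp.prod_fintype _ _ (by simp)]
      rfl
    rw [h1, ← map_mul, aeval_fam (T := PowerSeries F) (fun s : I => s.1) Subtype.val_injective]
    · rfl
    · intro s hs
      refine ⟨⟨s, hI ▸ (mem_monF _ _ _).2 ((le_totalDegree hs).trans ((totalDegree_mul _ _).trans ?_))⟩, rfl⟩
      have h2 : (monomial (eB a) (1:F)).totalDegree ≤ k * (D - 1) := by
        rw [totalDegree_monomial _ one_ne_zero, Finsupp.sum_fintype _ _ (by simp)]
        refine (Finset.sum_le_card_nsmul Finset.univ _ (D - 1) ?_).trans (by simp)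
        intro j _
        have := (a j).2
        rw [eB_apply]; omega
      have h3 : k * (D - 1) + k = k * D := by
        obtain ⟨D', rfl⟩ : ∃ D', D = D' + 1 := ⟨D - 1, by omega⟩
        simp [Nat.mul_add]
      omega
  have e3 : (M.map ι).mulVec vB = (ι M1.det * aeval z u) • vB := by
    have : M.map ι = ((Cu.map Polynomial.C).map ι) * (M1.adjugate.map ι) * ((Bm.map Polynomial.C).map ι) := by
      simp only [M, Matrix.map_mul]
    rw [this, ← Matrix.mulVec_mulVec, ← e1, Matrix.mulVec_mulVec, Matrix.mul_assoc, ← Matrix.map_mul,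
      Matrix.adjugate_mul]
    have h4 : (M1.det • (1 : Matrix I I (Polynomial F))).map ι = ι M1.det • (1 : Matrix I I (PowerSeries F)) := by
      ext i j
      simp only [Matrix.map_apply, Matrix.smul_apply, smul_eq_mul, map_mul, Matrix.one_apply]
      split_ifs <;> simp
    rw [h4, Matrix.mul_smul, Matrix.mul_one, Matrix.smul_mulVec, e2, smul_smul]
  rw [← Matrix.charpoly_map]
  refine eigen_root _ vB ?_ _ e3
  intro h
  have := congrFun h (fun _ => ⟨0, hD⟩)
  simp [vB] at this

end Elim
end S17
end

section
namespace S17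
open MvPolynomial
set_option linter.unusedSectionVars false

section Forms
variable {F : Type} [Field F] {k D : ℕ}

/-- affine forms -/
noncomputable def uf (V : Matrix (Fin k) (Fin k) F) (β : Fin k → F) (r : Fin k) : MvPolynomial (Fin k) F :=
  ∑ i, C (V r i) * X i + C (β r)

lemma uf_deg (V : Matrix (Fin k) (Fin k) F) (β : Fin k → F) (r : Fin k) : (uf V β r).totalDegree ≤ 1 := by
  refine (totalDegree_add _ _).trans (max_le ?_ (by simp))
  apply totalDegree_finsetSum_le
  intro i _
  refine (totalDegree_mul _ _).trans ?_
  simp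

lemma aeval_uf {T : Type} [CommRing T] [Algebra F T] (V : Matrix (Fin k) (Fin k) F) (β : Fin k → F) (r : Fin k)
    (w : Fin k → T) : aeval w (uf V β r) = ∑ i, algebraMap F T (V r i) * w i + algebraMap F T (β r) := by
  simp [uf]

lemma mat_cancel {T : Type} [CommRing T] [Algebra F T] (V W : Matrix (Fin k) (Fin k) F) (h : V * W = 1)
    (c : Fin k → T) (r : Fin k) :
    ∑ i, algebraMap F T (V r i) * ∑ j, algebraMap F T (W i j) * c j = c r := by
  simp only [Finset.mul_sum]
  rw [Finset.sum_comm]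
  have : ∀ j, ∑ i, algebraMap F T (V r i) * (algebraMap F T (W i j) * c j) = algebraMap F T ((V * W) r j) * c j := by
    intro j
    rw [Matrix.mul_apply, map_sum, Finset.sum_mul]
    simp only [map_mul, mul_assoc]
  simp only [this, h, Matrix.one_apply]
  simp [Finset.sum_ite_eq]

theorem forms (k D : ℕ) : ∃ Q : ℕ, ∀ (F : Type) [Field F] [Fintype F], Q ≤ Fintype.card F →
    ∀ α : Fin D → F, Function.Injective α → ∃ (V W : Matrix (Fin k) (Fin k) F) (β : Fin k → F),
      V * W = 1 ∧ W * V = 1 ∧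
      Function.Injective fun ra : Fin k × (Fin k → Fin D) => ∑ i, V ra.1 i * α (ra.2 i) + β ra.1 := by
  classical
  refine ⟨D ^ k * D ^ k * k + k + (k * D ^ k) * (k * D ^ k) + 1, fun F _ _ hF α hα => ?_⟩
  let p : (Fin k → Fin D) → Polynomial F := fun a => ∑ i : Fin k, Polynomial.C (α (a i)) * Polynomial.X ^ (i : ℕ)
  have hpc : ∀ a (i : Fin k), (p a).coeff i = α (a i) := by
    intro a i
    simp only [p, Polynomial.finsetSum_coeff, Polynomial.coeff_C_mul_X_pow]
    rw [Finset.sum_eq_single i]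
    · simp
    · intro j _ hj
      rw [if_neg]
      intro h; exact hj (Fin.ext h.symm)
    · simp
  have hpd : ∀ a, (p a).natDegree ≤ k := by
    intro a
    apply Polynomial.natDegree_sum_le_of_forall_le
    intro i _
    exact (Polynomial.natDegree_C_mul_X_pow_le _ _).trans i.2.le
  have hpi : Function.Injective p := by
    intro a b h
    ext1 i
    apply hα
    rw [← hpc, ← hpc, h]
  let Bad : Finset F := (Finset.univ : Finset ((Fin k → Fin D) × (Fin k → Fin D))).biUnion
    fun ab => (p ab.1 - p ab.2).roots.toFinset
  have hBad : Bad.card ≤ D ^ k * D ^ k * k := by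
    refine (Finset.card_biUnion_le_card_mul _ _ k ?_).trans (by simp)
    intro ab _
    refine (Multiset.toFinset_card_le _).trans ((Polynomial.card_roots' _).trans ?_)
    exact (Polynomial.natDegree_sub_le _ _).trans (max_le (hpd _) (hpd _))
  have hcompl : k ≤ Badᶜ.card := by
    rw [Finset.card_compl]; omega
  obtain ⟨ρ⟩ : Nonempty (Fin k ↪ (Badᶜ : Finset F)) := by
    apply Function.Embedding.nonempty_of_card_le
    rw [Fintype.card_fin, Fintype.card_coe]; exact hcompl
  have hρ : ∀ r a b, (p a).eval (ρ r).1 = (p b).eval (ρ r).1 → a = b := by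
    intro r a b h
    by_contra hab
    have := (ρ r).2
    rw [Finset.mem_compl] at this
    apply this
    rw [Finset.mem_biUnion]
    refine ⟨(a, b), Finset.mem_univ _, ?_⟩
    rw [Multiset.mem_toFinset, Polynomial.mem_roots (sub_ne_zero.2 fun h => hab (hpi h))]
    simp [h]
  let Bad2 : Finset F := (Finset.univ : Finset ((Fin k × (Fin k → Fin D)) × (Fin k × (Fin k → Fin D)))).image
    fun x => ((p x.2.2).eval (ρ x.2.1).1 - (p x.1.2).eval (ρ x.1.1).1) / ((ρ x.1.1).1 - (ρ x.2.1).1)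
  have hBad2 : Bad2.card ≤ (k * D ^ k) * (k * D ^ k) := by
    refine Finset.card_image_le.trans (by simp)
  obtain ⟨s, hs⟩ : ∃ s, s ∉ Bad2 := by
    by_contra h
    push Not at h
    have : Bad2 = Finset.univ := Finset.eq_univ_of_forall h
    rw [this, Finset.card_univ] at hBad2
    omega
  let V : Matrix (Fin k) (Fin k) F := Matrix.vandermonde fun r => (ρ r).1
  have hdet : IsUnit V.det := by
    rw [isUnit_iff_ne_zero, Matrix.det_vandermonde_ne_zero_iff]
    exact fun a b h => ρ.injective (Subtype.ext h)
  have hev : ∀ r a, ∑ i, V r i * α (a i) = (p a).eval (ρ r).1 := by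
    intro r a
    simp only [p, Polynomial.eval_finsetSum, V, Matrix.vandermonde_apply, Polynomial.eval_mul,
      Polynomial.eval_C, Polynomial.eval_pow, Polynomial.eval_X]
    exact Finset.sum_congr rfl fun i _ => mul_comm _ _
  refine ⟨V, V⁻¹, fun r => s * (ρ r).1, Matrix.mul_nonsing_inv _ hdet, Matrix.nonsing_inv_mul _ hdet, ?_⟩
  rintro ⟨r, a⟩ ⟨r', b⟩ h
  simp only [hev] at h
  by_cases hr : r = r'
  · subst hr
    rw [hρ r a b (add_right_cancel h)]
  · exfalso
    apply hs
    rw [Finset.mem_image]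
    refine ⟨((r, a), (r', b)), Finset.mem_univ _, ?_⟩
    have : (ρ r).1 - (ρ r').1 ≠ 0 := sub_ne_zero.2 fun h => hr (ρ.injective (Subtype.ext h))
    rw [div_eq_iff this]
    linear_combination -h

theorem transfer (α : Fin D → F) (g : Fin k → MvPolynomial (Fin k) F) (V W : Matrix (Fin k) (Fin k) F)
    (β : Fin k → F) (hVW : V * W = 1) (hWV : W * V = 1) {O S T : Type} [CommRing O] [Algebra F O]
    [CommRing S] [Algebra F S] [CommRing T] [Algebra F T] (em : O →ₐ[F] S) (hem : Function.Injective em)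
    (R t : O) (hR : IsUnit (em R)) (Y : Fin k → O) (z : Fin k → S) (hz : IsZ α g (em t) z)
    (hY : ∀ r, em (Y r) = em R * aeval z (uf V β r)) (ψ : O →ₐ[F] T) (hψ : IsUnit (ψ R)) :
    ∃ w : Fin k → T, IsZ α g (ψ t) w ∧ ∀ r, ψ (Y r) = ψ R * aeval w (uf V β r) := by
  let L := Localization.Away R
  have hu : ∀ {T' : Type} [CommRing T'] [Algebra F T'] (χ : O →ₐ[F] T') (_ : IsUnit (χ R)),
      ∀ y : Submonoid.powers R, IsUnit (χ y) := by
    rintro T' _ _ χ h ⟨_, n, rfl⟩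
    simp only [map_pow]
    exact h.pow n
  let e' : L →ₐ[F] S := IsLocalization.liftAlgHom (M := Submonoid.powers R) (S := L) (f := em) (hu em hR)
  let ψ' : L →ₐ[F] T := IsLocalization.liftAlgHom (M := Submonoid.powers R) (S := L) (f := ψ) (hu ψ hψ)
  have he' : ∀ x, e' (algebraMap O L x) = em x := fun x => IsLocalization.lift_eq _ x
  have hψ' : ∀ x, ψ' (algebraMap O L x) = ψ x := fun x => IsLocalization.lift_eq _ x
  have hinj : Function.Injective e' := by
    have : Function.Injective (IsLocalization.lift (M := Submonoid.powers R) (S := L) (g := em.toRingHom) (hu em hR)) := by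
      rw [IsLocalization.lift_injective_iff]
      intro x y
      constructor
      · intro h
        have := congrArg e' h
        rwa [he', he'] at this
      · intro h
        rw [hem h]
    exact this
  let Ri : L := IsLocalization.Away.invSelf R
  have hRi : algebraMap O L R * Ri = 1 := IsLocalization.Away.mul_invSelf R
  let zt : Fin k → L := fun i => ∑ r, algebraMap F L (W i r) * (algebraMap O L (Y r) * Ri - algebraMap F L (β r))
  have h1 : ∀ i, e' (zt i) = z i := by
    intro i
    have h2 : ∀ r, e' (algebraMap O L (Y r) * Ri - algebraMap F L (β r)) = ∑ i, algebraMap F S (V r i) * z i := by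
      intro r
      have h3 := congrArg e' hRi
      rw [map_mul, he', map_one] at h3
      rw [map_sub, map_mul, he', AlgHom.commutes, hY, aeval_uf]
      linear_combination (∑ i, algebraMap F S (V r i) * z i + algebraMap F S (β r)) * h3
    simp only [zt, map_sum, map_mul, AlgHom.commutes, h2]
    exact mat_cancel W V hWV z i
  have h4 : IsZ α g (algebraMap O L t) zt := by
    apply IsZ.of_map e' hinj
    rw [he', funext h1]
    exact hz
  have h5 : ∀ r, algebraMap O L (Y r) = algebraMap O L R * aeval zt (uf V β r) := by
    intro r
    rw [aeval_uf, mat_cancel V W hVW]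
    linear_combination (-algebraMap O L (Y r)) * hRi
  refine ⟨fun i => ψ' (zt i), ?_, fun r => ?_⟩
  · have := h4.map ψ'
    rwa [hψ'] at this
  · have := congrArg ψ' (h5 r)
    rw [map_mul, hψ', hψ', MvPolynomial.comp_aeval_apply] at this
    exact this

end Forms
end S17
end

section
namespace S17
open MvPolynomial
set_option linter.unusedSectionVars false

lemma monic_eq_prod {S : Type} [CommRing S] [IsDomain S] {ι : Type} [Fintype ι] (p : Polynomial S) (hp : p.Monic)
    (hd : p.natDegree = Fintype.card ι) (y : ι → S) (hy : Function.Injective y) (h : ∀ i, p.eval (y i) = 0) :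
    p = ∏ i, (Polynomial.X - Polynomial.C (y i)) := by
  classical
  have h1 : (Finset.univ.map ⟨y, hy⟩).val ≤ p.roots := by
    rw [Multiset.le_iff_subset (Finset.nodup _)]
    intro x hx
    obtain ⟨i, -, rfl⟩ := Finset.mem_map.1 (show x ∈ Finset.univ.map ⟨y, hy⟩ from hx)
    rw [Polynomial.mem_roots hp.ne_zero]
    exact h i
  have h2 := Multiset.eq_of_le_of_card_le h1 (by
    refine (Polynomial.card_roots' p).trans ?_
    rw [hd, Finset.card_val, Finset.card_map, Finset.card_univ])
  have h3 := Polynomial.prod_multiset_X_sub_C_of_monic_of_roots_card_eq hp (by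
    rw [← h2, hd, Finset.card_val, Finset.card_map, Finset.card_univ])
  rw [← h2] at h3
  rw [← h3]
  simp [Multiset.map_map]

section Pen
variable {F : Type} [Field F] {k D : ℕ}

theorem grp_bound (hk : 0 < k) (α : Fin D → F) (hα : Function.Injective α) (g : Fin k → MvPolynomial (Fin k) F)
    (V W : Matrix (Fin k) (Fin k) F)
    (β : Fin k → F) (hVW : V * W = 1) (hWV : W * V = 1) (R : Polynomial F) (hR : R.coeff 0 = 1)
    (z : (Fin k → Fin D) → Fin k → PowerSeries F) (hz : ∀ a, Ini α a (z a)) (hz' : ∀ a, IsZ α g PowerSeries.X (z a))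
    (y : Fin k × (Fin k → Fin D) → PowerSeries F) (hy : Function.Injective y)
    (hyz : ∀ r a, y (r, a) = algebraMap (Polynomial F) (PowerSeries F) R * aeval (z a) (uf V β r)) :
    Nat.card (Algebra.adjoin (Polynomial F) (Set.range y) ≃ₐ[Polynomial F] Algebra.adjoin (Polynomial F) (Set.range y))
      ≤ (D ^ k).factorial := by
  classical
  set O := Algebra.adjoin (Polynomial F) (Set.range y) with hO
  let Y : Fin k × (Fin k → Fin D) → O := fun i => ⟨y i, Algebra.subset_adjoin ⟨i, rfl⟩⟩
  have hYi : Function.Injective Y := fun a b h => hy (congrArg Subtype.val h)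
  let em : O →ₐ[F] PowerSeries F := O.val.restrictScalars F
  have hem : Function.Injective em := Subtype.val_injective
  have hRu : IsUnit (algebraMap (Polynomial F) (PowerSeries F) R) := by
    rw [PowerSeries.isUnit_iff_constantCoeff, ← PowerSeries.coeff_zero_eq_constantCoeff_apply]
    show IsUnit (PowerSeries.coeff 0 (R : PowerSeries F))
    rw [Polynomial.coeff_coe, hR]
    exact isUnit_one
  have key : ∀ (σ : O ≃ₐ[Polynomial F] O) (a : Fin k → Fin D), ∃ b, ∀ r, σ (Y (r, a)) = Y (r, b) := by
    intro σ a
    have := transfer α g V W β hVW hWV em hem (algebraMap (Polynomial F) O R)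
      (algebraMap (Polynomial F) O Polynomial.X) hRu (fun r => Y (r, a)) (z a)
      (by
        have : em (algebraMap (Polynomial F) O Polynomial.X) = PowerSeries.X := Polynomial.coe_X
        rw [this]; exact hz' a) (fun r => hyz r a) (em.comp (σ.toAlgHom.restrictScalars F)) (by
        show IsUnit (em (σ (algebraMap (Polynomial F) O R)))
        rw [σ.commutes]; exact hRu)
    obtain ⟨w, h1, h2⟩ := this
    have h3 : (em.comp (σ.toAlgHom.restrictScalars F)) (algebraMap (Polynomial F) O Polynomial.X) = PowerSeries.X := by
      show em (σ (algebraMap (Polynomial F) O Polynomial.X)) = _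
      rw [σ.commutes]
      exact Polynomial.coe_X
    rw [h3] at h1
    obtain ⟨b, hb⟩ := ini_exists α g w h1
    have hwb := z_unique α hα g b w (z b) hb (hz b) h1 (hz' b)
    refine ⟨b, fun r => ?_⟩
    apply hem
    have h4 : em (σ (Y (r, a))) = em (σ (algebraMap (Polynomial F) O R)) * aeval w (uf V β r) := h2 r
    rw [h4, σ.commutes, hwb]
    exact (hyz r b).symm
  choose π hπ using key
  have hinj : ∀ σ, Function.Injective (π σ) := by
    intro σ a b h
    have h1 := hπ σ a ⟨0, hk⟩
    rw [h, ← hπ σ b ⟨0, hk⟩] at h1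
    have := hYi (σ.injective h1)
    exact (Prod.ext_iff.1 this).2
  let PI : (O ≃ₐ[Polynomial F] O) → Equiv.Perm (Fin k → Fin D) := fun σ =>
    Equiv.ofBijective (π σ) (Finite.injective_iff_bijective.1 (hinj σ))
  have hPI : Function.Injective PI := by
    intro σ τ h
    have h1 : ∀ a, π σ a = π τ a := fun a => DFunLike.congr_fun h a
    have h2 : (σ : O →ₐ[Polynomial F] O) = τ := by
      apply AlgHom.adjoin_ext
      rintro x ⟨⟨r, a⟩, rfl⟩
      show σ (Y (r, a)) = τ (Y (r, a))
      rw [hπ, hπ, h1]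
    exact AlgEquiv.ext fun x => DFunLike.congr_fun h2 x
  refine (Nat.card_le_card_of_injective PI hPI).trans ?_
  rw [Nat.card_eq_fintype_card, Fintype.card_perm]
  simp

theorem pt_bound (hk : 0 < k) (α : Fin D → F) [Finite F] (g : Fin k → MvPolynomial (Fin k) F)
    (V W : Matrix (Fin k) (Fin k) F)
    (β : Fin k → F) (hVW : V * W = 1) (hWV : W * V = 1) (R : Polynomial F) (hR : R.coeff 0 = 1)
    (z : (Fin k → Fin D) → Fin k → PowerSeries F) (hz' : ∀ a, IsZ α g PowerSeries.X (z a))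
    (y : Fin k × (Fin k → Fin D) → PowerSeries F)
    (hyz : ∀ r a, y (r, a) = algebraMap (Polynomial F) (PowerSeries F) R * aeval (z a) (uf V β r)) (t : F)
    (φ : Algebra.adjoin (Polynomial F) (Set.range y) →ₐ[F] F) (hφt : φ (algebraMap (Polynomial F) _ Polynomial.X) = t)
    (hφ : Function.Injective fun i => φ ⟨y i, Algebra.subset_adjoin ⟨i, rfl⟩⟩) (ht : R.eval t ≠ 0) :
    D ^ k ≤ Nat.card {x : Fin k → F // ∀ i, eval x (f0 α i + C t * g i) = 0} := by
  classical
  let O := Algebra.adjoin (Polynomial F) (Set.range y)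
  let Y : Fin k × (Fin k → Fin D) → O := fun i => ⟨y i, Algebra.subset_adjoin ⟨i, rfl⟩⟩
  let em : O →ₐ[F] PowerSeries F := O.val.restrictScalars F
  have hem : Function.Injective em := Subtype.val_injective
  have hRu : IsUnit (algebraMap (Polynomial F) (PowerSeries F) R) := by
    rw [PowerSeries.isUnit_iff_constantCoeff, ← PowerSeries.coeff_zero_eq_constantCoeff_apply]
    show IsUnit (PowerSeries.coeff 0 (R : PowerSeries F))
    rw [Polynomial.coeff_coe, hR]
    exact isUnit_one
  have hφR : φ (algebraMap (Polynomial F) O R) = R.eval t := by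
    have : φ.comp (IsScalarTower.toAlgHom F (Polynomial F) O) = Polynomial.aeval t := by
      apply Polynomial.algHom_ext
      rw [Polynomial.aeval_X]
      exact hφt
    have := DFunLike.congr_fun this R
    rw [Polynomial.coe_aeval_eq_eval] at this
    exact this
  have key : ∀ a, ∃ w : Fin k → F, IsZ α g t w ∧ ∀ r, φ (Y (r, a)) = R.eval t * aeval w (uf V β r) := by
    intro a
    have := transfer α g V W β hVW hWV em hem (algebraMap (Polynomial F) O R)
      (algebraMap (Polynomial F) O Polynomial.X) hRu (fun r => Y (r, a)) (z a)
      (by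
        have : em (algebraMap (Polynomial F) O Polynomial.X) = PowerSeries.X := Polynomial.coe_X
        rw [this]; exact hz' a) (fun r => hyz r a) φ (by
        rw [hφR]; exact isUnit_iff_ne_zero.2 ht)
    rw [hφR, hφt] at this
    exact this
  choose w hw hw' using key
  have hcard : D ^ k = Nat.card (Fin k → Fin D) := by simp
  rw [hcard]
  refine Nat.card_le_card_of_injective (fun a => ⟨w a, fun i => ?_⟩) ?_
  · have := hw a i
    rw [map_add, map_mul, eval_C]
    rw [← MvPolynomial.coe_aeval_eq_eval]
    exact this
  · intro a b h
    have h1 : w a = w b := congrArg Subtype.val h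
    have h2 : φ (Y (⟨0, hk⟩, a)) = φ (Y (⟨0, hk⟩, b)) := by rw [hw', hw', h1]
    exact (Prod.ext_iff.1 (hφ h2)).2

end Pen

theorem pencil (k D : ℕ) (hk : 0 < k) (hD : 0 < D) : ∃ Q : ℕ, ∀ (F : Type) [Field F] [Fintype F],
    Q ≤ Fintype.card F → ∃ α : Fin D → F, ∀ g : Fin k → MvPolynomial (Fin k) F, (∀ i, (g i).totalDegree ≤ D) →
      6 * Fintype.card F ≤ 6 * (D ^ k).factorial * (Nat.card {t : F // D ^ k ≤
        Nat.card {x : Fin k → F // ∀ i, eval x (f0 α i + C t * g i) = 0}} + nu k D) + Fintype.card F := by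
  classical
  obtain ⟨Q1, hQ1⟩ := forms k D
  obtain ⟨Q2, hQ2⟩ := thmU (k * D ^ k) (k * (D ^ k * nu k D) + 1) (D ^ k).factorial 6 (by omega) (by omega)
  refine ⟨max D (max Q1 Q2), fun F _ _ hF => ?_⟩
  have hF0 : D ≤ Fintype.card F := (le_max_left _ _).trans hF
  have hF1 : Q1 ≤ Fintype.card F := (le_max_left _ _).trans ((le_max_right _ _).trans hF)
  have hF2 : Q2 ≤ Fintype.card F := (le_max_right _ _).trans ((le_max_right _ _).trans hF)
  obtain ⟨α⟩ : Nonempty (Fin D ↪ F) := Function.Embedding.nonempty_of_card_le (by simpa using hF0)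
  have hα := α.injective
  refine ⟨α, fun g hg => ?_⟩
  obtain ⟨V, W, β, hVW, hWV, hinj⟩ := hQ1 F hF1 α hα
  obtain ⟨R, hRd, hR0, hRP⟩ := elim hk hD α g hg
  have hzz := fun a => z_exists α hα g a
  choose z hz hz' using hzz
  choose P hPm hPd hPc hPz using fun r => hRP (uf V β r) (uf_deg V β r)
  let y : Fin k × (Fin k → Fin D) → PowerSeries F :=
    fun ra => algebraMap (Polynomial F) (PowerSeries F) R * aeval (z ra.2) (uf V β ra.1)
  have hyc : ∀ ra, PowerSeries.constantCoeff (y ra) = ∑ i, V ra.1 i * α (ra.2 i) + β ra.1 := by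
    intro ra
    have h1 : PowerSeries.constantCoeff (algebraMap (Polynomial F) (PowerSeries F) R) = 1 := by
      rw [← PowerSeries.coeff_zero_eq_constantCoeff_apply]
      show PowerSeries.coeff 0 (R : PowerSeries F) = 1
      rw [Polynomial.coeff_coe, hR0]
    have h2 : ∀ c : F, PowerSeries.constantCoeff (algebraMap F (PowerSeries F) c) = c :=
      fun c => PowerSeries.constantCoeff_C c
    simp only [y, map_mul, h1, one_mul, aeval_uf, map_add, map_sum, h2]
    simp only [hz ra.2 _]
  have hy : Function.Injective y := by
    intro a b h
    apply hinj
    have := congrArg PowerSeries.constantCoeff h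
    rwa [hyc, hyc] at this
  have hPr : ∀ r, (P r).map (algebraMap (Polynomial F) (PowerSeries F)) =
      ∏ a, (Polynomial.X - Polynomial.C (y (r, a))) := by
    intro r
    apply monic_eq_prod _ ((hPm r).map _)
    · rw [(hPm r).natDegree_map, hPd]; simp
    · intro a b h
      exact (Prod.ext_iff.1 (hy h)).2
    · intro a
      exact hPz r (z a) (hz' a)
  have hW2 : ∏ r, P r ∈ W2 F (k * (D ^ k * nu k D)) := by
    have : ∀ s : Finset (Fin k), ∏ r ∈ s, P r ∈ W2 F (s.card * (D ^ k * nu k D)) := by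
      intro s
      induction s using Finset.induction_on with
      | empty => simpa using W2_one
      | insert i s hi ih =>
        rw [Finset.prod_insert hi, Finset.card_insert_of_notMem hi, add_mul, one_mul, add_comm]
        exact W2_mul _ _ _ _ (hPc i) ih
    simpa using this Finset.univ
  have hU := hQ2 F (Fin k × (Fin k → Fin D)) y (∏ r, P r) (by simp)
    (by rw [Polynomial.map_prod, Fintype.prod_prod_type]; exact Finset.prod_congr rfl fun r _ => hPr r) hy
    (fun i => (hW2 i).trans (Nat.le_succ _))
    (grp_bound hk α hα g V W β hVW hWV R hR0 z hz hz' y hy (fun r a => rfl)) hF2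
  refine hU.trans ?_
  gcongr
  have hR : R ≠ 0 := by rintro rfl; simp at hR0
  refine le_trans ?_ (Nat.add_le_add_left (((Multiset.toFinset_card_le _).trans (Polynomial.card_roots' R)).trans hRd) _)
  rw [← Set.ncard_coe_finset]
  refine le_trans (Set.ncard_le_ncard (t := {t : F | D ^ k ≤
        Nat.card {x : Fin k → F // ∀ i, eval x (f0 α i + C t * g i) = 0}} ∪ (R.roots.toFinset : Set F)) ?_
        (Set.toFinite _)) (Set.ncard_union_le _ _)
  rintro t ⟨φ, h1, h2⟩
  rw [Set.mem_union]
  by_cases hRt : R.eval t = 0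
  · right
    rw [Finset.mem_coe, Multiset.mem_toFinset, Polynomial.mem_roots hR]
    exact hRt
  · left
    exact pt_bound hk α g V W β hVW hWV R hR0 z hz' y (fun r a => rfl) t φ h1 h2 hRt

end S17
end

section
namespace S17
open MvPolynomial

theorem P3proof (k D : ℕ) (hk : 0 < k) (hD : 0 < D) : P3Stmt k D := by
  classical
  obtain ⟨Q, hQ⟩ := pencil k D hk hD
  refine ⟨max Q (6 * (D ^ k).factorial * (1 + nu k D)), fun F _ _ hF => ?_⟩
  obtain ⟨α, hα⟩ := hQ F ((le_max_left _ _).trans hF)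
  have hq : 6 * (D ^ k).factorial * (1 + nu k D) ≤ Fintype.card F := (le_max_right _ _).trans hF
  have hf0 : ∀ i : Fin k, f0 α i ∈ restrictTotalDegree (Fin k) F D := by
    intro i
    rw [mem_restrictTotalDegree, f0_low]
    refine (totalDegree_sub _ _).trans (max_le ((totalDegree_pow _ _).trans (by simp)) ?_)
    exact (td_aeval i _).trans (lowp_deg hD α).le
  have : Finite (restrictTotalDegree (Fin k) F D) := Module.finite_of_finite F
  have : Fintype (restrictTotalDegree (Fin k) F D) := Fintype.ofFinite _
  let G0 : Fin k → restrictTotalDegree (Fin k) F D := fun i => ⟨f0 α i, hf0 i⟩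
  let Good : (Fin k → restrictTotalDegree (Fin k) F D) → Prop :=
    fun f => D ^ k ≤ Nat.card {x : Fin k → F // ∀ i, eval x (f i).1 = 0}
  show 2 * Nat.card (Fin k → restrictTotalDegree (Fin k) F D) ≤ 3 * (D ^ k).factorial * Nat.card {f // Good f}
  let Tg : (Fin k → restrictTotalDegree (Fin k) F D) → ℕ := fun g => Nat.card {t : F // t ≠ 0 ∧ Good (G0 + t • g)}
  have h1 : ∀ g, 6 * Fintype.card F ≤ 6 * (D ^ k).factorial * (Tg g + (1 + nu k D)) + Fintype.card F := by
    intro g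
    refine (hα (fun i => (g i).1) fun i => (mem_restrictTotalDegree _ _ _).1 (g i).2).trans ?_
    rw [← add_assoc]
    gcongr
    have : Nat.card {t : F // D ^ k ≤ Nat.card {x : Fin k → F // ∀ i, eval x (f0 α i + C t * (g i).1) = 0}} ≤
        Set.ncard ({t : F | t ≠ 0 ∧ Good (G0 + t • g)} ∪ {0}) := by
      refine Set.ncard_le_ncard (s := {t : F | D ^ k ≤ Nat.card {x : Fin k → F // ∀ i, eval x (f0 α i + C t * (g i).1) = 0}}) ?_ (Set.toFinite _)
      intro t ht
      by_cases h0 : t = 0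
      · right; exact h0
      · left
        refine ⟨h0, ?_⟩
        have e : ∀ i, ((G0 + t • g) i).1 = f0 α i + C t * (g i).1 := by
          intro i
          show f0 α i + t • (g i).1 = _
          rw [smul_eq_C_mul]
        show D ^ k ≤ Nat.card {x : Fin k → F // ∀ i, eval x ((G0 + t • g) i).1 = 0}
        simp only [e]
        exact ht
    refine this.trans ((Set.ncard_union_le _ _).trans ?_)
    rw [Set.ncard_singleton]
    exact le_rfl
  have h2 : ∑ g, Tg g ≤ Nat.card {f // Good f} * Fintype.card F := by
    rw [← Nat.card_sigma, ← Nat.card_eq_fintype_card (α := F), ← Nat.card_prod]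
    refine Nat.card_le_card_of_injective (fun x => (⟨G0 + x.2.1 • x.1, x.2.2.2⟩, x.2.1)) ?_
    rintro ⟨g, t, ht, h⟩ ⟨g', t', ht', h'⟩ e
    simp only [Prod.mk.injEq, Subtype.mk.injEq] at e
    obtain ⟨e1, rfl⟩ := e
    have e2 := smul_right_injective _ ht (add_left_cancel e1)
    subst e2
    rfl
  have h3 := Finset.sum_le_sum fun g (_ : g ∈ (Finset.univ : Finset (Fin k → restrictTotalDegree (Fin k) F D))) => h1 g
  rw [Finset.sum_add_distrib, ← Finset.mul_sum Finset.univ (fun g => Tg g + (1 + nu k D)), Finset.sum_add_distrib] at h3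
  simp only [Finset.sum_const, Finset.card_univ, smul_eq_mul] at h3
  rw [Nat.card_eq_fintype_card (α := Fin k → restrictTotalDegree (Fin k) F D)]
  set S := Fintype.card (Fin k → restrictTotalDegree (Fin k) F D)
  set q := Fintype.card F
  set Gd := Nat.card {f // Good f}
  set m := (D ^ k).factorial
  have hq0 : 0 < q := Fintype.card_pos
  have h4 : 6 * m * (1 + nu k D) * S ≤ q * S := Nat.mul_le_mul_right _ hq
  have h5 : 6 * m * ∑ g, Tg g ≤ 6 * m * (Gd * q) := Nat.mul_le_mul_left _ h2
  have h6 : q * (2 * S) ≤ q * (3 * m * Gd) := by nlinarith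
  exact Nat.le_of_mul_le_mul_left h6 hq0

end S17
end

/-- Fix `k ≥ 1` and an integer `λ > 1`, and set `d = k² + 2`, `D = λd`.
There exists `Q` such that for every finite field `F` of order `q = Fintype.card F ≥ Q`,
with `n = q^k`: choose `w_1, …, w_k` independently uniform among polynomials in `k`
variables of total degree at most `D`, and independently `p_{i,j}` (for `i ∈ {1,…,k}`,
`j ∈ {1,…,n}`) uniform among polynomials of total degree at most `d`; set
`f_{i,j} = w_i + p_{i,j}`. Then with probability at least `1/(4·(D^k)!)` all three hold:
(i) every tuple `(j_1, …, j_k)` gives at most `D^k` common zeros of `f_{1,j_1},…,f_{k,j_k}`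
in `F^k`; (ii) at least `n^k/(4·(D^k)!)` of the tuples give exactly `D^k` common zeros; and
(iii) every family of `k` pairwise distinct pairs `(i_1,j_1), …, (i_k,j_k)` with
`{i_1,…,i_k} ≠ {1,…,k}` gives at most `D^k/λ` common zeros. The probability is expressed as
counts: the number of joint choices realizing the event is at least `1/(4·(D^k)!)` times
the total number of joint choices. -/
theorem statement_17 (k lam : ℕ) (hk : 0 < k) (hlam : 1 < lam)
    (d D : ℕ) (hd : d = k ^ 2 + 2) (hD : D = lam * d) :
    ∃ Q : ℕ, ∀ (F : Type) [Field F] [Fintype F], Q ≤ Fintype.card F →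
      (1 / (4 * (Nat.factorial (D ^ k) : ℝ))) *
          (Nat.card {wp : (Fin k → MvPolynomial (Fin k) F) ×
              (Fin k → Fin (Fintype.card F ^ k) → MvPolynomial (Fin k) F) //
            (∀ i, (wp.1 i).totalDegree ≤ D) ∧
              ∀ i j, (wp.2 i j).totalDegree ≤ d} : ℝ) ≤
        (Nat.card {wp : (Fin k → MvPolynomial (Fin k) F) ×
            (Fin k → Fin (Fintype.card F ^ k) → MvPolynomial (Fin k) F) //
          ((∀ i, (wp.1 i).totalDegree ≤ D) ∧
            ∀ i j, (wp.2 i j).totalDegree ≤ d) ∧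
          (∀ js : Fin k → Fin (Fintype.card F ^ k),
            Nat.card {x : Fin k → F //
              ∀ i, MvPolynomial.eval x (wp.1 i + wp.2 i (js i)) = 0} ≤ D ^ k) ∧
          (((Fintype.card F : ℝ) ^ k) ^ k / (4 * (Nat.factorial (D ^ k) : ℝ)) ≤
            (Nat.card {js : Fin k → Fin (Fintype.card F ^ k) //
              Nat.card {x : Fin k → F //
                ∀ i, MvPolynomial.eval x (wp.1 i + wp.2 i (js i)) = 0} =
                D ^ k} : ℝ)) ∧
          (∀ idx : Fin k → Fin k × Fin (Fintype.card F ^ k),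
            Function.Injective idx →
            (Set.range fun j => (idx j).1) ≠ Set.univ →
            (Nat.card {x : Fin k → F //
              ∀ j, MvPolynomial.eval x
                (wp.1 (idx j).1 + wp.2 (idx j).1 (idx j).2) = 0} : ℝ) ≤
              (D : ℝ) ^ k / (lam : ℝ))} : ℝ) := by
  exact S17.assembly S17.P3proof k lam hk hlam d D hd hD
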